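/- Let p be a prime with p > 5 and p ∉ {7, 11, 19, 31}. Then PSL(2,p) satisfies the replacement property if and only if p % 8 ∈ {3, 5} and p % 10 ∈ {3, 7} (i.e., p ≡ ±3 mod 8 and p ≡ ±3 mod 10). -/

import Mathlib

section Defs

variable {G : Type*} [Group G]

/-- `g` is a generating sequence of `G`: the set of its entries generates `G`. -/
def IsGenSeq {n : ℕ} (g : Fin n → G) : Prop :=
  Subgroup.closure (Set.range g) = ⊤

/-- `g` is irredundant: for each `i`, the entries other than `g i` do not generate `G`. -/
def IsIrred {n : ℕ} (g : Fin n → G) : Prop :=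
  ∀ i : Fin n, Subgroup.closure (g '' {j | j ≠ i}) ≠ ⊤

/-- `m(G)`: the largest length of an irredundant generating sequence of `G`. -/
noncomputable def maxIrredLen (G : Type*) [Group G] : ℕ :=
  sSup {n | ∃ g : Fin n → G, IsGenSeq g ∧ IsIrred g}

/-- `G` satisfies the replacement property. -/
def ReplacementProperty (G : Type*) [Group G] : Prop :=
  ∀ g : Fin (maxIrredLen G) → G, IsGenSeq g → IsIrred g →
    ∀ x : G, x ≠ 1 → ∃ i, IsGenSeq (Function.update g i x)

/-- `x` is a witness to failure of the replacement property for `G`. -/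
def IsWitnessToFailure {G : Type*} [Group G] (x : G) : Prop :=
  x ≠ 1 ∧ ∃ g : Fin (maxIrredLen G) → G, IsGenSeq g ∧ IsIrred g ∧
    ∀ i, ¬ IsGenSeq (Function.update g i x)

/-- A family of subgroups is in general position. -/
def InGeneralPosition {n : ℕ} (H : Fin n → Subgroup G) : Prop :=
  ∀ j, ¬ ((⨅ i ∈ ({j}ᶜ : Set (Fin n)), H i) ≤ H j)

/-- The sequence of subgroups `M` corresponds to the sequence of elements `g`. -/
def Corresponds {n : ℕ} (M : Fin n → Subgroup G) (g : Fin n → G) : Prop :=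
  (∀ i j, j ≠ i → g i ∈ M j) ∧ ∀ i, g i ∉ M i

end Defs

/-- `PSL(2,p)`. -/
abbrev PSL (p : ℕ) : Type := Matrix.ProjectiveSpecialLinearGroup (Fin 2) (ZMod p)

namespace RPSL

open Matrix

/-- The group `SL(2,p)`. -/
abbrev SLp (p : ℕ) : Type := Matrix.SpecialLinearGroup (Fin 2) (ZMod p)

/-- The subgroup of `SL(2,p)` generated by `s` and `-1`. -/
def gen {p : ℕ} (s : Set (SLp p)) : Subgroup (SLp p) := Subgroup.closure (insert (-1) s)

/-- An irredundant generating sequence of `SL(2,p)` modulo `±1`. -/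
def ISeq {p n : ℕ} (A : Fin n → SLp p) : Prop :=
  gen (Set.range A) = ⊤ ∧ ∀ i, gen (A '' {j | j ≠ i}) ≠ ⊤

section Basics

variable {p : ℕ}

lemma neg_one_mem_gen (s : Set (SLp p)) : (-1 : SLp p) ∈ gen s :=
  Subgroup.subset_closure (Set.mem_insert _ _)

lemma subset_gen (s : Set (SLp p)) : s ⊆ gen s :=
  (Set.subset_insert _ _).trans Subgroup.subset_closure

lemma gen_le {s : Set (SLp p)} {H : Subgroup (SLp p)} : gen s ≤ H ↔ -1 ∈ H ∧ s ⊆ H := by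
  rw [gen, Subgroup.closure_le, Set.insert_subset_iff]; rfl

lemma gen_mono {s t : Set (SLp p)} (h : s ⊆ t) : gen s ≤ gen t :=
  gen_le.2 ⟨neg_one_mem_gen _, h.trans (subset_gen _)⟩

lemma neg_mem_of {H : Subgroup (SLp p)} (h : -1 ∈ H) {A : SLp p} (hA : A ∈ H) : -A ∈ H := by
  simpa using H.mul_mem h hA

lemma neg_mem_iff' {H : Subgroup (SLp p)} (h : -1 ∈ H) {A : SLp p} : -A ∈ H ↔ A ∈ H :=
  ⟨fun hA => by simpa using neg_mem_of h hA, neg_mem_of h⟩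

lemma sl_ext {A B : SLp p} (h00 : A.1 0 0 = B.1 0 0) (h01 : A.1 0 1 = B.1 0 1)
    (h10 : A.1 1 0 = B.1 1 0) (h11 : A.1 1 1 = B.1 1 1) : A = B := by
  apply Subtype.ext
  ext i j
  fin_cases i <;> fin_cases j <;> assumption

lemma mat_ext {R : Type*} {A B : Matrix (Fin 2) (Fin 2) R} (h00 : A 0 0 = B 0 0) (h01 : A 0 1 = B 0 1)
    (h10 : A 1 0 = B 1 0) (h11 : A 1 1 = B 1 1) : A = B := by
  ext i j
  fin_cases i <;> fin_cases j <;> assumption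

lemma sl_det (A : SLp p) : A.1 0 0 * A.1 1 1 - A.1 0 1 * A.1 1 0 = 1 := by
  rw [← Matrix.det_fin_two]; exact A.2

/-- The trace of an element of `SL(2,p)`. -/
def tr (A : SLp p) : ZMod p := A.1 0 0 + A.1 1 1

@[simp] lemma m00 (A B : SLp p) : (A * B).1 0 0 = A.1 0 0 * B.1 0 0 + A.1 0 1 * B.1 1 0 := by
  simp [Matrix.mul_apply, Fin.sum_univ_two]
@[simp] lemma m01 (A B : SLp p) : (A * B).1 0 1 = A.1 0 0 * B.1 0 1 + A.1 0 1 * B.1 1 1 := by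
  simp [Matrix.mul_apply, Fin.sum_univ_two]
@[simp] lemma m10 (A B : SLp p) : (A * B).1 1 0 = A.1 1 0 * B.1 0 0 + A.1 1 1 * B.1 1 0 := by
  simp [Matrix.mul_apply, Fin.sum_univ_two]
@[simp] lemma m11 (A B : SLp p) : (A * B).1 1 1 = A.1 1 0 * B.1 0 1 + A.1 1 1 * B.1 1 1 := by
  simp [Matrix.mul_apply, Fin.sum_univ_two]
@[simp] lemma i00 (A : SLp p) : (A⁻¹).1 0 0 = A.1 1 1 := by
  simp [Matrix.SpecialLinearGroup.coe_inv, Matrix.adjugate_fin_two]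
@[simp] lemma i01 (A : SLp p) : (A⁻¹).1 0 1 = - A.1 0 1 := by
  simp [Matrix.SpecialLinearGroup.coe_inv, Matrix.adjugate_fin_two]
@[simp] lemma i10 (A : SLp p) : (A⁻¹).1 1 0 = - A.1 1 0 := by
  simp [Matrix.SpecialLinearGroup.coe_inv, Matrix.adjugate_fin_two]
@[simp] lemma i11 (A : SLp p) : (A⁻¹).1 1 1 = A.1 0 0 := by
  simp [Matrix.SpecialLinearGroup.coe_inv, Matrix.adjugate_fin_two]
@[simp] lemma n00 (A : SLp p) (i j) : (-A).1 i j = - A.1 i j := by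
  simp [Matrix.SpecialLinearGroup.coe_neg]
@[simp] lemma o00 : (1 : SLp p).1 0 0 = 1 := by simp
@[simp] lemma o01 : (1 : SLp p).1 0 1 = 0 := by simp
@[simp] lemma o10 : (1 : SLp p).1 1 0 = 0 := by simp
@[simp] lemma o11 : (1 : SLp p).1 1 1 = 1 := by simp

lemma cmul (A B : SLp p) : (A * B).1 = A.1 * B.1 := Matrix.SpecialLinearGroup.coe_mul A B
lemma cone : (1 : SLp p).1 = 1 := Matrix.SpecialLinearGroup.coe_one
lemma cneg (A : SLp p) : (-A).1 = -A.1 := Matrix.SpecialLinearGroup.coe_neg A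
lemma cinv_mul (A : SLp p) : (A⁻¹).1 * A.1 = 1 := by rw [← cmul, inv_mul_cancel, cone]
lemma cmul_inv (A : SLp p) : A.1 * (A⁻¹).1 = 1 := by rw [← cmul, mul_inv_cancel, cone]

/-- The element of `SL(2,p)` with given entries. -/
def mk2 (a b c d : ZMod p) (h : a * d - b * c = 1) : SLp p :=
  ⟨!![a, b; c, d], by rw [Matrix.det_fin_two]; simpa using h⟩

@[simp] lemma mk2_00 (a b c d : ZMod p) (h) : (mk2 a b c d h).1 0 0 = a := rfl
@[simp] lemma mk2_01 (a b c d : ZMod p) (h) : (mk2 a b c d h).1 0 1 = b := rfl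
@[simp] lemma mk2_10 (a b c d : ZMod p) (h) : (mk2 a b c d h).1 1 0 = c := rfl
@[simp] lemma mk2_11 (a b c d : ZMod p) (h) : (mk2 a b c d h).1 1 1 = d := rfl

lemma two_ne (hp : 5 < p) : (2 : ZMod p) ≠ 0 := by
  intro h
  have : ((2 : ℕ) : ZMod p) = 0 := by exact_mod_cast h
  rw [ZMod.natCast_eq_zero_iff] at this
  have := Nat.le_of_dvd (by norm_num) this
  omega

variable [Fact p.Prime]

lemma sl_sq_eq_one (hp : 5 < p) {A : SLp p} (h : A * A = 1) : A = 1 ∨ A = -1 := by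
  have h2 := two_ne hp
  have e00 := congrArg (fun X : SLp p => X.1 0 0) h
  have e01 := congrArg (fun X : SLp p => X.1 0 1) h
  have e10 := congrArg (fun X : SLp p => X.1 1 0) h
  have e11 := congrArg (fun X : SLp p => X.1 1 1) h
  have hd := sl_det A
  simp only [m00, m01, m10, m11, o00, o01, o10, o11] at e00 e01 e10 e11
  by_cases ht : A.1 0 0 + A.1 1 1 = 0
  · exfalso; apply h2
    linear_combination (-1) * e00 - hd + A.1 0 0 * ht
  · have b0 : A.1 0 1 = 0 := by
      have : A.1 0 1 * (A.1 0 0 + A.1 1 1) = 0 := by linear_combination e01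
      simpa [ht] using this
    have c0 : A.1 1 0 = 0 := by
      have : A.1 1 0 * (A.1 0 0 + A.1 1 1) = 0 := by linear_combination e10
      simpa [ht] using this
    have a0 : A.1 0 0 = A.1 1 1 := by
      have : (A.1 0 0 - A.1 1 1) * (A.1 0 0 + A.1 1 1) = 0 := by linear_combination e00 - e11
      rcases mul_eq_zero.1 this with h | h
      · exact sub_eq_zero.1 h
      · exact absurd h ht
    have : (A.1 0 0 - 1) * (A.1 0 0 + 1) = 0 := by rw [b0] at e00; linear_combination e00
    rcases mul_eq_zero.1 this with h | h
    · left; apply sl_ext <;> simp only [o00, o01, o10, o11, b0, c0]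
      · linear_combination h
      · rw [← a0]; linear_combination h
    · right; apply sl_ext <;> simp only [n00, o00, o01, o10, o11, b0, c0, neg_zero]
      · linear_combination h
      · rw [← a0]; linear_combination h

lemma one_ne_neg_one (hp : 5 < p) : (1 : SLp p) ≠ -1 := by
  intro h
  have e00 := congrArg (fun X : SLp p => X.1 0 0) h
  simp only [n00, o00] at e00
  exact two_ne hp (by linear_combination e00)

lemma mem_center_iff_pm (hp : 5 < p) {A : SLp p} :
    A ∈ Subgroup.center (SLp p) ↔ A = 1 ∨ A = -1 := by
  constructor
  · intro h
    rw [Matrix.SpecialLinearGroup.mem_center_iff] at h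
    obtain ⟨r, hr, h⟩ := h
    apply sl_sq_eq_one hp
    apply Subtype.ext
    rw [Matrix.SpecialLinearGroup.coe_mul, ← h, ← map_mul]
    simp only [Fintype.card_fin] at hr
    rw [← sq, hr]; simp
  · rintro (rfl | rfl)
    · exact one_mem _
    · rw [Subgroup.mem_center_iff]; intro g; simp

lemma closure_eq_top_iff (hp : 5 < p) (s : Set (SLp p)) :
    Subgroup.closure ((QuotientGroup.mk' (Subgroup.center (SLp p))) '' s) = ⊤ ↔ gen s = ⊤ := by
  set f := QuotientGroup.mk' (Subgroup.center (SLp p))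
  have hsurj : Function.Surjective f := QuotientGroup.mk'_surjective _
  rw [← MonoidHom.map_closure]
  have hk : f.ker = Subgroup.center (SLp p) := QuotientGroup.ker_mk' _
  have h1 : (Subgroup.closure s).map f = (gen s).map f := by
    apply le_antisymm
    · exact Subgroup.map_mono (Subgroup.closure_mono (Set.subset_insert _ _))
    · rw [Subgroup.map_le_iff_le_comap, gen_le, Subgroup.comap_map_eq, hk]
      exact ⟨Subgroup.mem_sup_right ((mem_center_iff_pm hp).2 (Or.inr rfl)),
        Subgroup.subset_closure.trans (SetLike.coe_subset_coe.2 le_sup_left)⟩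
  rw [h1]
  constructor
  · intro h
    have := congrArg (Subgroup.comap f) h
    rw [Subgroup.comap_map_eq, hk, Subgroup.comap_top] at this
    rw [← this, eq_comm, sup_eq_left]
    intro x hx
    rcases (mem_center_iff_pm hp).1 hx with rfl | rfl
    · exact one_mem _
    · exact neg_one_mem_gen _
  · intro h; rw [h]; exact Subgroup.map_top_of_surjective _ hsurj

lemma seq_iff (hp : 5 < p) {n : ℕ} (A : Fin n → SLp p) :
    IsGenSeq (fun i => (A i : PSL p)) ∧ IsIrred (fun i => (A i : PSL p)) ↔ ISeq A := by
  unfold IsGenSeq IsIrred ISeq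
  refine and_congr ?_ (forall_congr' fun i => not_congr ?_)
  · rw [← closure_eq_top_iff hp, ← Set.range_comp]; rfl
  · rw [← closure_eq_top_iff hp, ← Set.image_comp]; rfl

lemma exists_lift {n : ℕ} (g : Fin n → PSL p) : ∃ A : Fin n → SLp p, g = fun i => (A i : PSL p) := by
  choose A hA using fun i => QuotientGroup.mk_surjective (g i)
  exact ⟨A, funext fun i => (hA i).symm⟩

/-- The replacement property for sequences of length three, formulated in `SL(2,p)`. -/
def RP3 (p : ℕ) : Prop :=
  ∀ A : Fin 3 → SLp p, ISeq A → ∀ x : SLp p, x ≠ 1 → x ≠ -1 →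
    ∃ i, gen (Set.range (Function.update A i x)) = ⊤

lemma rp_iff_RP3 (hp : 5 < p) (hlow : ∃ A : Fin 3 → SLp p, ISeq A)
    (hup : ∀ n, 4 ≤ n → ∀ A : Fin n → SLp p, ¬ ISeq A) :
    ReplacementProperty (PSL p) ↔ RP3 p := by
  have hm : maxIrredLen (PSL p) = 3 := by
    unfold maxIrredLen
    apply IsGreatest.csSup_eq
    constructor
    · obtain ⟨A, hA⟩ := hlow
      exact ⟨_, (seq_iff hp A).2 hA⟩
    · rintro n ⟨g, hg⟩
      by_contra hn
      obtain ⟨A, rfl⟩ := exists_lift g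
      exact hup n (by omega) A ((seq_iff hp A).1 hg)
  unfold ReplacementProperty
  rw [hm]
  have hupd : ∀ (A : Fin 3 → SLp p) (i : Fin 3) (x : SLp p),
      Function.update (fun i => (A i : PSL p)) i (x : PSL p) =
        fun j => ((Function.update A i x j : SLp p) : PSL p) := by
    intro A i x
    ext j
    by_cases h : j = i
    · subst h; simp
    · simp [h]
  have hgen : ∀ A : Fin 3 → SLp p, IsGenSeq (fun i => (A i : PSL p)) ↔ gen (Set.range A) = ⊤ := by
    intro A
    unfold IsGenSeq
    rw [← closure_eq_top_iff hp, ← Set.range_comp]; rfl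
  have hone : ∀ x : SLp p, (x : PSL p) = 1 ↔ x = 1 ∨ x = -1 := by
    intro x
    rw [← mem_center_iff_pm hp]
    exact QuotientGroup.eq_one_iff x
  constructor
  · intro h A hA x h1 h2
    obtain ⟨hg, hi⟩ := (seq_iff hp A).2 hA
    obtain ⟨i, hi⟩ := h _ hg hi (x : PSL p) (fun hx => by rcases (hone x).1 hx with h | h <;> tauto)
    refine ⟨i, ?_⟩
    rw [hupd, hgen] at hi
    exact hi
  · intro h g hg hi x hx
    obtain ⟨A, rfl⟩ := exists_lift g
    obtain ⟨x, rfl⟩ := QuotientGroup.mk_surjective x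
    have := mt (hone x).2 hx
    obtain ⟨i, hi⟩ := h A ((seq_iff hp A).1 ⟨hg, hi⟩) x (by tauto) (by tauto)
    exact ⟨i, by rw [hupd, hgen]; exact hi⟩

end Basics

section Types

variable {p : ℕ}

/-- The stabilizer of the line spanned by `v`. -/
def borel (v : Fin 2 → ZMod p) : Subgroup (SLp p) where
  carrier := {A | ∃ c : ZMod p, A.1 *ᵥ v = c • v}
  mul_mem' := by
    rintro A B ⟨c, hc⟩ ⟨d, hd⟩
    refine ⟨d * c, ?_⟩
    rw [cmul, ← mulVec_mulVec, hd, mulVec_smul, hc, smul_smul]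
  one_mem' := ⟨1, by rw [cone]; simp⟩
  inv_mem' := by
    rintro A ⟨c, hc⟩
    have h3 : (A⁻¹).1 = A.1.trace • (1 : Matrix (Fin 2) (Fin 2) (ZMod p)) - A.1 := by
      apply mat_ext <;> simp only [i00, i01, i10, i11] <;> simp [Matrix.trace_fin_two]
    exact ⟨A.1.trace - c, by rw [h3, sub_mulVec, smul_mulVec, one_mulVec, hc, sub_smul]⟩

lemma mem_borel {v : Fin 2 → ZMod p} {A : SLp p} : A ∈ borel v ↔ ∃ c : ZMod p, A.1 *ᵥ v = c • v :=
  Iff.rfl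

/-- The stabilizer of the line spanned by `W` for the conjugation action. -/
def dih (W : Matrix (Fin 2) (Fin 2) (ZMod p)) : Subgroup (SLp p) where
  carrier := {A | A.1 * W = W * A.1 ∨ A.1 * W = -(W * A.1)}
  mul_mem' := by
    rintro A B hA hB
    change (A * B).1 * W = W * (A * B).1 ∨ (A * B).1 * W = -(W * (A * B).1)
    rw [cmul]
    rcases hA with hA | hA <;> rcases hB with hB | hB <;>
      [left; right; right; left] <;>
      rw [mul_assoc, hB] <;> simp only [Matrix.mul_neg, ← mul_assoc, hA] <;> simp
  one_mem' := Or.inl (by rw [cone]; simp)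
  inv_mem' := by
    rintro A hA
    change (A⁻¹).1 * W = W * (A⁻¹).1 ∨ (A⁻¹).1 * W = -(W * (A⁻¹).1)
    have key : (A⁻¹).1 * (A.1 * W) * (A⁻¹).1 = W * (A⁻¹).1 := by
      rw [← mul_assoc, cinv_mul, one_mul]
    have key2 : (A⁻¹).1 * (W * A.1) * (A⁻¹).1 = (A⁻¹).1 * W := by
      rw [mul_assoc, mul_assoc, cmul_inv, mul_one]
    rcases hA with hA | hA
    · left; rw [← key, hA, key2]
    · right; rw [← key, hA, ← key2]; simp only [Matrix.mul_neg, Matrix.neg_mul, neg_neg]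

lemma mem_dih {W : Matrix (Fin 2) (Fin 2) (ZMod p)} {A : SLp p} :
    A ∈ dih W ↔ A.1 * W = W * A.1 ∨ A.1 * W = -(W * A.1) := Iff.rfl

lemma neg_one_mem_borel (v : Fin 2 → ZMod p) : (-1 : SLp p) ∈ borel v :=
  ⟨-1, by rw [cneg, cone]; simp [neg_mulVec]⟩

lemma neg_one_mem_dih (W : Matrix (Fin 2) (Fin 2) (ZMod p)) : (-1 : SLp p) ∈ dih W :=
  Or.inl (by rw [cneg, cone]; simp)

/-- `H` fixes an isotropic line. -/
def PType (H : Subgroup (SLp p)) : Prop := ∃ v, v ≠ 0 ∧ H ≤ borel v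

/-- `H` fixes a nonisotropic line. -/
def DType (H : Subgroup (SLp p)) : Prop :=
  ∃ W : Matrix (Fin 2) (Fin 2) (ZMod p), W.trace = 0 ∧ W.det ≠ 0 ∧ H ≤ dih W

/-- Upper unitriangular elements. -/
def uu (x : ZMod p) : SLp p := mk2 1 x 0 1 (by ring)
/-- Lower unitriangular elements. -/
def ll (x : ZMod p) : SLp p := mk2 1 0 x 1 (by ring)

lemma uu_pow (x : ZMod p) (n : ℕ) : uu x ^ n = uu ((n : ZMod p) * x) := by
  induction n with
  | zero => apply sl_ext <;> simp [uu]
  | succ k ih => rw [pow_succ, ih]; apply sl_ext <;> simp [uu] <;> ring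

variable [Fact p.Prime]

lemma eq_top_of_uu_ll {S : Subgroup (SLp p)} (hu : ∀ x, uu x ∈ S) (hl : ∀ x, ll x ∈ S) : S = ⊤ := by
  have key : ∀ M : SLp p, M.1 1 0 ≠ 0 → M ∈ S := by
    intro M hc
    have : M = uu ((M.1 0 0 - 1) / M.1 1 0) * ll (M.1 1 0) * uu ((M.1 1 1 - 1) / M.1 1 0) := by
      have hd := sl_det M
      apply sl_ext <;> simp [uu, ll] <;> field_simp
      · ring
      · linear_combination -hd
      · ring
    rw [this]
    exact S.mul_mem (S.mul_mem (hu _) (hl _)) (hu _)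
  rw [eq_top_iff]
  intro M _
  by_cases hc : M.1 1 0 = 0
  · have h1 : ll 1 * M ∈ S := by
      apply key
      have hd := sl_det M
      simp [ll, hc]
      intro h0
      simp [h0, hc] at hd
    have : M = (ll 1)⁻¹ * (ll 1 * M) := by group
    rw [this]
    exact S.mul_mem (S.inv_mem (hl _)) h1
  · exact key M hc

lemma eq_top_of_uu {S : Subgroup (SLp p)} {a : ZMod p} (ha : a ≠ 0) (hu : uu a ∈ S) {B : SLp p}
    (hB : B ∈ S) (h0 : B.1 0 0 = 0) : S = ⊤ := by
  have hU : ∀ x, uu x ∈ S := by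
    intro x
    have := S.pow_mem hu (x / a).val
    rwa [uu_pow, ZMod.natCast_zmod_val, div_mul_cancel₀ _ ha] at this
  have hd := sl_det B
  have hc : B.1 1 0 ≠ 0 := by
    intro hc; simp [h0, hc] at hd
  refine eq_top_of_uu_ll hU fun y => ?_
  have : ll y = B * uu (-(y / (B.1 1 0 ^ 2))) * B⁻¹ := by
    rw [h0] at hd
    apply sl_ext <;> simp [uu, ll, h0] <;> field_simp
    · linear_combination -hd
    · ring
    · linear_combination -hd
  rw [this]
  exact S.mul_mem (S.mul_mem hB (hU _)) (S.inv_mem hB)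

lemma mulVec_pair (A : SLp p) (v : Fin 2 → ZMod p) (c : ZMod p) :
    A.1 *ᵥ v = c • v ↔ A.1 0 0 * v 0 + A.1 0 1 * v 1 = c * v 0 ∧
      A.1 1 0 * v 0 + A.1 1 1 * v 1 = c * v 1 := by
  constructor
  · intro h
    have h0 := congrFun h 0
    have h1 := congrFun h 1
    simp [Matrix.mulVec, dotProduct, Fin.sum_univ_two] at h0 h1
    exact ⟨h0, h1⟩
  · rintro ⟨h0, h1⟩
    ext i; fin_cases i
    · simpa [Matrix.mulVec, dotProduct, Fin.sum_univ_two] using h0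
    · simpa [Matrix.mulVec, dotProduct, Fin.sum_univ_two] using h1

lemma vec_ne {v : Fin 2 → ZMod p} (hv : v ≠ 0) : v 0 ≠ 0 ∨ v 1 ≠ 0 := by
  by_contra! h
  exact hv (by ext i; fin_cases i <;> simp [h.1, h.2])

lemma mem_borel_iff {v : Fin 2 → ZMod p} (hv : v ≠ 0) {A : SLp p} : A ∈ borel v ↔
    (A.1 0 0 * v 0 + A.1 0 1 * v 1) * v 1 = (A.1 1 0 * v 0 + A.1 1 1 * v 1) * v 0 := by
  rw [mem_borel]
  constructor
  · rintro ⟨c, hc⟩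
    rw [mulVec_pair] at hc
    rw [hc.1, hc.2]; ring
  · intro h
    rcases vec_ne hv with h0 | h1
    · refine ⟨(A.1 0 0 * v 0 + A.1 0 1 * v 1) / v 0, ?_⟩
      rw [mulVec_pair]
      constructor
      · field_simp
      · field_simp; linear_combination -h
    · refine ⟨(A.1 1 0 * v 0 + A.1 1 1 * v 1) / v 1, ?_⟩
      rw [mulVec_pair]
      constructor
      · field_simp; linear_combination h
      · field_simp

lemma eig_quadratic {v : Fin 2 → ZMod p} (hv : v ≠ 0) {A : SLp p} {c : ZMod p}
    (h : A.1 *ᵥ v = c • v) : c ^ 2 - tr A * c + 1 = 0 := by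
  rw [mulVec_pair] at h
  have hd := sl_det A
  obtain ⟨h0, h1⟩ := h
  unfold tr
  rcases vec_ne hv with h' | h' <;> apply mul_right_cancel₀ h' <;> rw [zero_mul]
  · linear_combination (A.1 1 1 - c) * h0 - A.1 0 1 * h1 - v 0 * hd
  · linear_combination (A.1 0 0 - c) * h1 - A.1 1 0 * h0 - v 1 * hd

lemma tr_neg (A : SLp p) : tr (-A) = - tr A := by simp [tr]; ring

lemma le_borel_aux {H : Subgroup (SLp p)} (hH : H ≠ ⊤) {A : SLp p}
    (hA : A ∈ H) (ht : tr A = 2) (h1 : A ≠ 1) {v : Fin 2 → ZMod p} (hv : v ≠ 0)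
    (hAv : A ∈ borel v) : H ≤ borel v := by
  intro B hB
  by_contra hBv
  apply hH
  obtain ⟨c, hc⟩ := hAv
  have hq := eig_quadratic hv hc
  have hc1 : c = 1 := by
    rw [ht] at hq
    have : (c - 1) ^ 2 = 0 := by linear_combination hq
    exact sub_eq_zero.1 (pow_eq_zero_iff (two_ne_zero) |>.1 this)
  subst hc1
  rw [mulVec_pair] at hc
  rw [mem_borel_iff hv] at hBv
  obtain ⟨e0, e1⟩ := hc
  set x' := B.1 0 0 * v 0 + B.1 0 1 * v 1 with hx'
  set y' := B.1 1 0 * v 0 + B.1 1 1 * v 1 with hy'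
  set D := v 0 * y' - v 1 * x' with hD
  have hD0 : D ≠ 0 := fun h => hBv (by rw [hD] at h; linear_combination -h)
  let P : SLp p := mk2 (v 0) (x' / D) (v 1) (y' / D) (by field_simp; rw [hD]; ring)
  have hPd := sl_det P
  have hP00 : P.1 0 0 = v 0 := rfl
  have hP10 : P.1 1 0 = v 1 := rfl
  have hP01 : P.1 0 1 * D = x' := by simp [P]; field_simp
  have hP11 : P.1 1 1 * D = y' := by simp [P]; field_simp
  let S := H.comap (MulAut.conj P).toMonoidHom
  have hS : ∀ X, P⁻¹ * X * P ∈ S ↔ X ∈ H := by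
    intro X
    simp [S, Subgroup.mem_comap, MulAut.conj_apply, mul_assoc]
  have hStop : S = ⊤ → H = ⊤ := by
    intro h
    rw [eq_top_iff]; intro X _
    rw [← hS, h]; trivial
  apply hStop
  have hA' : P⁻¹ * A * P = uu ((P⁻¹ * A * P).1 0 1) := by
    have d := sl_det (P⁻¹ * A * P)
    have g0 : (P⁻¹ * A * P).1 0 0 = 1 := by
      simp only [m00, m01, m10, m11, i00, i01, i10, i11, hP00, hP10] at *
      linear_combination P.1 1 1 * e0 - P.1 0 1 * e1 + hPd
    have g1 : (P⁻¹ * A * P).1 1 0 = 0 := by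
      simp only [m00, m01, m10, m11, i00, i01, i10, i11, hP00, hP10] at *
      linear_combination -v 1 * e0 + v 0 * e1
    apply sl_ext
    · rw [g0]; rfl
    · rfl
    · rw [g1]; rfl
    · rw [g0, g1] at d; simp only [uu, mk2_11]; linear_combination d
  refine eq_top_of_uu (a := (P⁻¹ * A * P).1 0 1) ?_ ?_ ((hS B).2 hB) ?_
  · intro h0
    rw [h0] at hA'
    have : P⁻¹ * A * P = 1 := by rw [hA']; apply sl_ext <;> simp [uu]
    apply h1
    have h2 : A = P * (P⁻¹ * A * P) * P⁻¹ := by group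
    rw [h2, this]; group
  · rw [← hA']; exact (hS A).2 hA
  · simp only [m00, m01, m10, m11, i00, i01, i10, i11, hP00, hP10]
    apply mul_right_cancel₀ hD0
    linear_combination x' * hP11 - y' * hP01

/-- A proper subgroup with an element of order `p` fixes the line of that element. -/
lemma le_borel {H : Subgroup (SLp p)} (hneg : -1 ∈ H) (hH : H ≠ ⊤) {A : SLp p}
    (hA : A ∈ H) (ht : tr A ^ 2 = 4) (h1 : A ≠ 1) (h2 : A ≠ -1) {v : Fin 2 → ZMod p} (hv : v ≠ 0)
    (hAv : A ∈ borel v) : H ≤ borel v := by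
  have : (tr A - 2) * (tr A + 2) = 0 := by linear_combination ht
  rcases mul_eq_zero.1 this with h | h
  · exact le_borel_aux hH hA (sub_eq_zero.1 h) h1 hv hAv
  · refine le_borel_aux hH (neg_mem_of hneg hA) (by rw [tr_neg]; linear_combination -h) ?_ hv
      (neg_mem_of (neg_one_mem_borel v) hAv)
    intro h'; apply h2; rw [← h', neg_neg]

lemma exists_borel (hp : 5 < p) {A : SLp p} (ht : tr A ^ 2 = 4) : ∃ v, v ≠ 0 ∧ A ∈ borel v := by
  have h2 := two_ne hp
  have hd := sl_det A
  have : (A.1 - (tr A / 2) • (1 : Matrix (Fin 2) (Fin 2) (ZMod p))).det = 0 := by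
    rw [Matrix.det_fin_two]
    simp [tr] at *
    field_simp
    linear_combination -ht + 4 * hd
  obtain ⟨v, hv, h⟩ := Matrix.exists_mulVec_eq_zero_iff.2 this
  refine ⟨v, hv, tr A / 2, ?_⟩
  rw [sub_mulVec, smul_mulVec, one_mulVec, sub_eq_zero] at h
  exact h

end Types

section Orbits

lemma three_orbits_aux {n1 n2 n3 s1 s2 s3 N : ℕ} (h1 : n1 * s1 = N) (h2 : n2 * s2 = N)
    (h3 : n3 * s3 = N) (l1 : 2 ≤ s1) (l12 : s1 ≤ s2) (l23 : s2 ≤ s3)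
    (hn3 : 3 ≤ n3) (hs : n1 + n2 + n3 = N + 2) :
    s1 = 2 ∧ s2 = 3 ∧ (s3 = 3 ∧ N = 12 ∨ s3 = 4 ∧ N = 24 ∨ s3 = 5 ∧ N = 60) := by
  have e1 : s1 = 2 := by
    by_contra h
    have a1 := Nat.mul_le_mul_left n1 (show 3 ≤ s1 by omega)
    have a2 := Nat.mul_le_mul_left n2 (show 3 ≤ s2 by omega)
    have a3 := Nat.mul_le_mul_left n3 (show 3 ≤ s3 by omega)
    omega
  subst e1
  have e2 : s2 = 3 := by
    by_contra h
    rcases Nat.lt_or_ge s2 3 with h' | h'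
    · have : s2 = 2 := by omega
      subst this; omega
    · have a2 := Nat.mul_le_mul_left n2 (show 4 ≤ s2 by omega)
      have a3 := Nat.mul_le_mul_left n3 (show 4 ≤ s3 by omega)
      omega
  subst e2
  have : s3 < 6 := by
    by_contra h
    have a3 := Nat.mul_le_mul_left n3 (show 6 ≤ s3 by omega)
    omega
  interval_cases s3 <;> omega

lemma three_orbits {n1 n2 n3 s1 s2 s3 N : ℕ} (h1 : n1 * s1 = N) (h2 : n2 * s2 = N)
    (h3 : n3 * s3 = N) (l1 : 2 ≤ s1) (l2 : 2 ≤ s2) (l3 : 2 ≤ s3)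
    (hn1 : 3 ≤ n1) (hn2 : 3 ≤ n2) (hn3 : 3 ≤ n3) (hs : n1 + n2 + n3 = N + 2) :
    ∃ s, (s = 3 ∧ N = 12 ∨ s = 4 ∧ N = 24 ∨ s = 5 ∧ N = 60) ∧ (s1 = 2 ∨ s1 = 3 ∨ s1 = s) ∧
      (s2 = 2 ∨ s2 = 3 ∨ s2 = s) ∧ (s3 = 2 ∨ s3 = 3 ∨ s3 = s) := by
  rcases le_total s1 s2 with a | a <;> rcases le_total s2 s3 with b | b <;>
    rcases le_total s1 s3 with c | c
  · obtain ⟨x, y, z⟩ := three_orbits_aux h1 h2 h3 l1 a b hn3 hs; exact ⟨s3, by omega⟩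
  · obtain ⟨x, y, z⟩ := three_orbits_aux h1 h2 h3 l1 a b hn3 hs; exact ⟨s3, by omega⟩
  · obtain ⟨x, y, z⟩ := three_orbits_aux h1 h3 h2 l1 c b hn2 (by omega); exact ⟨s2, by omega⟩
  · obtain ⟨x, y, z⟩ := three_orbits_aux h3 h1 h2 l3 c a hn2 (by omega); exact ⟨s2, by omega⟩
  · obtain ⟨x, y, z⟩ := three_orbits_aux h2 h1 h3 l2 a c hn3 (by omega); exact ⟨s3, by omega⟩
  · obtain ⟨x, y, z⟩ := three_orbits_aux h2 h3 h1 l2 b c hn1 (by omega); exact ⟨s1, by omega⟩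
  · obtain ⟨x, y, z⟩ := three_orbits_aux h3 h2 h1 l3 b a hn1 (by omega); exact ⟨s1, by omega⟩
  · obtain ⟨x, y, z⟩ := three_orbits_aux h3 h2 h1 l3 b a hn1 (by omega); exact ⟨s1, by omega⟩

open MulAction

set_option maxHeartbeats 1000000 in
/-- The orbit count behind the classification of finite rotation groups. -/
lemma rotation_count {G X : Type*} [Group G] [Finite G] [MulAction G X] [Finite X]
    (Z : Subgroup G) (hZ : Nat.card Z = 2) (htriv : ∀ z ∈ Z, ∀ x : X, z • x = x)
    (hfix : ∀ g ∉ Z, Nat.card (fixedBy X g) = 2) (hst : ∀ x : X, ∃ g ∉ Z, g • x = x) :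
    Z = ⊤ ∨ (∃ x y : X, ∀ g : G, g • x = x ∨ g • x = y) ∨
    ∃ s, (s = 3 ∧ Nat.card G = 24 ∨ s = 4 ∧ Nat.card G = 48 ∨ s = 5 ∧ Nat.card G = 120) ∧
      ∀ x : X, ∃ t, Nat.card (stabilizer G x) = 2 * t ∧ (t = 2 ∨ t = 3 ∨ t = s) := by
  classical
  have := Fintype.ofFinite G
  have := Fintype.ofFinite X
  by_cases hZtop : Z = ⊤
  · exact Or.inl hZtop
  right
  have hle : ∀ x : X, Z ≤ stabilizer G x := fun x z hz => htriv z hz x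
  have hs2 : ∀ x : X, ∃ s, 2 ≤ s ∧ Nat.card (stabilizer G x) = 2 * s := by
    intro x
    have hd : 2 ∣ Nat.card (stabilizer G x) := hZ ▸ Subgroup.card_dvd_of_le (hle x)
    obtain ⟨s, hs⟩ := hd
    refine ⟨s, ?_, hs⟩
    have hpos : 0 < Nat.card (stabilizer G x) := Nat.card_pos
    by_contra hlt
    have h1 : Nat.card (stabilizer G x) = Nat.card Z := by omega
    have h2 : Z = stabilizer G x := Subgroup.eq_of_le_of_card_ge (hle x) h1.le
    obtain ⟨g, hg, hgx⟩ := hst x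
    exact hg (h2 ▸ hgx)
  have horb : ∀ x : X, Nat.card (orbit G x) * Nat.card (stabilizer G x) = Nat.card G := by
    intro x
    simp only [Nat.card_eq_fintype_card]
    exact card_orbit_mul_card_stabilizer_eq_card_group G x
  set Ω := Quotient (orbitRel G X)
  have hX : Nat.card X = ∑ ω : Ω, Nat.card (orbit G ω.out) := by
    rw [Nat.card_eq_fintype_card, card_eq_sum_card_group_div_card_stabilizer G X]
    refine Finset.sum_congr rfl fun ω _ => ?_
    rw [← Nat.card_eq_fintype_card, ← Nat.card_eq_fintype_card, ← horb ω.out,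
      Nat.mul_div_cancel _ Nat.card_pos]
  have hB : 2 * Nat.card X + (Nat.card G - 2) * 2 = Fintype.card Ω * Nat.card G := by
    have h1 := sum_card_fixedBy_eq_card_orbits_mul_card_group G X
    rw [Nat.card_eq_fintype_card (α := G), ← h1]
    have h2 : ∀ g : G, Fintype.card (fixedBy X g) = if g ∈ Z then Nat.card X else 2 := by
      intro g
      split_ifs with hg
      · have : fixedBy X g = Set.univ := by
          ext x; simpa using htriv g hg x
        rw [← Nat.card_eq_fintype_card, this]; simp
      · rw [← Nat.card_eq_fintype_card, hfix g hg]
    simp only [h2]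
    rw [Finset.sum_ite, Finset.sum_const, Finset.sum_const, Finset.filter_not,
      Finset.card_sdiff_of_subset (Finset.filter_subset _ _)]
    have h3 : (Finset.univ.filter fun g => g ∈ Z).card = 2 := by
      rw [← hZ, Nat.card_eq_fintype_card, Fintype.card_subtype]
    rw [h3]; simp
  have hfewpts : ∀ x : X, Nat.card (orbit G x) ≤ 2 →
      ∃ x y : X, ∀ g : G, g • x = x ∨ g • x = y := by
    intro x hx
    by_cases hall : ∀ g : G, g • x = x
    · exact ⟨x, x, fun g => Or.inl (hall g)⟩
    · push Not at hall
      obtain ⟨g, hg⟩ := hall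
      refine ⟨x, g • x, fun k => ?_⟩
      by_contra! hk
      have hsub : ({x, g • x, k • x} : Finset X) ⊆ (orbit G x).toFinset := by
        intro y hy
        simp only [Finset.mem_insert, Finset.mem_singleton] at hy
        rw [Set.mem_toFinset]
        rcases hy with rfl | rfl | rfl
        · exact mem_orbit_self _
        · exact mem_orbit _ _
        · exact mem_orbit _ _
      have h3 := Finset.card_le_card hsub
      rw [Set.toFinset_card, ← Nat.card_eq_fintype_card,
        Finset.card_eq_three.2 ⟨x, g • x, k • x, hg.symm, hk.1.symm, hk.2.symm, rfl⟩] at h3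
      omega
  by_cases hfew : ∃ x : X, Nat.card (orbit G x) ≤ 2
  · obtain ⟨x, hx⟩ := hfew
    exact Or.inl (hfewpts x hx)
  right
  push Not at hfew
  have hG : 2 < Nat.card G := by
    by_contra hlt
    apply hZtop
    apply Subgroup.eq_top_of_card_eq
    have := Subgroup.card_dvd_of_le (le_top : Z ≤ ⊤)
    have h4 := Subgroup.card_le_card_group Z
    omega
  have hge : ∀ x : X, 4 * Nat.card (orbit G x) ≤ Nat.card G := by
    intro x
    obtain ⟨s, hs, h⟩ := hs2 x
    rw [← horb x, h, mul_comm]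
    exact Nat.mul_le_mul_left _ (by omega)
  have hXle : 4 * Nat.card X ≤ Fintype.card Ω * Nat.card G := by
    rw [hX, Finset.mul_sum]
    calc _ ≤ ∑ ω : Ω, Nat.card G := Finset.sum_le_sum fun ω _ => hge _
      _ = _ := by simp
  have hXge : 3 * Fintype.card Ω ≤ Nat.card X := by
    rw [hX]
    calc _ = ∑ ω : Ω, 3 := by simp [mul_comm]
      _ ≤ _ := Finset.sum_le_sum fun ω _ => hfew _
  have hk4 : Fintype.card Ω < 4 := by
    by_contra hk
    have := Nat.mul_le_mul_right (Nat.card G) (show 4 ≤ Fintype.card Ω by omega)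
    omega
  have hk3 : Fintype.card Ω = 3 := by
    generalize Fintype.card Ω = k at *
    interval_cases k <;> omega
  let e : Ω ≃ Fin 3 := Fintype.equivFinOfCardEq hk3
  have hsum : Nat.card X = Nat.card (orbit G (e.symm 0).out) + Nat.card (orbit G (e.symm 1).out) +
      Nat.card (orbit G (e.symm 2).out) := by
    rw [hX, ← e.symm.sum_comp, Fin.sum_univ_three]
  have key : ∀ x : X, ∃ s, 2 ≤ s ∧ Nat.card (stabilizer G x) = 2 * s ∧
      2 * (Nat.card (orbit G x) * s) = Nat.card G := by
    intro x
    obtain ⟨s, hs, h⟩ := hs2 x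
    exact ⟨s, hs, h, by rw [← horb x, h]; ring⟩
  choose s hs1 hs2 hs3 using key
  have hgrp : ∃ N, Nat.card G = 2 * N := ⟨_, (hs3 (e.symm 0).out).symm⟩
  obtain ⟨N, hN⟩ := hgrp
  rw [hk3] at hB
  obtain ⟨r, hr, ha, hb, hc⟩ := three_orbits (N := N) (n1 := Nat.card (orbit G (e.symm 0).out))
    (n2 := Nat.card (orbit G (e.symm 1).out)) (n3 := Nat.card (orbit G (e.symm 2).out))
    (s1 := s (e.symm 0).out) (s2 := s (e.symm 1).out) (s3 := s (e.symm 2).out)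
    (by have := hs3 (e.symm 0).out; omega) (by have := hs3 (e.symm 1).out; omega)
    (by have := hs3 (e.symm 2).out; omega) (hs1 _) (hs1 _) (hs1 _) (hfew _) (hfew _) (hfew _)
    (by omega)
  refine ⟨r, by omega, fun x => ⟨_, hs2 x, ?_⟩⟩
  have hω : ∀ ω : Ω, s ω.out = 2 ∨ s ω.out = 3 ∨ s ω.out = r := by
    intro ω
    obtain ⟨i, rfl⟩ := e.symm.surjective ω
    fin_cases i
    · exact ha
    · exact hb
    · exact hc
  have hrel : orbitRel G X x (⟦x⟧ : Ω).out := by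
    have := Quotient.mk_out (s := orbitRel G X) x
    exact (orbitRel G X).symm this
  have hcard : Nat.card (stabilizer G x) = Nat.card (stabilizer G (⟦x⟧ : Ω).out) :=
    Nat.card_congr (stabilizerEquivStabilizerOfOrbitRel hrel).toEquiv
  have : s x = s (⟦x⟧ : Ω).out := by
    have h1 := hs2 x
    have h2 := hs2 (⟦x⟧ : Ω).out
    omega
  rw [this]
  exact hω _

end Orbits

section Classification

variable {p : ℕ}

/-- `A` is central, that is `A = ±1`. -/
def PM (A : SLp p) : Prop := A = 1 ∨ A = -1

lemma pm_one : PM (1 : SLp p) := Or.inl rfl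
lemma pm_neg {A : SLp p} : PM (-A) ↔ PM A := by
  unfold PM
  constructor
  · rintro (h | h)
    · right; rw [← h, neg_neg]
    · left; exact neg_injective h
  · rintro (rfl | rfl) <;> simp

lemma PM.mem {A : SLp p} (h : PM A) {H : Subgroup (SLp p)} (hH : -1 ∈ H) : A ∈ H := by
  rcases h with rfl | rfl
  · exact one_mem _
  · exact hH

lemma PM.mul {A B : SLp p} (hA : PM A) (hB : PM B) : PM (A * B) := by
  rcases hA with rfl | rfl <;> rcases hB with rfl | rfl <;> simp [PM]

lemma PM.comm {A : SLp p} (hA : PM A) (B : SLp p) : A * B = B * A := by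
  rcases hA with rfl | rfl <;> simp

/-- The subgroup of central elements. -/
def pmSub (p : ℕ) : Subgroup (SLp p) where
  carrier := {A | PM A}
  mul_mem' := PM.mul
  one_mem' := pm_one
  inv_mem' := by
    rintro A (rfl | rfl)
    · left; simp
    · right; exact inv_eq_of_mul_eq_one_left (by simp)

lemma pm_iff_entries {A : SLp p} (h1 : A.1 0 1 = 0) (h2 : A.1 1 0 = 0)
    (h3 : A.1 0 0 = A.1 1 1) [Fact p.Prime] : PM A := by
  have hd := sl_det A
  rw [h1, ← h3] at hd
  have : (A.1 0 0 - 1) * (A.1 0 0 + 1) = 0 := by linear_combination hd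
  rcases mul_eq_zero.1 this with h | h
  · left; apply sl_ext <;> simp only [o00, o01, o10, o11, h1, h2, ← h3] <;> linear_combination h
  · right; apply sl_ext <;> simp only [n00, o00, o01, o10, o11, h1, h2, ← h3, neg_zero] <;>
      linear_combination h

/-- A subgroup of exceptional type, with `s` the largest order of an element modulo `±1`. -/
structure EType (s : ℕ) (H : Subgroup (SLp p)) : Prop where
  neg : -1 ∈ H
  notP : ¬ PType H
  notD : ¬ DType H
  pow : ∀ A ∈ H, PM (A ^ 2) ∨ PM (A ^ 3) ∨ PM (A ^ s)
  semisimple : ∀ A ∈ H, tr A ^ 2 = 4 → PM A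
  card : s = 3 ∧ Nat.card H = 24 ∨ s = 4 ∧ Nat.card H = 48 ∨ s = 5 ∧ Nat.card H = 120

variable [Fact p.Prime]

/-- Twice the trace-zero part of `A`. -/
def ax (A : SLp p) : Matrix (Fin 2) (Fin 2) (ZMod p) :=
  !![A.1 0 0 - A.1 1 1, 2 * A.1 0 1; 2 * A.1 1 0, A.1 1 1 - A.1 0 0]

lemma ax_trace (A : SLp p) : (ax A).trace = 0 := by simp [ax, Matrix.trace_fin_two]

lemma ax_eq (A : SLp p) : ax A = (2 : ZMod p) • A.1 - tr A • (1 : Matrix _ _ (ZMod p)) := by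
  apply mat_ext <;> simp [ax, tr] <;> ring

lemma ax_comm (A : SLp p) : A.1 * ax A = ax A * A.1 := by
  rw [ax_eq]; simp [mul_sub, sub_mul]

lemma ax_det (A : SLp p) : (ax A).det = 4 - tr A ^ 2 := by
  have := sl_det A
  rw [Matrix.det_fin_two]; simp [ax, tr]; linear_combination 4 * this

/-- Trace-zero matrices commuting with a noncentral element are proportional to its axis. -/
lemma comm_ax (hp : 5 < p) {A : SLp p} (hA : ¬ PM A) {W : Matrix (Fin 2) (Fin 2) (ZMod p)}
    (hW : W.trace = 0) (h : A.1 * W = W * A.1) : ∃ c : ZMod p, W = c • ax A := by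
  have h2 := two_ne hp
  rw [Matrix.trace_fin_two] at hW
  have h00 := congrFun (congrFun h 0) 0
  have h01 := congrFun (congrFun h 0) 1
  have h10 := congrFun (congrFun h 1) 0
  simp only [Matrix.mul_apply, Fin.sum_univ_two] at h00 h01 h10
  have w4 : W 1 1 = - W 0 0 := by linear_combination hW
  have w1 : A.1 0 1 * W 1 0 = A.1 1 0 * W 0 1 := by linear_combination h00
  have w2 : (A.1 0 0 - A.1 1 1) * W 0 1 = 2 * W 0 0 * A.1 0 1 := by
    linear_combination h01 - A.1 0 1 * hW
  have w3 : (A.1 0 0 - A.1 1 1) * W 1 0 = 2 * W 0 0 * A.1 1 0 := by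
    linear_combination -h10 - A.1 1 0 * hW
  by_cases hb : A.1 0 1 = 0
  · by_cases hc : A.1 1 0 = 0
    · have ha : A.1 0 0 - A.1 1 1 ≠ 0 := fun h => hA (pm_iff_entries hb hc (sub_eq_zero.1 h))
      refine ⟨W 0 0 / (A.1 0 0 - A.1 1 1), ?_⟩
      apply mat_ext <;> simp [ax] <;> field_simp
      · linear_combination w2
      · linear_combination w3
      · rw [w4]; ring
    · refine ⟨W 1 0 / (2 * A.1 1 0), ?_⟩
      apply mat_ext <;> simp [ax] <;> field_simp
      · linear_combination -w3
      · linear_combination -w1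
      · rw [w4]; linear_combination w3
  · refine ⟨W 0 1 / (2 * A.1 0 1), ?_⟩
    apply mat_ext <;> simp [ax] <;> field_simp
    · linear_combination -w2
    · linear_combination w1
    · rw [w4]; linear_combination w2

lemma comm_prop (hp : 5 < p) {A : SLp p} (hA : ¬ PM A) {W X : Matrix (Fin 2) (Fin 2) (ZMod p)}
    (hW : W.trace = 0) (hX : X.trace = 0) (hAW : A.1 * W = W * A.1) (hAX : A.1 * X = X * A.1)
    (hW0 : W ≠ 0) : ∃ c : ZMod p, X = c • W := by
  obtain ⟨w, rfl⟩ := comm_ax hp hA hW hAW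
  obtain ⟨x, rfl⟩ := comm_ax hp hA hX hAX
  have : w ≠ 0 := by rintro rfl; simp at hW0
  exact ⟨x / w, by rw [smul_smul, div_mul_cancel₀ _ this]⟩

lemma exists_nonsquare (hp : 5 < p) : ∃ ν : ZMod p, ν ≠ 0 ∧ ¬ IsSquare ν ∧
    ∀ d : ZMod p, d ≠ 0 → ∃ e : ZMod p, e ≠ 0 ∧ (e ^ 2 * d = 1 ∨ e ^ 2 * d = ν) := by
  have hch : ringChar (ZMod p) ≠ 2 := by
    rw [ZMod.ringChar_zmod_n]; omega
  obtain ⟨ν, hν⟩ := FiniteField.exists_nonsquare hch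
  have hν0 : ν ≠ 0 := by rintro rfl; exact hν (IsSquare.zero)
  refine ⟨ν, hν0, hν, fun d hd => ?_⟩
  by_cases hs : IsSquare d
  · obtain ⟨r, rfl⟩ := hs
    have hr : r ≠ 0 := by rintro rfl; simp at hd
    exact ⟨r⁻¹, inv_ne_zero hr, Or.inl (by field_simp)⟩
  · have h1 := quadraticChar_neg_one_iff_not_isSquare.2 hs
    have h2 := quadraticChar_neg_one_iff_not_isSquare.2 hν
    have h3 : IsSquare (d * ν) := by
      rw [← quadraticChar_one_iff_isSquare (mul_ne_zero hd hν0), map_mul, h1, h2]; norm_num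
    obtain ⟨r, hr⟩ := h3
    have hr0 : r ≠ 0 := by rintro rfl; simp [hd, hν0] at hr
    refine ⟨r / d, div_ne_zero hr0 hd, Or.inr ?_⟩
    field_simp
    linear_combination -hr

lemma pm_card (hp : 5 < p) {H : Subgroup (SLp p)} (hneg : -1 ∈ H) :
    Nat.card ((pmSub p).subgroupOf H) = 2 := by
  have hle : pmSub p ≤ H := fun A hA => PM.mem hA hneg
  rw [Nat.card_congr (Subgroup.subgroupOfEquivOfLe hle).toEquiv]
  have : ((pmSub p : Subgroup (SLp p)) : Set (SLp p)) = {1, -1} := by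
    ext A; rfl
  rw [← SetLike.coe_sort_coe, this, Nat.card_coe_set_eq, Set.ncard_pair (one_ne_neg_one hp)]

set_option maxHeartbeats 1000000 in
theorem classification (hp : 5 < p) {H : Subgroup (SLp p)} (hneg : -1 ∈ H) (hH : H ≠ ⊤) :
    PType H ∨ DType H ∨ ∃ s, EType s H := by
  classical
  by_cases hP : PType H
  · exact Or.inl hP
  right
  by_cases hD : DType H
  · exact Or.inl hD
  right
  have hss : ∀ A ∈ H, tr A ^ 2 = 4 → PM A := by
    intro A hA ht
    by_contra hpm
    obtain ⟨v, hv, hAv⟩ := exists_borel hp ht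
    exact hP ⟨v, hv, le_borel hneg hH hA ht (fun h => hpm (Or.inl h)) (fun h => hpm (Or.inr h)) hv hAv⟩
  obtain ⟨ν, hν0, hν, hrep⟩ := exists_nonsquare hp
  let X := {W : Matrix (Fin 2) (Fin 2) (ZMod p) // W.trace = 0 ∧ (W.det = 1 ∨ W.det = ν) ∧
    ∃ h ∈ H, ¬ PM h ∧ h.1 * W = W * h.1}
  have conj1 : ∀ (g h : SLp p) (W : Matrix (Fin 2) (Fin 2) (ZMod p)), h.1 * W = W * h.1 →
      (g * h * g⁻¹).1 * (g.1 * W * (g⁻¹).1) = (g.1 * W * (g⁻¹).1) * (g * h * g⁻¹).1 := by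
    intro g h W hW
    simp only [cmul]
    calc _ = g.1 * h.1 * ((g⁻¹).1 * g.1) * W * (g⁻¹).1 := by simp only [mul_assoc]
      _ = g.1 * (W * h.1) * (g⁻¹).1 := by rw [cinv_mul, mul_one, mul_assoc g.1 h.1, hW]
      _ = g.1 * W * ((g⁻¹).1 * g.1) * h.1 * (g⁻¹).1 := by
        rw [cinv_mul, mul_one]; simp only [mul_assoc]
      _ = _ := by simp only [mul_assoc]
  have pmconj : ∀ g h : SLp p, PM (g * h * g⁻¹) → PM h := by
    intro g h hh
    have : h = g⁻¹ * (g * h * g⁻¹) * g := by group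
    rw [this, mul_assoc, hh.comm]; simpa using hh
  let act : MulAction H X :=
    { smul := fun g W => ⟨g.1.1 * W.1 * (g.1⁻¹).1, by
        obtain ⟨W, h1, h2, h, hh, hpm, hc⟩ := W
        refine ⟨?_, ?_, g.1 * h * g.1⁻¹, ?_, fun h' => hpm (pmconj _ _ h'), conj1 _ _ _ hc⟩
        · rw [Matrix.trace_mul_comm, ← mul_assoc, cinv_mul, one_mul, h1]
        · rw [Matrix.det_mul, Matrix.det_mul, g.1.2, (g.1⁻¹).2]; simpa using h2
        · exact H.mul_mem (H.mul_mem g.2 hh) (H.inv_mem g.2)⟩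
      one_smul := by
        intro W; apply Subtype.ext
        change (1 : SLp p).1 * W.1 * ((1 : SLp p)⁻¹).1 = W.1
        rw [inv_one, cone]; simp
      mul_smul := by
        intro g h W; apply Subtype.ext
        change (g.1 * h.1).1 * W.1 * ((g.1 * h.1)⁻¹).1 = g.1.1 * (h.1.1 * W.1 * (h.1⁻¹).1) * (g.1⁻¹).1
        rw [_root_.mul_inv_rev, cmul, cmul]; simp only [mul_assoc] }
  have smul_iff : ∀ (g : H) (W W' : X), g • W = W' ↔ g.1.1 * W.1 = W'.1 * g.1.1 := by
    intro g W W'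
    rw [Subtype.ext_iff]
    change g.1.1 * W.1 * (g.1⁻¹).1 = W'.1 ↔ _
    constructor
    · intro h; rw [← h, mul_assoc, cinv_mul, mul_one]
    · intro h; rw [h, mul_assoc, cmul_inv, mul_one]
  have hdet : ∀ W : X, W.1.det ≠ 0 := by
    rintro ⟨W, h1, h2, h3⟩ h0
    rcases h2 with h2 | h2 <;> simp_all
  have hW0 : ∀ W : X, W.1 ≠ 0 := by
    intro W h; apply hdet W; rw [h, Matrix.det_fin_two]; simp
  let ng : X → X := fun W => ⟨-W.1, by
    obtain ⟨W, h1, h2, h, hh, hpm, hc⟩ := W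
    refine ⟨by simp [h1], ?_, h, hh, hpm, by simp [hc]⟩
    have : (-W).det = W.det := by simp [Matrix.det_fin_two]
    simpa [this] using h2⟩
  have h2 := two_ne hp
  have hng : ∀ W : X, ng W ≠ W := by
    intro W h
    have h' : -W.1 = W.1 := congrArg Subtype.val h
    apply hW0 W
    ext i j
    have := congrFun (congrFun h' i) j
    simp only [Matrix.neg_apply] at this
    have : 2 * W.1 i j = 0 := by linear_combination -this
    simpa [h2] using this
  have huniq : ∀ (g : H), ¬ PM g.1 → ∀ W W' : X, g • W = W → g • W' = W' → W' = W ∨ W' = ng W := by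
    intro g hg W W' hW hW'
    rw [smul_iff] at hW hW'
    obtain ⟨c, hc⟩ := comm_prop hp hg W.2.1 W'.2.1 hW hW' (hW0 W)
    have hd : W'.1.det = c ^ 2 * W.1.det := by rw [hc, Matrix.det_smul]; simp
    have : c ^ 2 = 1 := by
      have hd1 := W.2.2.1
      have hd2 := W'.2.2.1
      rcases hd1 with a | a <;> rcases hd2 with b | b <;> rw [a, b] at hd
      · linear_combination -hd
      · exact absurd ⟨c, by linear_combination hd⟩ hν
      · exfalso
        have hc0 : c ≠ 0 := by rintro rfl; simp at hd
        exact hν ⟨c⁻¹, by field_simp; linear_combination -hd⟩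
      · apply mul_right_cancel₀ hν0; linear_combination -hd
    have : (c - 1) * (c + 1) = 0 := by linear_combination this
    rcases mul_eq_zero.1 this with h | h
    · left; apply Subtype.ext; rw [hc, sub_eq_zero.1 h, one_smul]
    · right; apply Subtype.ext; rw [hc, eq_neg_of_add_eq_zero_left h]; simp [ng]
  have hngfix : ∀ (g : H) (W : X), g • W = W → g • (ng W) = ng W := by
    intro g W h; rw [smul_iff] at *; simp [ng, h]
  have hexist : ∀ g : H, ¬ PM g.1 → ∃ W : X, g • W = W := by
    intro g hg
    have hd : (ax g.1).det ≠ 0 := by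
      rw [ax_det]; intro h; exact hg (hss _ g.2 (by linear_combination -h))
    obtain ⟨e, he, h⟩ := hrep _ hd
    refine ⟨⟨e • ax g.1, ?_, ?_, g.1, g.2, hg, ?_⟩, ?_⟩
    · rw [Matrix.trace_smul, ax_trace, smul_zero]
    · rw [Matrix.det_smul]; simpa using h
    · simp [ax_comm]
    · rw [smul_iff]; simp [ax_comm]
  have t1 : ∀ z ∈ (pmSub p).subgroupOf H, ∀ W : X, z • W = W := by
    intro z hz W
    rw [smul_iff]
    have : PM z.1 := hz
    rcases this with h | h <;> rw [h]
    · rw [cone]; simp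
    · rw [cneg, cone]; simp
  have t2 : ∀ g ∉ (pmSub p).subgroupOf H, Nat.card (MulAction.fixedBy X g) = 2 := by
    intro g hg
    obtain ⟨W, hW⟩ := hexist g hg
    have : MulAction.fixedBy X g = {W, ng W} := by
      ext W'
      simp only [MulAction.mem_fixedBy, Set.mem_insert_iff, Set.mem_singleton_iff]
      constructor
      · exact huniq g hg W W' hW
      · rintro (rfl | rfl)
        · exact hW
        · exact hngfix g W hW
    rw [this, Nat.card_coe_set_eq, Set.ncard_pair (hng W).symm]
  have t3 : ∀ W : X, ∃ g ∉ (pmSub p).subgroupOf H, g • W = W := by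
    intro W
    obtain ⟨h, hh, hpm, hc⟩ := W.2.2.2
    exact ⟨⟨h, hh⟩, hpm, by rw [smul_iff]; exact hc⟩
  rcases rotation_count (G := H) (X := X) ((pmSub p).subgroupOf H) (pm_card hp hneg) t1 t2 t3 with
    h | ⟨x, y, h⟩ | ⟨s, hs, h⟩
  · exfalso; apply hP
    refine ⟨![1, 0], by simp, fun A hA => ?_⟩
    have : (⟨A, hA⟩ : H) ∈ (pmSub p).subgroupOf H := by rw [h]; trivial
    exact PM.mem this (neg_one_mem_borel _)
  · exfalso; apply hD
    refine ⟨x.1, x.2.1, hdet x, fun A hA => ?_⟩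
    obtain ⟨-, -, k, hk, hkpm, hkx⟩ := x.2
    have hkx' : (⟨k, hk⟩ : H) • x = x := by rw [smul_iff]; exact hkx
    rcases h ⟨A, hA⟩ with h1 | h1
    · rw [smul_iff] at h1; exact Or.inl h1
    · have hky : (⟨k, hk⟩ : H) • y = y := by
        rw [← h1, ← mul_smul]
        rcases h (⟨k, hk⟩ * ⟨A, hA⟩) with h3 | h3
        · have h4 : (⟨A, hA⟩ : H) • x = x := by
            rw [mul_smul] at h3
            conv_rhs at h3 => rw [← hkx']
            exact MulAction.injective _ h3
          rw [h4, h3]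
        · rw [h3, h1]
      rcases huniq _ hkpm x y hkx' hky with h5 | h5
      · rw [h5, smul_iff] at h1; exact Or.inl h1
      · rw [h5, smul_iff] at h1; right; simpa [ng] using h1
  · refine ⟨s, hneg, hP, hD, fun A hA => ?_, hss, hs⟩
    by_cases hpm : PM A
    · left; rw [sq]; exact hpm.mul hpm
    obtain ⟨W, hW⟩ := hexist ⟨A, hA⟩ hpm
    obtain ⟨t, ht, ht'⟩ := h W
    have hpow : A ^ (2 * t) = 1 := by
      have : (⟨⟨A, hA⟩, hW⟩ : MulAction.stabilizer H W) ^ Nat.card (MulAction.stabilizer H W) = 1 :=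
        pow_card_eq_one'
      rw [ht] at this
      exact congrArg (fun z : MulAction.stabilizer H W => z.1.1) this
    have : PM (A ^ t) := by
      apply sl_sq_eq_one hp
      rw [← pow_add, ← two_mul, hpow]
    rcases ht' with rfl | rfl | rfl
    · exact Or.inl this
    · exact Or.inr (Or.inl this)
    · exact Or.inr (Or.inr this)

end Classification

section Proper

variable {p : ℕ} [Fact p.Prime]

lemma gen_image_le {n : ℕ} {A : Fin n → SLp p} {i : Fin n} {H : Subgroup (SLp p)} :
    gen (A '' {j | j ≠ i}) ≤ H ↔ -1 ∈ H ∧ ∀ j, j ≠ i → A j ∈ H := by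
  rw [gen_le, Set.image_subset_iff]; rfl

lemma gen_range_le {n : ℕ} {A : Fin n → SLp p} {H : Subgroup (SLp p)} :
    gen (Set.range A) ≤ H ↔ -1 ∈ H ∧ ∀ j, A j ∈ H := by
  rw [gen_le, Set.range_subset_iff]; rfl

lemma DType.ne_top (hp : 5 < p) {H : Subgroup (SLp p)} (hH : DType H) : H ≠ ⊤ := by
  rintro rfl
  have h2 := two_ne hp
  obtain ⟨W, ht, hd, hle⟩ := hH
  rw [Matrix.trace_fin_two] at ht
  rw [Matrix.det_fin_two] at hd
  have hu : uu 1 ∈ dih W := hle trivial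
  rw [mem_dih] at hu
  rcases hu with h | h
  · have h00 := congrFun (congrFun h 0) 0
    have h01 := congrFun (congrFun h 0) 1
    simp [Matrix.mul_apply, Fin.sum_univ_two, uu] at h00 h01
    have h3 : 2 * W 0 0 = 0 := by linear_combination ht - h01
    have h4 : W 0 0 = 0 := by simpa [h2] using h3
    apply hd; rw [h4, h00]; ring
  · have h00 := congrFun (congrFun h 0) 0
    have h10 := congrFun (congrFun h 1) 0
    simp [Matrix.mul_apply, Fin.sum_univ_two, uu] at h00 h10
    have h3 : 2 * W 1 0 = 0 := by linear_combination h10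
    have h4 : W 1 0 = 0 := by simpa [h2] using h3
    have h5 : 2 * W 0 0 = 0 := by linear_combination h00 - h4
    have h6 : W 0 0 = 0 := by simpa [h2] using h5
    apply hd; rw [h4, h6]; ring

lemma involutions_mem_dih {A B : SLp p} (hA : tr A = 0) (hB : tr B = 0)
    (hAB : tr (A * B) ^ 2 ≠ 4) : ∃ W : Matrix (Fin 2) (Fin 2) (ZMod p), W.trace = 0 ∧ W.det ≠ 0 ∧
      A ∈ dih W ∧ B ∈ dih W := by
  have dA := sl_det A
  have dB := sl_det B
  simp only [tr, m00, m11] at hA hB hAB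
  have a11 : A.1 1 1 = - A.1 0 0 := by linear_combination hA
  have b11 : B.1 1 1 = - B.1 0 0 := by linear_combination hB
  rw [a11] at hAB dA; rw [b11] at hAB dB
  refine ⟨A.1 * B.1 - B.1 * A.1, ?_, ?_, Or.inr ?_, Or.inr ?_⟩
  · rw [Matrix.trace_sub, Matrix.trace_mul_comm, sub_self]
  · rw [Matrix.det_fin_two]
    simp only [Matrix.sub_apply, Matrix.mul_apply, Fin.sum_univ_two, a11, b11]
    intro h; apply hAB
    linear_combination (-1) * h + 4 * dA * (-B.1 0 0 ^ 2 - B.1 0 1 * B.1 1 0) + 4 * dB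
  · rw [mul_sub, sub_mul]
    have e : A.1 * A.1 = -1 := by
      apply mat_ext <;> simp [Matrix.mul_apply, Fin.sum_univ_two, a11] <;> first | ring1 | linear_combination -dA | linear_combination dA

    rw [← mul_assoc, mul_assoc B.1 A.1 A.1, e, ← mul_assoc]; simp [sub_eq_add_neg]
  · rw [mul_sub, sub_mul]
    have e : B.1 * B.1 = -1 := by
      apply mat_ext <;> simp [Matrix.mul_apply, Fin.sum_univ_two, b11] <;> first | ring1 | linear_combination -dB | linear_combination dB

    rw [← mul_assoc, ← mul_assoc, mul_assoc A.1 B.1 B.1, e]; simp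

lemma natCast_ne {n : ℕ} (h0 : n ≠ 0) (h : ¬ p ∣ n) : (n : ZMod p) ≠ 0 := by
  rwa [Ne, ZMod.natCast_eq_zero_iff]

lemma exists_iseq_three (hp : 5 < p) : ∃ A : Fin 3 → SLp p, ISeq A := by
  have h2 := two_ne hp
  have h5 : (5 : ZMod p) ≠ 0 := by
    have := natCast_ne (p := p) (n := 5) (by norm_num)
      (fun h => by have := Nat.le_of_dvd (by norm_num) h; omega)
    exact_mod_cast this
  have h3 : (3 : ZMod p) ≠ 0 := by
    have := natCast_ne (p := p) (n := 3) (by norm_num)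
      (fun h => by have := Nat.le_of_dvd (by norm_num) h; omega)
    exact_mod_cast this
  let a : SLp p := mk2 0 1 (-1) 0 (by ring)
  let b : SLp p := mk2 1 1 (-2) (-1) (by ring)
  let c : SLp p := mk2 1 2 (-1) (-1) (by ring)
  have ha : tr a = 0 := by simp [tr, a]
  have hb : tr b = 0 := by simp [tr, b]
  have hc : tr c = 0 := by simp [tr, c]
  have key : ∀ t : ZMod p, t = -3 → t ^ 2 ≠ 4 := by
    rintro t rfl h; apply h5; linear_combination h
  have hab : tr (a * b) ^ 2 ≠ 4 := key _ (by simp [tr, a, b]; ring)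
  have hac : tr (a * c) ^ 2 ≠ 4 := key _ (by simp [tr, a, c]; ring)
  have hbc : tr (b * c) ^ 2 ≠ 4 := key _ (by simp [tr, b, c]; ring)
  refine ⟨![a, b, c], ?_, ?_⟩
  · by_contra hne
    have hm : ∀ i, (![a, b, c] : Fin 3 → SLp p) i ∈ gen (Set.range ![a, b, c]) :=
      fun i => subset_gen _ ⟨i, rfl⟩
    have hma : a ∈ gen (Set.range ![a, b, c]) := hm 0
    have hu := mul_mem (mul_mem hma (hm 1)) (hm 2)
    have hv : (![1, 0] : Fin 2 → ZMod p) ≠ 0 := by simp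
    have hle := le_borel (neg_one_mem_gen _) hne hu (v := ![1, 0]) ?_ ?_ ?_ hv ?_
    · have := hle hma
      rw [mem_borel_iff hv] at this
      simp [a] at this
    · simp [tr, a, b, c]; ring
    · intro h
      have := congrArg (fun X : SLp p => X.1 0 1) h
      simp only [o01] at this
      simp [a, b, c] at this
      apply h3; linear_combination -this
    · intro h
      have := congrArg (fun X : SLp p => X.1 0 1) h
      simp only [n00, o01] at this
      simp [a, b, c] at this
      apply h3; linear_combination -this
    · rw [mem_borel_iff hv]
      simp [a, b, c]
  · have main : ∀ {x y : SLp p}, tr x = 0 → tr y = 0 → tr (x * y) ^ 2 ≠ 4 → ∀ i : Fin 3,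
        (∀ j, j ≠ i → (![a, b, c] : Fin 3 → SLp p) j = x ∨ (![a, b, c] : Fin 3 → SLp p) j = y) →
        gen ((![a, b, c] : Fin 3 → SLp p) '' {j | j ≠ i}) ≠ ⊤ := by
      intro x y hx hy hxy i hi
      obtain ⟨W, h1, h2, hxW, hyW⟩ := involutions_mem_dih hx hy hxy
      have : DType (gen ((![a, b, c] : Fin 3 → SLp p) '' {j | j ≠ i})) := by
        refine ⟨W, h1, h2, gen_image_le.2 ⟨neg_one_mem_dih _, fun j hj => ?_⟩⟩
        rcases hi j hj with h | h <;> rw [h] <;> assumption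
      exact this.ne_top hp
    intro i
    fin_cases i
    · refine main hb hc hbc _ fun j hj => ?_
      fin_cases j <;> simp at hj ⊢
    · refine main ha hc hac _ fun j hj => ?_
      fin_cases j <;> simp at hj ⊢
    · refine main ha hb hab _ fun j hj => ?_
      fin_cases j <;> simp at hj ⊢

/-- The elements mapping the finite set `S` to itself by conjugation. -/
def permSub (S : Finset (Matrix (Fin 2) (Fin 2) (ZMod p))) : Subgroup (SLp p) where
  carrier := {A | ∀ W ∈ S, ∃ W' ∈ S, A.1 * W = W' * A.1}
  mul_mem' := by
    intro A B hA hB W hW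
    obtain ⟨W', hW', h1⟩ := hB W hW
    obtain ⟨W'', hW'', h2⟩ := hA W' hW'
    exact ⟨W'', hW'', by rw [cmul, mul_assoc, h1, ← mul_assoc, h2, mul_assoc]⟩
  one_mem' := fun W hW => ⟨W, hW, by rw [cone]; simp⟩
  inv_mem' := by
    intro A hA
    have hmap : Set.MapsTo (fun W => A.1 * W * (A⁻¹).1) (S : Set (Matrix (Fin 2) (Fin 2) (ZMod p))) S := by
      intro W hW
      obtain ⟨W', hW', h1⟩ := hA W hW
      change A.1 * W * (A⁻¹).1 ∈ S
      rwa [h1, mul_assoc, cmul_inv, mul_one]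
    have hinj : Set.InjOn (fun W => A.1 * W * (A⁻¹).1) (S : Set (Matrix (Fin 2) (Fin 2) (ZMod p))) := by
      intro X _ Y _ h
      have h' : A.1 * X * (A⁻¹).1 = A.1 * Y * (A⁻¹).1 := h
      have : (A⁻¹).1 * (A.1 * X * (A⁻¹).1) * A.1 = (A⁻¹).1 * (A.1 * Y * (A⁻¹).1) * A.1 := by rw [h']
      simpa only [← mul_assoc, cinv_mul, one_mul, mul_assoc _ (A⁻¹).1 A.1, mul_one] using this
    have hsurj := Finset.surjOn_of_injOn_of_card_le _ hmap hinj le_rfl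
    intro W hW
    obtain ⟨W', hW', h⟩ := hsurj hW
    refine ⟨W', hW', ?_⟩
    change A.1 * W' * (A⁻¹).1 = W at h
    rw [← h, ← mul_assoc, ← mul_assoc, cinv_mul, one_mul]

lemma permSub_ne_top (hp : 5 < p) {S : Finset (Matrix (Fin 2) (Fin 2) (ZMod p))} (hc : S.card < p)
    {W : Matrix (Fin 2) (Fin 2) (ZMod p)} (hW : W ∈ S) (ht : W.trace = 0) (hd : W.det ≠ 0) :
    permSub S ≠ ⊤ := by
  intro htop
  have h2 := two_ne hp
  have hmem : ∀ A, A ∈ permSub S := fun A => htop ▸ trivial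
  choose f hf hf' using fun x : ZMod p => hmem (uu x) W hW
  obtain ⟨x, -, y, -, hxy, h⟩ := Finset.exists_ne_map_eq_of_card_lt_of_maps_to
    (s := (Finset.univ : Finset (ZMod p))) (t := S) (f := f)
    (by rwa [Finset.card_univ, ZMod.card]) (fun x _ => hf x)
  have hx := hf' x
  have hy := hf' y
  rw [h] at hx
  rw [Matrix.trace_fin_two] at ht
  rw [Matrix.det_fin_two] at hd
  have x00 := congrFun (congrFun hx 0) 0
  have x01 := congrFun (congrFun hx 0) 1
  have y00 := congrFun (congrFun hy 0) 0
  have y01 := congrFun (congrFun hy 0) 1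
  simp [Matrix.mul_apply, Fin.sum_univ_two, uu] at x00 x01 y00 y01
  have hne := sub_ne_zero.2 hxy
  have c0 : W 1 0 = 0 := by
    have : (x - y) * W 1 0 = 0 := by linear_combination x00 - y00
    simpa [hne] using this
  have a0 : W 0 0 = 0 := by
    have : 2 * ((x - y) * W 0 0) = 0 := by
      linear_combination y01 - x01 + x * x00 - y * y00 + (x - y) * ht + (y^2-x^2) * c0
    simpa [hne, h2] using this
  apply hd; rw [a0, c0]; ring

lemma permSub_conj {S : Finset (Matrix (Fin 2) (Fin 2) (ZMod p))}
    {N : Matrix (Fin 2) (Fin 2) (ZMod p)} (hN : N.det ≠ 0) {A B : SLp p} (hB : B ∈ permSub S)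
    (h : A.1 * N = N * B.1 ∨ A.1 * N = -(N * B.1)) :
    A ∈ permSub (S.image fun W => N * W * N.adjugate) := by
  intro W hW
  obtain ⟨W0, hW0, rfl⟩ := Finset.mem_image.1 hW
  obtain ⟨W', hW', h'⟩ := hB W0 hW0
  refine ⟨_, Finset.mem_image_of_mem _ hW', ?_⟩
  have e1 := Matrix.mul_adjugate N
  have e2 := Matrix.adjugate_mul N
  rcases h with h | h
  · have h3 : N.adjugate * A.1 = B.1 * N.adjugate := by
      have : N.adjugate * (A.1 * N) * N.adjugate = N.adjugate * (N * B.1) * N.adjugate := by rw [h]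
      rw [mul_assoc, mul_assoc A.1, e1, ← mul_assoc N.adjugate N, e2] at this
      simpa [hN] using this
    calc A.1 * (N * W0 * N.adjugate) = (A.1 * N) * W0 * N.adjugate := by simp only [mul_assoc]
      _ = N * (B.1 * W0) * N.adjugate := by rw [h]; simp only [mul_assoc]
      _ = N * W' * (B.1 * N.adjugate) := by rw [h']; simp only [mul_assoc]
      _ = _ := by rw [← h3]; simp only [mul_assoc]
  · have h3 : N.adjugate * A.1 = -(B.1 * N.adjugate) := by
      have : N.adjugate * (A.1 * N) * N.adjugate = N.adjugate * (-(N * B.1)) * N.adjugate := by rw [h]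
      rw [mul_assoc, mul_assoc A.1, e1, Matrix.mul_neg, ← mul_assoc N.adjugate N, e2] at this
      have h4 : N.det • (N.adjugate * A.1) = N.det • -(B.1 * N.adjugate) := by simpa using this
      exact smul_right_injective _ hN h4
    calc A.1 * (N * W0 * N.adjugate) = (A.1 * N) * W0 * N.adjugate := by simp only [mul_assoc]
      _ = -(N * (B.1 * W0) * N.adjugate) := by rw [h]; simp only [mul_assoc, Matrix.neg_mul]
      _ = -(N * W' * (B.1 * N.adjugate)) := by rw [h']; simp only [mul_assoc]
      _ = _ := by rw [← Matrix.mul_neg, ← h3]; simp only [mul_assoc]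

end Proper

section Powers

variable {p : ℕ} [Fact p.Prime]

lemma pm_of_offdiag {A B : SLp p} {u : ZMod p} (hu : u ≠ 0) (h01 : B.1 0 1 = u * A.1 0 1)
    (h10 : B.1 1 0 = u * A.1 1 0) (hd : B.1 0 0 - B.1 1 1 = u * (A.1 0 0 - A.1 1 1)) (hB : PM B) :
    PM A := by
  have key : B.1 0 1 = 0 ∧ B.1 1 0 = 0 ∧ B.1 0 0 - B.1 1 1 = 0 := by
    rcases hB with rfl | rfl <;> simp
  rw [h01, h10, hd] at key
  simp only [mul_eq_zero, hu, false_or] at key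
  exact pm_iff_entries key.1 key.2.1 (sub_eq_zero.1 key.2.2)

lemma tr_eq_of_pow_two {A : SLp p} (hA : ¬ PM A) (h : PM (A ^ 2)) : tr A = 0 := by
  by_contra ht
  refine hA (pm_of_offdiag ht ?_ ?_ ?_ h) <;> simp only [pow_two, m00, m01, m10, m11, tr] <;> ring

lemma tr_eq_of_pow_three {A : SLp p} (hA : ¬ PM A) (h : PM (A ^ 3)) : tr A ^ 2 = 1 := by
  by_contra ht
  have hd := sl_det A
  refine hA (pm_of_offdiag (sub_ne_zero.2 ht) ?_ ?_ ?_ h) <;>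
    simp only [pow_succ, pow_zero, one_mul, m00, m01, m10, m11, tr]
  · linear_combination (-A.1 0 1) * hd
  · linear_combination (-A.1 1 0) * hd
  · linear_combination (A.1 1 1 - A.1 0 0) * hd

lemma tr_eq_of_pow_four {A : SLp p} (hA : ¬ PM A) (h : PM (A ^ 4)) : tr A = 0 ∨ tr A ^ 2 = 2 := by
  by_cases h2 : PM (A ^ 2)
  · exact Or.inl (tr_eq_of_pow_two hA h2)
  · right
    rw [show 4 = 2 * 2 from rfl, pow_mul] at h
    have := tr_eq_of_pow_two h2 h
    have hd := sl_det A
    simp only [pow_two, m00, m11, tr] at this ⊢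
    linear_combination this + 2 * hd

lemma tr_eq_of_pow_five {A : SLp p} (hA : ¬ PM A) (h : PM (A ^ 5)) :
    tr A ^ 4 - 3 * tr A ^ 2 + 1 = 0 := by
  by_contra ht
  have hd := sl_det A
  have e2 : (A ^ 2).1 = tr A • A.1 - 1 := by
    apply mat_ext <;> simp [pow_two, tr, Matrix.one_apply, -Matrix.SpecialLinearGroup.coe_mul]
    · linear_combination -hd
    · ring
    · ring
    · linear_combination -hd
  have e4 : (A ^ 4).1 = (tr A ^ 3 - 2 * tr A) • A.1 - (tr A ^ 2 - 1) • 1 := by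
    rw [show A ^ 4 = A ^ 2 * A ^ 2 by rw [← pow_add], cmul, e2]
    have : A.1 * A.1 = tr A • A.1 - 1 := by rw [← e2, pow_two, cmul]
    simp only [mul_sub, sub_mul, mul_one, one_mul, smul_mul_assoc, mul_smul_comm, this]
    module
  have e5 : (A ^ 5).1 = (tr A ^ 4 - 3 * tr A ^ 2 + 1) • A.1 - (tr A ^ 3 - 2 * tr A) • 1 := by
    rw [show A ^ 5 = A ^ 4 * A by rw [← pow_succ], cmul, e4]
    have : A.1 * A.1 = tr A • A.1 - 1 := by rw [← e2, pow_two, cmul]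
    simp only [mul_sub, sub_mul, mul_one, one_mul, smul_mul_assoc, mul_smul_comm, this]
    module
  refine hA (pm_of_offdiag ht ?_ ?_ ?_ h) <;> rw [e5] <;> simp <;> ring

end Powers

section Failure

variable {p : ℕ} [Fact p.Prime]

lemma tr_of_mem_borel {v : Fin 2 → ZMod p} (hv : v ≠ 0) {A B : SLp p} (hA : A ∈ borel v)
    (hB : B ∈ borel v) (tA : tr A = 0) (tB : tr B = 0) : tr (A * B) ^ 2 = 4 := by
  have hC := mul_mem hA hB
  obtain ⟨a, ha⟩ := hA
  obtain ⟨b, hb⟩ := hB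
  have h1 := eig_quadratic hv ha
  have h2 := eig_quadratic hv hb
  have hab : (A * B).1 *ᵥ v = (a * b) • v := by
    rw [cmul, ← Matrix.mulVec_mulVec, hb, Matrix.mulVec_smul, ha, smul_smul, mul_comm]
  have h3 := eig_quadratic hv hab
  rw [tA] at h1; rw [tB] at h2
  have h4 : (a * b) ^ 2 = 1 := by linear_combination b ^ 2 * h1 - h2
  have h5 : tr (A * B) * (a * b) = 2 := by linear_combination h4 - h3
  linear_combination (-tr (A*B) ^ 2) * h4 + (tr (A * B) * (a * b) + 2) * h5

lemma comm_of_mem_dih (hp : 5 < p) {W : Matrix (Fin 2) (Fin 2) (ZMod p)} (hW : W.trace = 0)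
    (hd : W.det ≠ 0) {A : SLp p} (hA : A ∈ dih W) (ht : tr A ≠ 0) : A.1 * W = W * A.1 := by
  rcases mem_dih.1 hA with h | h
  · exact h
  · exfalso
    have h2 := two_ne hp
    rw [Matrix.trace_fin_two] at hW
    rw [Matrix.det_fin_two] at hd
    have h00 := congrFun (congrFun h 0) 0
    have h01 := congrFun (congrFun h 0) 1
    have h10 := congrFun (congrFun h 1) 0
    have h11 := congrFun (congrFun h 1) 1
    simp [Matrix.mul_apply, Fin.sum_univ_two] at h00 h01 h10 h11
    unfold tr at ht
    have c1 : W 0 1 = 0 := by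
      refine (mul_eq_zero.1 (?_ : (A.1 0 0 + A.1 1 1) * _ = 0)).resolve_left ht
      linear_combination h01 - A.1 0 1 * hW
    have c2 : W 1 0 = 0 := by
      refine (mul_eq_zero.1 (?_ : (A.1 0 0 + A.1 1 1) * _ = 0)).resolve_left ht
      linear_combination h10 - A.1 1 0 * hW
    have c0 : W 0 0 = 0 := by
      refine (mul_eq_zero.1 (?_ : (2 * (A.1 0 0 + A.1 1 1)) * _ = 0)).resolve_left (mul_ne_zero h2 ht)
      linear_combination h00 - h11 + 2 * A.1 1 1 * hW
    exact hd (by rw [c1, c0]; ring)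

lemma dih_smul {c : ZMod p} (hc : c ≠ 0) {W : Matrix (Fin 2) (Fin 2) (ZMod p)} {A : SLp p}
    (h : A ∈ dih (c • W)) : A ∈ dih W := by
  rw [mem_dih] at h ⊢
  simp only [Matrix.mul_smul, Matrix.smul_mul, ← smul_neg] at h
  exact h.imp (fun h => smul_right_injective _ hc h) (fun h => smul_right_injective _ hc h)

lemma not_RP3_aux (hp : 5 < p) {x g₁ g₂ g₃ : SLp p} (hx : ¬ PM x) (t1 : tr g₁ = 0) (t2 : tr g₂ = 0)
    (h4 : tr (g₁ * g₂) ^ 2 ≠ 4) (h0 : tr (g₁ * g₂) ≠ 0) (h1 : tr (g₁ * g₂) ^ 2 ≠ 1)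
    (h2 : tr (g₁ * g₂) ^ 2 ≠ 2) (h5 : tr (g₁ * g₂) ^ 4 - 3 * tr (g₁ * g₂) ^ 2 + 1 ≠ 0)
    (h3 : g₃ ∉ dih (ax (g₁ * g₂))) {K₁ K₂ K₃ : Subgroup (SLp p)} (hK₁ : K₁ ≠ ⊤) (hK₂ : K₂ ≠ ⊤)
    (hK₃ : K₃ ≠ ⊤) (n₁ : -1 ∈ K₁) (n₂ : -1 ∈ K₂) (n₃ : -1 ∈ K₃) (x1 : x ∈ K₁) (x2 : x ∈ K₂)
    (x3 : x ∈ K₃) (g12 : g₁ ∈ K₂) (g13 : g₁ ∈ K₃) (g21 : g₂ ∈ K₁) (g23 : g₂ ∈ K₃) (g31 : g₃ ∈ K₁)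
    (g32 : g₃ ∈ K₂) : ¬ RP3 p := by
  intro hRP
  have hpm : ¬ PM (g₁ * g₂) := by
    rintro (h | h) <;> rw [h] at h4 <;> apply h4 <;> simp [tr] <;> norm_num
  have hI : ISeq ![g₁, g₂, g₃] := by
    constructor
    · by_contra hne
      have m1 : g₁ ∈ gen (Set.range ![g₁, g₂, g₃]) := subset_gen _ ⟨0, rfl⟩
      have m2 : g₂ ∈ gen (Set.range ![g₁, g₂, g₃]) := subset_gen _ ⟨1, rfl⟩
      have m3 : g₃ ∈ gen (Set.range ![g₁, g₂, g₃]) := subset_gen _ ⟨2, rfl⟩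
      rcases classification hp (neg_one_mem_gen _) hne with ⟨v, hv, hle⟩ | ⟨W, hW, hd, hle⟩ | ⟨s, hs⟩
      · exact h4 (tr_of_mem_borel hv (hle m1) (hle m2) t1 t2)
      · have hc := comm_of_mem_dih hp hW hd (hle (mul_mem m1 m2)) h0
        obtain ⟨c, rfl⟩ := comm_ax hp hpm hW hc
        have hc0 : c ≠ 0 := by rintro rfl; simp at hd
        exact h3 (dih_smul hc0 (hle m3))
      · have hm := mul_mem m1 m2
        rcases hs.pow _ hm with h | h | h
        · exact h0 (tr_eq_of_pow_two hpm h)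
        · exact h1 (tr_eq_of_pow_three hpm h)
        · rcases hs.card with ⟨rfl, -⟩ | ⟨rfl, -⟩ | ⟨rfl, -⟩
          · exact h1 (tr_eq_of_pow_three hpm h)
          · exact (tr_eq_of_pow_four hpm h).elim h0 h2
          · exact h5 (tr_eq_of_pow_five hpm h)
    · have : ∀ (i : Fin 3) (K : Subgroup (SLp p)), K ≠ ⊤ → -1 ∈ K →
          (∀ j, j ≠ i → (![g₁, g₂, g₃] : Fin 3 → SLp p) j ∈ K) →
            gen (![g₁, g₂, g₃] '' {j | j ≠ i}) ≠ ⊤ := by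
        intro i K hK hn hj h
        exact hK (top_le_iff.1 (h ▸ gen_image_le.2 ⟨hn, hj⟩))
      intro i
      fin_cases i
      · refine this _ K₁ hK₁ n₁ fun j => ?_
        fin_cases j <;> simp <;> assumption
      · refine this _ K₂ hK₂ n₂ fun j => ?_
        fin_cases j <;> simp <;> assumption
      · refine this _ K₃ hK₃ n₃ fun j => ?_
        fin_cases j <;> simp <;> assumption
  obtain ⟨i, hi⟩ := hRP ![g₁, g₂, g₃] hI x (fun h => hx (Or.inl h)) (fun h => hx (Or.inr h))
  have : ∀ K : Subgroup (SLp p), K ≠ ⊤ → -1 ∈ K →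
      (∀ j, Function.update ![g₁, g₂, g₃] i x j ∈ K) → False := by
    intro K hK hn hj
    exact hK (top_le_iff.1 (hi ▸ gen_range_le.2 ⟨hn, hj⟩))
  fin_cases i
  · refine this K₁ hK₁ n₁ fun j => ?_
    fin_cases j <;> simp <;> assumption
  · refine this K₂ hK₂ n₂ fun j => ?_
    fin_cases j <;> simp <;> assumption
  · refine this K₃ hK₃ n₃ fun j => ?_
    fin_cases j <;> simp <;> assumption

end Failure

section Quaternions

variable {p : ℕ} [Fact p.Prime]

/-- The quaternion `w + xI + yJ + zK` as a matrix, where `a ^ 2 + b ^ 2 = -1`. -/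
def Q (a b w x y z : ZMod p) : Matrix (Fin 2) (Fin 2) (ZMod p) :=
  !![w + y * a + z * b, x + y * b - z * a; -x + y * b - z * a, w - y * a - z * b]

variable {a b : ZMod p}

lemma Q_mul (hab : a ^ 2 + b ^ 2 = -1) (w x y z w' x' y' z' : ZMod p) :
    Q a b w x y z * Q a b w' x' y' z' =
      Q a b (w * w' - x * x' - y * y' - z * z') (w * x' + x * w' + y * z' - z * y')
        (w * y' - x * z' + y * w' + z * x') (w * z' + x * y' - y * x' + z * w') := by
  apply mat_ext <;> simp [Q, Matrix.mul_apply, Fin.sum_univ_two]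
  · linear_combination (y * y' + z * z') * hab
  · linear_combination (z * y' - y * z') * hab
  · linear_combination (y * z' - z * y') * hab
  · linear_combination (y * y' + z * z') * hab

lemma Q_neg (w x y z : ZMod p) : -Q a b w x y z = Q a b (-w) (-x) (-y) (-z) := by
  apply mat_ext <;> simp [Q] <;> ring

lemma Q_smul (c w x y z : ZMod p) : c • Q a b w x y z = Q a b (c * w) (c * x) (c * y) (c * z) := by
  apply mat_ext <;> simp [Q] <;> ring

lemma Q_det (hab : a ^ 2 + b ^ 2 = -1) (w x y z : ZMod p) :
    (Q a b w x y z).det = w ^ 2 + x ^ 2 + y ^ 2 + z ^ 2 := by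
  rw [Matrix.det_fin_two]; simp [Q]; linear_combination -(y ^ 2 + z ^ 2) * hab

lemma Q_trace (w x y z : ZMod p) : (Q a b w x y z).trace = 2 * w := by
  rw [Matrix.trace_fin_two]; simp [Q]; ring

lemma Q_inj (hp : 5 < p) (hab : a ^ 2 + b ^ 2 = -1) {w x y z w' x' y' z' : ZMod p}
    (h : Q a b w x y z = Q a b w' x' y' z') : w = w' ∧ x = x' ∧ y = y' ∧ z = z' := by
  have h2 := two_ne hp
  have h00 := congrFun (congrFun h 0) 0
  have h01 := congrFun (congrFun h 0) 1
  have h10 := congrFun (congrFun h 1) 0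
  have h11 := congrFun (congrFun h 1) 1
  simp [Q] at h00 h01 h10 h11
  refine ⟨?_, ?_, ?_, ?_⟩ <;> apply mul_left_cancel₀ h2
  · linear_combination h00 + h11
  · linear_combination h01 - h10
  · linear_combination -a * (h00 - h11) - b * (h01 + h10) + 2 * (y - y') * hab
  · linear_combination -b * (h00 - h11) + a * (h01 + h10) + 2 * (z - z') * hab

/-- A scaled quaternion of norm one as an element of `SL(2,p)`. -/
def qs (hab : a ^ 2 + b ^ 2 = -1) (c w x y z : ZMod p)
    (h : c ^ 2 * (w ^ 2 + x ^ 2 + y ^ 2 + z ^ 2) = 1) : SLp p :=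
  ⟨c • Q a b w x y z, by rw [Matrix.det_smul, Q_det hab]; simpa using h⟩

lemma qs_ne (hab : a ^ 2 + b ^ 2 = -1) {c w x y z : ZMod p}
    (h : c ^ 2 * (w ^ 2 + x ^ 2 + y ^ 2 + z ^ 2) = 1) : c ≠ 0 := by
  rintro rfl; simp at h

lemma tr_qs (hab : a ^ 2 + b ^ 2 = -1) {c w x y z : ZMod p}
    (h : c ^ 2 * (w ^ 2 + x ^ 2 + y ^ 2 + z ^ 2) = 1) : tr (qs hab c w x y z h) = 2 * c * w := by
  simp [tr, qs, Q]; ring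

lemma qs_mul (hab : a ^ 2 + b ^ 2 = -1) {c w x y z c' w' x' y' z' : ZMod p}
    (h : c ^ 2 * (w ^ 2 + x ^ 2 + y ^ 2 + z ^ 2) = 1)
    (h' : c' ^ 2 * (w' ^ 2 + x' ^ 2 + y' ^ 2 + z' ^ 2) = 1) :
    qs hab c w x y z h * qs hab c' w' x' y' z' h' =
      qs hab (c * c') (w * w' - x * x' - y * y' - z * z') (w * x' + x * w' + y * z' - z * y')
        (w * y' - x * z' + y * w' + z * x') (w * z' + x * y' - y * x' + z * w')
        (by linear_combination c' ^ 2 * (w' ^ 2 + x' ^ 2 + y' ^ 2 + z' ^ 2) * h + h') := by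
  apply Subtype.ext
  rw [cmul]
  simp only [qs, Matrix.smul_mul, Matrix.mul_smul, smul_smul, Q_mul hab]
  rw [mul_comm c']

lemma ax_qs (hab : a ^ 2 + b ^ 2 = -1) {c w x y z : ZMod p}
    (h : c ^ 2 * (w ^ 2 + x ^ 2 + y ^ 2 + z ^ 2) = 1) :
    ax (qs hab c w x y z h) = (2 * c) • Q a b 0 x y z := by
  apply mat_ext <;> simp [ax, qs, Q] <;> ring

lemma qs_mem_dih (hab : a ^ 2 + b ^ 2 = -1) {c w x y z x' y' z' : ZMod p}
    (h : c ^ 2 * (w ^ 2 + x ^ 2 + y ^ 2 + z ^ 2) = 1) :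
    qs hab c w x y z h ∈ dih (Q a b 0 x' y' z') ↔
      (Q a b w x y z * Q a b 0 x' y' z' = Q a b 0 x' y' z' * Q a b w x y z ∨
        Q a b w x y z * Q a b 0 x' y' z' = -(Q a b 0 x' y' z' * Q a b w x y z)) := by
  have hc := qs_ne hab h
  rw [mem_dih]
  simp only [qs, Matrix.mul_smul, Matrix.smul_mul, ← smul_neg]
  exact or_congr (smul_right_injective _ hc).eq_iff (smul_right_injective _ hc).eq_iff

lemma mem_permSub_of_sign {A : SLp p} {T : Finset (Matrix (Fin 2) (Fin 2) (ZMod p))}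
    (h : ∀ W ∈ T, ∃ W' ∈ T, A.1 * W = W' * A.1 ∨ A.1 * W = -(W' * A.1)) :
    A ∈ permSub (T ∪ T.image Neg.neg) := by
  intro W hW
  rw [Finset.mem_union, Finset.mem_image] at hW
  rcases hW with hW | ⟨W, hW, rfl⟩ <;> obtain ⟨W', hW', h1 | h1⟩ := h W hW
  · exact ⟨W', Finset.mem_union_left _ hW', h1⟩
  · exact ⟨-W', Finset.mem_union_right _ (Finset.mem_image_of_mem _ hW'), by rw [h1, neg_mul]⟩
  · exact ⟨-W', Finset.mem_union_right _ (Finset.mem_image_of_mem _ hW'), by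
      rw [mul_neg, h1, neg_mul]⟩
  · exact ⟨W', Finset.mem_union_left _ hW', by rw [mul_neg, h1, neg_neg]⟩

lemma qs_mem_permSub (hab : a ^ 2 + b ^ 2 = -1) {c w x y z : ZMod p}
    {h : c ^ 2 * (w ^ 2 + x ^ 2 + y ^ 2 + z ^ 2) = 1}
    {T : Finset (Matrix (Fin 2) (Fin 2) (ZMod p))}
    (hT : ∀ W ∈ T, ∃ W' ∈ T, Q a b w x y z * W = W' * Q a b w x y z ∨
      Q a b w x y z * W = -(W' * Q a b w x y z)) :
    qs hab c w x y z h ∈ permSub (T ∪ T.image Neg.neg) := by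
  refine mem_permSub_of_sign fun W hW => ?_
  obtain ⟨W', hW', h1⟩ := hT W hW
  refine ⟨W', hW', ?_⟩
  simp only [qs, Matrix.mul_smul, Matrix.smul_mul, ← smul_neg]
  exact h1.imp (fun h => by rw [h]) (fun h => by rw [h])

lemma permSub_conj_ne_top (hp : 5 < p) {S : Finset (Matrix (Fin 2) (Fin 2) (ZMod p))}
    (hc : S.card < p) {W : Matrix (Fin 2) (Fin 2) (ZMod p)} (hW : W ∈ S) (ht : W.trace = 0)
    (hd : W.det ≠ 0) {N : Matrix (Fin 2) (Fin 2) (ZMod p)} (hN : N.det ≠ 0) :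
    permSub (S.image fun W => N * W * N.adjugate) ≠ ⊤ := by
  refine permSub_ne_top hp (Finset.card_image_le.trans_lt hc) (Finset.mem_image_of_mem _ hW) ?_ ?_
  · rw [Matrix.trace_mul_comm, ← mul_assoc, Matrix.adjugate_mul]; simp [ht]
  · rw [Matrix.det_mul, Matrix.det_mul, Matrix.det_adjugate]; simp [hN, hd]

lemma neg_one_mem_permSub (S : Finset (Matrix (Fin 2) (Fin 2) (ZMod p))) : -1 ∈ permSub S :=
  fun W hW => ⟨W, hW, by rw [cneg, cone]; simp⟩

lemma qs_conj (hab : a ^ 2 + b ^ 2 = -1) {c w x y z c' w' x' y' z' : ZMod p}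
    {h : c ^ 2 * (w ^ 2 + x ^ 2 + y ^ 2 + z ^ 2) = 1}
    {h' : c' ^ 2 * (w' ^ 2 + x' ^ 2 + y' ^ 2 + z' ^ 2) = 1}
    {S : Finset (Matrix (Fin 2) (Fin 2) (ZMod p))} (hB : qs hab c' w' x' y' z' h' ∈ permSub S)
    {N : Matrix (Fin 2) (Fin 2) (ZMod p)} (hN : N.det ≠ 0)
    (hA : c • (Q a b w x y z * N) = c' • (N * Q a b w' x' y' z') ∨
      c • (Q a b w x y z * N) = -(c' • (N * Q a b w' x' y' z'))) :
    qs hab c w x y z h ∈ permSub (S.image fun W => N * W * N.adjugate) := by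
  apply permSub_conj hN hB
  simpa only [qs, Matrix.mul_smul, Matrix.smul_mul] using hA

lemma natCast_ne' {n q : ℕ} (hn : Nat.Prime q) (hne : p ≠ q) (h : n = q) : (n : ZMod p) ≠ 0 := by
  subst h
  refine natCast_ne hn.ne_zero fun h => hne ?_
  exact (Nat.prime_dvd_prime_iff_eq Fact.out hn).1 h

end Quaternions

section Witnesses

variable {p : ℕ} [Fact p.Prime]

lemma not_RP3_of_sqrt_two (hp : 5 < p) (h7 : p ≠ 7) (h11 : p ≠ 11) {r : ZMod p} (hr : r ^ 2 = 2) :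
    ¬ RP3 p := by
  have h2 := two_ne hp
  have e3 : (3 : ZMod p) ≠ 0 := mod_cast natCast_ne' (p := p) (n := 3) Nat.prime_three (by omega) rfl
  have e5 : (5 : ZMod p) ≠ 0 := mod_cast natCast_ne' (p := p) (n := 5) Nat.prime_five (by omega) rfl
  have e7 : (7 : ZMod p) ≠ 0 := mod_cast natCast_ne' (p := p) (n := 7) (by norm_num) h7 rfl
  have e11 : (11 : ZMod p) ≠ 0 := mod_cast natCast_ne' (p := p) (n := 11) (by norm_num) h11 rfl
  obtain ⟨a, b, hab⟩ := ZMod.sq_add_sq p (-1)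
  obtain ⟨c, hc⟩ : ∃ c : ZMod p, 3 * c = 1 := ⟨3⁻¹, mul_inv_cancel₀ e3⟩
  obtain ⟨d, hd⟩ : ∃ d : ZMod p, 2 * d = 1 := ⟨2⁻¹, mul_inv_cancel₀ h2⟩
  have hc2 : 9 * c ^ 2 = 1 := by linear_combination (3 * c + 1) * hc
  have hx : (r * d) ^ 2 * (0 ^ 2 + 1 ^ 2 + (-1) ^ 2 + 0 ^ 2) = 1 := by
    linear_combination 2 * d ^ 2 * hr + (2 * d + 1) * hd
  have hg1 : c ^ 2 * (0 ^ 2 + 2 ^ 2 + 2 ^ 2 + (-1) ^ 2) = 1 := by linear_combination hc2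
  have hg2 : (1 : ZMod p) ^ 2 * (0 ^ 2 + 0 ^ 2 + 0 ^ 2 + 1 ^ 2) = 1 := by ring
  have hg3 : d ^ 2 * (1 ^ 2 + 1 ^ 2 + 1 ^ 2 + 1 ^ 2) = 1 := by linear_combination (2 * d + 1) * hd
  have hg : c ^ 2 * (1 ^ 2 + 2 ^ 2 + (-2) ^ 2 + 0 ^ 2) = 1 := by linear_combination hc2
  have hprod : qs hab c 0 2 2 (-1) hg1 * qs hab 1 0 0 0 1 hg2 = qs hab c 1 2 (-2) 0 hg := by
    rw [qs_mul]; congr 1 <;> ring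
  let T : Finset (Matrix (Fin 2) (Fin 2) (ZMod p)) := {Q a b 0 1 0 0, Q a b 0 0 1 0, Q a b 0 0 0 1}
  have hT : (T ∪ T.image Neg.neg).card < p := by
    have h1 : T.card ≤ 3 := Finset.card_le_three
    have h2 := Finset.card_image_le (s := T) (f := Neg.neg)
    have h3 := Finset.card_union_le T (T.image Neg.neg)
    have : p ≠ 6 := by rintro rfl; exact absurd (Fact.out : Nat.Prime 6) (by norm_num)
    omega
  have hmT : Q a b 0 1 0 0 ∈ T ∪ T.image Neg.neg := Finset.mem_union_left _ (by simp [T])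
  have htr : (Q a b 0 1 0 0).trace = 0 := by rw [Q_trace]; ring
  have hdt : (Q a b 0 1 0 0).det ≠ 0 := by rw [Q_det hab]; simp
  have hN : (Q a b 0 1 1 1).det ≠ 0 := by
    rw [Q_det hab]; intro h; apply e3; linear_combination h
  have x1 : qs hab (r * d) 0 1 (-1) 0 hx ∈ permSub (T ∪ T.image Neg.neg) := by
    refine qs_mem_permSub hab fun W hW => ?_
    simp only [T, Finset.mem_insert, Finset.mem_singleton] at hW
    rcases hW with rfl | rfl | rfl
    · exact ⟨Q a b 0 0 1 0, by simp [T], Or.inr (by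
        rw [Q_mul hab, Q_mul hab, Q_neg]; congr 1 <;> ring)⟩
    · exact ⟨Q a b 0 1 0 0, by simp [T], Or.inr (by
        rw [Q_mul hab, Q_mul hab, Q_neg]; congr 1 <;> ring)⟩
    · exact ⟨Q a b 0 0 0 1, by simp [T], Or.inr (by
        rw [Q_mul hab, Q_mul hab, Q_neg]; congr 1 <;> ring)⟩
  have g21 : qs hab 1 0 0 0 1 hg2 ∈ permSub (T ∪ T.image Neg.neg) := by
    refine qs_mem_permSub hab fun W hW => ?_
    simp only [T, Finset.mem_insert, Finset.mem_singleton] at hW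
    rcases hW with rfl | rfl | rfl
    · exact ⟨Q a b 0 1 0 0, by simp [T], Or.inr (by
        rw [Q_mul hab, Q_mul hab, Q_neg]; congr 1 <;> ring)⟩
    · exact ⟨Q a b 0 0 1 0, by simp [T], Or.inr (by
        rw [Q_mul hab, Q_mul hab, Q_neg]; congr 1 <;> ring)⟩
    · exact ⟨Q a b 0 0 0 1, by simp [T], Or.inl (by
        rw [Q_mul hab])⟩
  have g31 : qs hab d 1 1 1 1 hg3 ∈ permSub (T ∪ T.image Neg.neg) := by
    refine qs_mem_permSub hab fun W hW => ?_
    simp only [T, Finset.mem_insert, Finset.mem_singleton] at hW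
    rcases hW with rfl | rfl | rfl
    · exact ⟨Q a b 0 0 1 0, by simp [T], Or.inl (by
        rw [Q_mul hab, Q_mul hab]; congr 1 <;> ring)⟩
    · exact ⟨Q a b 0 0 0 1, by simp [T], Or.inl (by
        rw [Q_mul hab, Q_mul hab]; congr 1 <;> ring)⟩
    · exact ⟨Q a b 0 1 0 0, by simp [T], Or.inl (by
        rw [Q_mul hab, Q_mul hab]; congr 1 <;> ring)⟩
  have hD : DType (dih (Q a b 0 1 (-1) 0)) := by
    refine ⟨_, ?_, ?_, le_rfl⟩
    · rw [Q_trace]; ring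
    · rw [Q_det hab]; intro h; apply h2; linear_combination h
  have ht : tr (qs hab c 0 2 2 (-1) hg1 * qs hab 1 0 0 0 1 hg2) = 2 * c := by
    rw [hprod, tr_qs]; ring
  refine not_RP3_aux hp (x := qs hab (r * d) 0 1 (-1) 0 hx) (g₁ := qs hab c 0 2 2 (-1) hg1)
    (g₂ := qs hab 1 0 0 0 1 hg2) (g₃ := qs hab d 1 1 1 1 hg3) ?_ (by rw [tr_qs]; ring)
    (by rw [tr_qs]; ring) ?_ ?_ ?_ ?_ ?_ ?_ (permSub_ne_top hp hT hmT htr hdt)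
    (permSub_conj_ne_top hp hT hmT htr hdt hN) (hD.ne_top hp) (neg_one_mem_permSub _)
    (neg_one_mem_permSub _) (neg_one_mem_dih _) x1 ?_ ?_ ?_ ?_ g21 ?_ g31 ?_
  · intro h
    have h0 : tr (qs hab (r * d) 0 1 (-1) 0 hx) = 0 := by rw [tr_qs]; ring
    rcases h with h | h <;> rw [h] at h0 <;> simp [tr] at h0 <;> apply h2
    · linear_combination h0
    · linear_combination -h0
  · rw [ht]; intro h
    apply pow_ne_zero 5 h2; linear_combination -9 * h + 4 * hc2
  · rw [ht]; intro h
    apply h2; linear_combination 3 * h - 2 * hc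
  · rw [ht]; intro h
    apply e5; linear_combination -9 * h + 4 * hc2
  · rw [ht]; intro h
    apply mul_ne_zero h2 e7; linear_combination -9 * h + 4 * hc2
  · rw [ht]; intro h
    apply e11; linear_combination -81 * h + (16 * (9 * c ^ 2 + 1) - 108) * hc2
  · rw [hprod, ax_qs]
    intro h
    have hc0 : 2 * c ≠ 0 := mul_ne_zero h2 (qs_ne hab hg)
    have h := dih_smul hc0 h
    rw [qs_mem_dih] at h
    rcases h with h | h
    · rw [Q_mul hab, Q_mul hab] at h
      have := (Q_inj hp hab h).2.2.2
      apply pow_ne_zero 3 h2; linear_combination -this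
    · rw [Q_mul hab, Q_mul hab, Q_neg] at h
      have := (Q_inj hp hab h).2.1
      apply pow_ne_zero 2 h2; linear_combination this
  · refine qs_conj hab x1 hN (Or.inr ?_)
    rw [Q_mul hab, Q_mul hab, Q_smul, Q_smul, Q_neg]; congr 1 <;> ring
  · rw [qs_mem_dih]; left; rfl
  · refine qs_conj hab g21 hN (Or.inl ?_)
    rw [Q_mul hab, Q_mul hab, Q_smul, Q_smul]; congr 1
    · linear_combination -hc
    · linear_combination hc
    · linear_combination -hc
    · ring
  · rw [qs_mem_dih]; right
    rw [Q_mul hab, Q_mul hab, Q_neg]; congr 1 <;> ring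
  · rw [qs_mem_dih]; right
    rw [Q_mul hab, Q_mul hab, Q_neg]; congr 1 <;> ring
  · refine qs_conj hab g31 hN (Or.inl ?_)
    rw [Q_mul hab, Q_mul hab, Q_smul, Q_smul]; congr 1 <;> ring

lemma not_RP3_of_sqrt_five (hp : 12 < p) (h19 : p ≠ 19) {f : ZMod p} (hf : f ^ 2 = f + 1) :
    ¬ RP3 p := by
  have hp5 : 5 < p := by omega
  have h2 := two_ne hp5
  have e3 : (3 : ZMod p) ≠ 0 := mod_cast natCast_ne' (p := p) (n := 3) Nat.prime_three (by omega) rfl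
  have e5 : (5 : ZMod p) ≠ 0 := mod_cast natCast_ne' (p := p) (n := 5) Nat.prime_five (by omega) rfl
  have e19 : (19 : ZMod p) ≠ 0 := mod_cast natCast_ne' (p := p) (n := 19) (by norm_num) h19 rfl
  obtain ⟨a, b, hab⟩ := ZMod.sq_add_sq p (-1)
  have hf5 : (2 * f - 1) ^ 2 = 5 := by linear_combination 4 * hf
  have hf0 : 2 * f - 1 ≠ 0 := by intro h; apply e5; rw [← hf5, h]; ring
  have hf1 : f ≠ 0 := by rintro rfl; simp at hf
  obtain ⟨c, hc⟩ : ∃ c : ZMod p, (2 * f - 1) * c = 1 := ⟨_, mul_inv_cancel₀ hf0⟩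
  obtain ⟨d, hd⟩ : ∃ d : ZMod p, 2 * d = 1 := ⟨2⁻¹, mul_inv_cancel₀ h2⟩
  have hc2 : 5 * c ^ 2 = 1 := by
    linear_combination ((2 * f - 1) * c + 1) * hc - c ^ 2 * hf5
  have hx : (1 : ZMod p) ^ 2 * (0 ^ 2 + 1 ^ 2 + 0 ^ 2 + 0 ^ 2) = 1 := by ring
  have hg1 : c ^ 2 * (0 ^ 2 + 0 ^ 2 + (-1) ^ 2 + 2 ^ 2) = 1 := by linear_combination hc2
  have hg2 : (1 : ZMod p) ^ 2 * (0 ^ 2 + 0 ^ 2 + 1 ^ 2 + 0 ^ 2) = 1 := by ring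
  have hg3 : d ^ 2 * (0 ^ 2 + (f - 1) ^ 2 + f ^ 2 + (-1) ^ 2) = 1 := by
    linear_combination 2 * d ^ 2 * hf + (2 * d + 1) * hd
  have hg : c ^ 2 * (1 ^ 2 + (-2) ^ 2 + 0 ^ 2 + 0 ^ 2) = 1 := by linear_combination hc2
  have hprod : qs hab c 0 0 (-1) 2 hg1 * qs hab 1 0 0 1 0 hg2 = qs hab c 1 (-2) 0 0 hg := by
    rw [qs_mul]; congr 1 <;> ring
  let T : Finset (Matrix (Fin 2) (Fin 2) (ZMod p)) := {Q a b 0 1 f 0, Q a b 0 1 (-f) 0,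
    Q a b 0 0 1 f, Q a b 0 0 1 (-f), Q a b 0 f 0 1, Q a b 0 (-f) 0 1}
  have hT : (T ∪ T.image Neg.neg).card < p := by
    have h1 : T.card ≤ 6 := Finset.card_le_six
    have h2 := Finset.card_image_le (s := T) (f := Neg.neg)
    have h3 := Finset.card_union_le T (T.image Neg.neg)
    omega
  have hmT : Q a b 0 1 f 0 ∈ T ∪ T.image Neg.neg := Finset.mem_union_left _ (by simp [T])
  have hf2 : f + 2 ≠ 0 := by
    intro h; apply e5; linear_combination hf - (f - 3) * h
  have htr : (Q a b 0 1 f 0).trace = 0 := by rw [Q_trace]; ring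
  have hdt : (Q a b 0 1 f 0).det ≠ 0 := by
    rw [Q_det hab]; intro h; apply hf2; linear_combination h - hf
  have hN : (Q a b 0 0 1 f).det ≠ 0 := by
    rw [Q_det hab]; intro h; apply hf2; linear_combination h - hf
  have x1 : qs hab 1 0 1 0 0 hx ∈ permSub (T ∪ T.image Neg.neg) := by
    refine qs_mem_permSub hab fun W hW => ?_
    simp only [T, Finset.mem_insert, Finset.mem_singleton] at hW
    rcases hW with rfl | rfl | rfl | rfl | rfl | rfl
    · exact ⟨Q a b 0 1 (-f) 0, by simp [T], Or.inl (by
        rw [Q_mul hab, Q_mul hab]; congr 1 <;> ring)⟩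
    · exact ⟨Q a b 0 1 f 0, by simp [T], Or.inl (by
        rw [Q_mul hab, Q_mul hab]; congr 1 <;> ring)⟩
    · exact ⟨Q a b 0 0 1 f, by simp [T], Or.inr (by
        rw [Q_mul hab, Q_mul hab, Q_neg]; congr 1 <;> ring)⟩
    · exact ⟨Q a b 0 0 1 (-f), by simp [T], Or.inr (by
        rw [Q_mul hab, Q_mul hab, Q_neg]; congr 1 <;> ring)⟩
    · exact ⟨Q a b 0 (-f) 0 1, by simp [T], Or.inr (by
        rw [Q_mul hab, Q_mul hab, Q_neg]; congr 1 <;> ring)⟩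
    · exact ⟨Q a b 0 f 0 1, by simp [T], Or.inr (by
        rw [Q_mul hab, Q_mul hab, Q_neg]; congr 1 <;> ring)⟩
  have g21 : qs hab 1 0 0 1 0 hg2 ∈ permSub (T ∪ T.image Neg.neg) := by
    refine qs_mem_permSub hab fun W hW => ?_
    simp only [T, Finset.mem_insert, Finset.mem_singleton] at hW
    rcases hW with rfl | rfl | rfl | rfl | rfl | rfl
    · exact ⟨Q a b 0 1 (-f) 0, by simp [T], Or.inr (by
        rw [Q_mul hab, Q_mul hab, Q_neg]; congr 1 <;> ring)⟩
    · exact ⟨Q a b 0 1 f 0, by simp [T], Or.inr (by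
        rw [Q_mul hab, Q_mul hab, Q_neg]; congr 1 <;> ring)⟩
    · exact ⟨Q a b 0 0 1 (-f), by simp [T], Or.inl (by
        rw [Q_mul hab, Q_mul hab]; congr 1 <;> ring)⟩
    · exact ⟨Q a b 0 0 1 f, by simp [T], Or.inl (by
        rw [Q_mul hab, Q_mul hab]; congr 1 <;> ring)⟩
    · exact ⟨Q a b 0 f 0 1, by simp [T], Or.inr (by
        rw [Q_mul hab, Q_mul hab, Q_neg]; congr 1 <;> ring)⟩
    · exact ⟨Q a b 0 (-f) 0 1, by simp [T], Or.inr (by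
        rw [Q_mul hab, Q_mul hab, Q_neg]; congr 1 <;> ring)⟩
  have g31 : qs hab d 0 (f - 1) f (-1) hg3 ∈ permSub (T ∪ T.image Neg.neg) := by
    refine qs_mem_permSub hab fun W hW => ?_
    simp only [T, Finset.mem_insert, Finset.mem_singleton] at hW
    rcases hW with rfl | rfl | rfl | rfl | rfl | rfl
    · exact ⟨Q a b 0 0 1 (-f), by simp [T], Or.inl (by
        rw [Q_mul hab, Q_mul hab]; congr 1 <;> grind)⟩
    · exact ⟨Q a b 0 (-f) 0 1, by simp [T], Or.inl (by
        rw [Q_mul hab, Q_mul hab]; congr 1 <;> grind)⟩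
    · exact ⟨Q a b 0 0 1 f, by simp [T], Or.inr (by
        rw [Q_mul hab, Q_mul hab, Q_neg]; congr 1 <;> grind)⟩
    · exact ⟨Q a b 0 1 f 0, by simp [T], Or.inl (by
        rw [Q_mul hab, Q_mul hab]; congr 1 <;> grind)⟩
    · exact ⟨Q a b 0 f 0 1, by simp [T], Or.inr (by
        rw [Q_mul hab, Q_mul hab, Q_neg]; congr 1 <;> grind)⟩
    · exact ⟨Q a b 0 1 (-f) 0, by simp [T], Or.inl (by
        rw [Q_mul hab, Q_mul hab]; congr 1 <;> grind)⟩
  have hD : DType (dih (Q a b 0 1 0 0)) := by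
    refine ⟨_, ?_, ?_, le_rfl⟩
    · rw [Q_trace]; ring
    · rw [Q_det hab]; simp
  have ht : tr (qs hab c 0 0 (-1) 2 hg1 * qs hab 1 0 0 1 0 hg2) = 2 * c := by
    rw [hprod, tr_qs]; ring
  refine not_RP3_aux hp5 (x := qs hab 1 0 1 0 0 hx) (g₁ := qs hab c 0 0 (-1) 2 hg1)
    (g₂ := qs hab 1 0 0 1 0 hg2) (g₃ := qs hab d 0 (f - 1) f (-1) hg3) ?_ (by rw [tr_qs]; ring)
    (by rw [tr_qs]; ring) ?_ ?_ ?_ ?_ ?_ ?_ (permSub_ne_top hp5 hT hmT htr hdt)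
    (permSub_conj_ne_top hp5 hT hmT htr hdt hN) (hD.ne_top hp5) (neg_one_mem_permSub _)
    (neg_one_mem_permSub _) (neg_one_mem_dih _) x1 ?_ ?_ ?_ ?_ g21 ?_ g31 ?_
  · intro h
    have h0 : tr (qs hab 1 0 1 0 0 hx) = 0 := by rw [tr_qs]; ring
    rcases h with h | h <;> rw [h] at h0 <;> simp [tr] at h0 <;> apply h2
    · linear_combination h0
    · linear_combination -h0
  · rw [ht]; intro h
    apply pow_ne_zero 4 h2; linear_combination -5 * h + 4 * hc2
  · rw [ht]; intro h
    apply h2; linear_combination (2 * f - 1) * h - 2 * hc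
  · rw [ht]; intro h
    apply one_ne_zero (α := ZMod p); linear_combination -5 * h + 4 * hc2
  · rw [ht]; intro h
    apply mul_ne_zero h2 e3; linear_combination -5 * h + 4 * hc2
  · rw [ht]; intro h
    apply e19; linear_combination -25 * h + (16 * (5 * c ^ 2 + 1) - 60) * hc2
  · rw [hprod, ax_qs]
    intro h
    have hc0 : 2 * c ≠ 0 := mul_ne_zero h2 (qs_ne hab hg)
    have h := dih_smul hc0 h
    rw [qs_mem_dih] at h
    rcases h with h | h
    · rw [Q_mul hab, Q_mul hab] at h
      have := (Q_inj hp5 hab h).2.2.1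
      apply pow_ne_zero 2 h2; linear_combination this
    · rw [Q_mul hab, Q_mul hab, Q_neg] at h
      have := (Q_inj hp5 hab h).1
      have h3 : 2 * (2 * (f - 1)) = 0 := by linear_combination this
      have h4 : f - 1 = 0 := by simpa [h2] using h3
      have : f = 1 := sub_eq_zero.1 h4
      rw [this] at hf
      apply one_ne_zero (α := ZMod p); linear_combination -hf
  · refine qs_conj hab x1 hN (Or.inr ?_)
    rw [Q_mul hab, Q_mul hab, Q_smul, Q_smul, Q_neg]; congr 1 <;> ring
  · rw [qs_mem_dih]; left; rfl
  · refine qs_conj hab g21 hN (Or.inl ?_)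
    rw [Q_mul hab, Q_mul hab, Q_smul, Q_smul]; congr 1 <;> grind
  · rw [qs_mem_dih]; right
    rw [Q_mul hab, Q_mul hab, Q_neg]; congr 1 <;> ring
  · rw [qs_mem_dih]; right
    rw [Q_mul hab, Q_mul hab, Q_neg]; congr 1 <;> ring
  · refine qs_conj hab g31 hN (Or.inr ?_)
    rw [Q_mul hab, Q_mul hab, Q_smul, Q_smul, Q_neg]; congr 1 <;> grind

/-- The replacement property fails unless `p` is `±3` modulo `8` and modulo `5`. -/
theorem mod_of_RP3 (hp : 5 < p) (h7 : p ≠ 7) (h11 : p ≠ 11) (h19 : p ≠ 19) (h : RP3 p) :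
    (p % 8 = 3 ∨ p % 8 = 5) ∧ (p % 10 = 3 ∨ p % 10 = 7) := by
  have hpp : p.Prime := Fact.out
  have hodd : p % 2 = 1 := hpp.eq_two_or_odd.resolve_left (by omega)
  have h5 : p % 5 ≠ 0 := by
    intro h
    have := (Nat.prime_dvd_prime_iff_eq Nat.prime_five hpp).1 (Nat.dvd_of_mod_eq_zero h)
    omega
  constructor
  · by_contra hne
    have : p % 8 = 1 ∨ p % 8 = 7 := by omega
    obtain ⟨r, hr⟩ := (ZMod.exists_sq_eq_two_iff (p := p) (by omega)).2 this
    exact not_RP3_of_sqrt_two hp h7 h11 (r := r) (by rw [hr]; ring) h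
  · by_contra hne
    haveI : Fact (Nat.Prime 5) := ⟨Nat.prime_five⟩
    have hsq : IsSquare ((5 : ℕ) : ZMod p) := by
      rw [← ZMod.exists_sq_eq_prime_iff_of_mod_four_eq_one (p := 5) (q := p) (by norm_num) (by omega)]
      have : p % 5 = 1 ∨ p % 5 = 4 := by omega
      rw [← ZMod.natCast_mod p 5]
      rcases this with h | h <;> rw [h]
      · exact ⟨1, by norm_num⟩
      · exact ⟨2, by norm_num⟩
    obtain ⟨r, hr⟩ := hsq
    push_cast at hr
    have h2 := two_ne hp
    obtain ⟨d, hd⟩ : ∃ d : ZMod p, 2 * d = 1 := ⟨2⁻¹, mul_inv_cancel₀ h2⟩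
    have : p ≠ 9 := by rintro rfl; exact absurd hpp (by norm_num)
    refine not_RP3_of_sqrt_five (by omega) h19 (f := (1 + r) * d) ?_ h
    linear_combination -d ^ 2 * hr + ((1 + r) * d + 2 * d + 1) * hd
end Witnesses

section Tetrahedral

variable {p : ℕ} [Fact p.Prime]

/-- Subgroups all of whose elements have order at most three modulo `±1`, and which do not preserve
a line of the plane or of the trace-zero matrices. -/
structure TType (H : Subgroup (SLp p)) : Prop where
  neg : -1 ∈ H
  notP : ¬ PType H
  notD : ¬ DType H
  trace : ∀ A ∈ H, PM A ∨ tr A = 0 ∨ tr A ^ 2 = 1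

lemma three_ne (hp : 5 < p) : (3 : ZMod p) ≠ 0 := by
  exact_mod_cast natCast_ne' (p := p) (n := 3) Nat.prime_three (by omega) rfl

lemma tr_eq_zero_of_sq {A : SLp p} (h : tr A = 0) : A * A = -1 := by
  have hd := sl_det A
  unfold tr at h
  apply sl_ext <;> simp only [m00, m01, m10, m11, n00, o00, o01, o10, o11]
  · linear_combination -hd + A.1 0 0 * h
  · linear_combination A.1 0 1 * h
  · linear_combination A.1 1 0 * h
  · linear_combination -hd + A.1 1 1 * h

lemma PM.tr_sq {A : SLp p} (h : PM A) : tr A ^ 2 = 4 := by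
  rcases h with rfl | rfl <;> simp [tr] <;> norm_num

lemma inv_of_tr_zero {A : SLp p} (h : tr A = 0) : A⁻¹ = -A := by
  rw [inv_eq_iff_mul_eq_one, mul_neg, tr_eq_zero_of_sq h, neg_neg]

lemma anticomm_of_trace {X Y : Matrix (Fin 2) (Fin 2) (ZMod p)} (hX : X.trace = 0) (hY : Y.trace = 0)
    (h : (X * Y).trace = 0) : X * Y = -(Y * X) := by
  rw [Matrix.trace_fin_two] at *
  simp only [Matrix.mul_apply, Fin.sum_univ_two] at h
  have hx : X 1 1 = - X 0 0 := by linear_combination hX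
  have hy : Y 1 1 = - Y 0 0 := by linear_combination hY
  rw [hx, hy] at h
  apply mat_ext <;> simp [Matrix.mul_apply, Fin.sum_univ_two, hx, hy]
  · linear_combination h
  · ring
  · ring
  · linear_combination h

lemma trace_of_anticomm (hp : 5 < p) {X Y : Matrix (Fin 2) (Fin 2) (ZMod p)} (h : X * Y = -(Y * X)) :
    (X * Y).trace = 0 := by
  have h1 : (X * Y).trace = -(X * Y).trace := by
    conv_lhs => rw [h, Matrix.trace_neg, Matrix.trace_mul_comm]
  have : 2 * (X * Y).trace = 0 := by linear_combination h1
  simpa [two_ne hp] using this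

lemma tr_eq_trace (A : SLp p) : tr A = A.1.trace := by rw [Matrix.trace_fin_two]; rfl

lemma not_pm_of_tr (hp : 5 < p) {A : SLp p} (h : tr A = 0 ∨ tr A ^ 2 = 1) : ¬ PM A := by
  intro hA
  have h4 := hA.tr_sq
  rcases h with h | h
  · apply pow_ne_zero 2 (two_ne hp); rw [h] at h4; linear_combination -h4
  · apply three_ne hp; linear_combination h - h4

/-- The involutions of a tetrahedral subgroup commute modulo `±1`. -/
lemma TType.involutions (hp : 5 < p) {H : Subgroup (SLp p)} (hH : TType H) {a b : SLp p} (ha : a ∈ H)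
    (hb : b ∈ H) (ta : tr a = 0) (tb : tr b = 0) : PM (a * b) ∨ tr (a * b) = 0 := by
  have h2 := two_ne hp
  have h3 := three_ne hp
  rcases hH.trace _ (mul_mem ha hb) with h | h | h
  · exact Or.inl h
  · exact Or.inr h
  exfalso
  apply hH.notD
  set W := a.1 * b.1 - b.1 * a.1 with hWdef
  have hWt : W.trace = 0 := by rw [hWdef, Matrix.trace_sub, Matrix.trace_mul_comm, sub_self]
  have da := sl_det a
  have db := sl_det b
  have a11 : a.1 1 1 = - a.1 0 0 := by unfold tr at ta; linear_combination ta
  have b11 : b.1 1 1 = - b.1 0 0 := by unfold tr at tb; linear_combination tb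
  have hWd : W.det = 3 := by
    simp only [tr, m00, m11] at h
    rw [a11] at h da; rw [b11] at h db
    rw [hWdef, Matrix.det_fin_two]
    simp only [Matrix.sub_apply, Matrix.mul_apply, Fin.sum_univ_two, a11, b11]
    linear_combination -h + 4 * da * (-b.1 0 0 ^ 2 - b.1 0 1 * b.1 1 0) + 4 * db
  have hWa : W * a.1 = -(a.1 * W) := by
    apply mat_ext <;> simp [hWdef, Matrix.mul_apply, Fin.sum_univ_two, a11, b11] <;> ring
  have hWb : W * b.1 = -(b.1 * W) := by
    apply mat_ext <;> simp [hWdef, Matrix.mul_apply, Fin.sum_univ_two, a11, b11] <;> ring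
  have key : ∀ c ∈ H, tr c = 0 → (W * c.1).trace = 0 := by
    intro c hc tc
    have c11 : c.1 1 1 = - c.1 0 0 := by unfold tr at tc; linear_combination tc
    have hcases : ∀ d : SLp p, d ∈ H → tr d = 0 → W * d.1 = -(d.1 * W) → PM (d * c) →
        (W * c.1).trace = 0 := by
      intro d hd td hWd hpm
      have : c = d ∨ c = -d := by
        have e : c = d⁻¹ * (d * c) := by group
        rcases hpm with h | h <;> rw [h, inv_of_tr_zero td] at e
        · right; simpa using e
        · left; simpa using e
      have hz := trace_of_anticomm hp hWd
      rcases this with rfl | rfl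
      · exact hz
      · rw [cneg, Matrix.mul_neg, Matrix.trace_neg, hz, neg_zero]
    have dc := sl_det c
    rw [a11] at da; rw [b11] at db; rw [c11] at dc
    have hz : (W * c.1).trace = 2 * tr (a * b * c) := by
      rw [Matrix.trace_fin_two]
      simp only [hWdef, tr, m00, m01, m10, m11, Matrix.sub_apply, Matrix.mul_apply, Fin.sum_univ_two,
        a11, b11, c11]
      ring
    have hgram : tr (a * b * c) ^ 2 = 4 - tr (a * c) ^ 2 - tr (b * c) ^ 2 - tr (a * b) ^ 2
        - tr (a * c) * tr (b * c) * tr (a * b) := by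
      have hx : tr (a * c) = 2 * a.1 0 0 * c.1 0 0 + a.1 0 1 * c.1 1 0 + a.1 1 0 * c.1 0 1 := by
        simp only [tr, m00, m11, a11, c11]; ring
      have hy : tr (b * c) = 2 * b.1 0 0 * c.1 0 0 + b.1 0 1 * c.1 1 0 + b.1 1 0 * c.1 0 1 := by
        simp only [tr, m00, m11, b11, c11]; ring
      have ht : tr (a * b) = 2 * a.1 0 0 * b.1 0 0 + a.1 0 1 * b.1 1 0 + a.1 1 0 * b.1 0 1 := by
        simp only [tr, m00, m11, a11, b11]; ring
      rw [hx, hy, ht]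
      simp only [tr, m00, m01, m10, m11, a11, b11, c11]
      linear_combination
        (4 * (-b.1 0 0 ^ 2 - b.1 0 1 * b.1 1 0) * (-c.1 0 0 ^ 2 - c.1 0 1 * c.1 1 0)
          - (2 * b.1 0 0 * c.1 0 0 + b.1 0 1 * c.1 1 0 + b.1 1 0 * c.1 0 1) ^ 2) * da
        + (4 * (-c.1 0 0 ^ 2 - c.1 0 1 * c.1 1 0)
          - (2 * a.1 0 0 * c.1 0 0 + a.1 0 1 * c.1 1 0 + a.1 1 0 * c.1 0 1) ^ 2) * db
        + (4 - (2 * a.1 0 0 * b.1 0 0 + a.1 0 1 * b.1 1 0 + a.1 1 0 * b.1 0 1) ^ 2) * dc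
    rcases hH.trace _ (mul_mem ha hc) with hx | hx
    · exact hcases a ha ta hWa hx
    rcases hH.trace _ (mul_mem hb hc) with hy | hy
    · exact hcases b hb tb hWb hy
    rw [hz]
    suffices tr (a * b * c) = 0 by rw [this, mul_zero]
    have hzs : tr (a * b * c) = 0 ∨ tr (a * b * c) ^ 2 = 4 ∨ tr (a * b * c) ^ 2 = 1 := by
      rcases hH.trace _ (mul_mem (mul_mem ha hb) hc) with hz | hz | hz
      · exact Or.inr (Or.inl hz.tr_sq)
      · exact Or.inl hz
      · exact Or.inr (Or.inr hz)
    generalize tr (a * b * c) = z at *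
    generalize tr (a * c) = x at *
    generalize tr (b * c) = y at *
    generalize tr (a * b) = t at *
    clear hz
    by_contra hz0
    have hzs := hzs.resolve_left hz0
    have hone : (1 : ZMod p) ≠ 0 := one_ne_zero
    rcases hx with rfl | hx <;> rcases hy with rfl | hy
    · rcases hzs with h' | h'
      · apply hone; linear_combination hgram - h' - h
      · apply h2; linear_combination h' - hgram + h
    · rcases hzs with h' | h'
      · apply h2; linear_combination hgram - h' - h - hy
      · apply hone; linear_combination h' - hgram + h + hy
    · rcases hzs with h' | h'
      · apply h2; linear_combination hgram - h' - h - hx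
      · apply hone; linear_combination h' - hgram + h + hx
    · have hs : (x * y * t - 1) * (x * y * t + 1) = 0 := by
        linear_combination y ^ 2 * t ^ 2 * hx + t ^ 2 * hy + h
      rcases mul_eq_zero.1 hs with hs | hs
      · apply hz0; apply pow_eq_zero_iff (two_ne_zero) |>.1
        linear_combination hgram - hx - hy - h - hs
      · have h2' : z ^ 2 = 2 := by linear_combination hgram - hx - hy - h - hs
        rcases hzs with h' | h'
        · apply h2; linear_combination h2' - h'
        · apply hone; linear_combination h' - h2'
  refine ⟨W, hWt, by rw [hWd]; exact h3, fun g hg => ?_⟩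
  have hconj : ∀ d ∈ H, tr d = 0 → (g⁻¹).1 * W * g.1 * d.1 = -(d.1 * ((g⁻¹).1 * W * g.1)) := by
    intro d hd td
    apply anticomm_of_trace
    · rw [Matrix.trace_mul_comm, ← mul_assoc, cmul_inv, one_mul, hWt]
    · rw [← tr_eq_trace, td]
    · have := key (g * d * g⁻¹) (mul_mem (mul_mem hg hd) (inv_mem hg)) (by
        rw [tr_eq_trace, cmul, cmul, Matrix.trace_mul_comm, ← mul_assoc, cinv_mul, one_mul,
          ← tr_eq_trace, td])
      rw [cmul, cmul] at this
      rw [← this, mul_assoc, mul_assoc, Matrix.trace_mul_comm]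
      simp only [mul_assoc]
  have h1 := hconj a ha ta
  have h1' := hconj b hb tb
  have hab : ¬ PM (a * b) := not_pm_of_tr hp (Or.inr h)
  have comm2 : ∀ X : Matrix (Fin 2) (Fin 2) (ZMod p), X * a.1 = -(a.1 * X) → X * b.1 = -(b.1 * X) →
      (a * b).1 * X = X * (a * b).1 := by
    intro X hXa hXb
    rw [cmul, ← mul_assoc X, hXa, neg_mul, mul_assoc a.1 X, hXb, mul_neg, neg_neg, mul_assoc]
  have hW0 : W ≠ 0 := by intro h0; rw [h0] at hWd; simp at hWd; exact h3 hWd.symm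
  obtain ⟨c, hc⟩ := comm_prop hp hab hWt (X := (g⁻¹).1 * W * g.1)
    (by rw [Matrix.trace_mul_comm, ← mul_assoc, cmul_inv, one_mul, hWt]) (comm2 W hWa hWb)
    (comm2 _ h1 h1') hW0
  have hdet : c ^ 2 = 1 := by
    have := congrArg Matrix.det hc
    rw [Matrix.det_mul, Matrix.det_mul, g.2, (g⁻¹).2, Matrix.det_smul, hWd, Fintype.card_fin] at this
    apply mul_right_cancel₀ h3; linear_combination -this
  have hWg : W * g.1 = c • (g.1 * W) := by
    have := congrArg (g.1 * ·) hc
    simp only [← mul_assoc, cmul_inv, one_mul, Matrix.mul_smul] at this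
    exact this
  have : (c - 1) * (c + 1) = 0 := by linear_combination hdet
  rw [mem_dih]
  rcases mul_eq_zero.1 this with h | h
  · left; rw [hWg, sub_eq_zero.1 h, one_smul]
  · right; rw [hWg, eq_neg_of_add_eq_zero_left h, neg_smul, one_smul, neg_neg]

/-- An involution and an element of order three of a tetrahedral subgroup do not commute. -/
lemma TType.not_comm (hp : 5 < p) {H : Subgroup (SLp p)} (hH : TType H) {a r : SLp p} (ha : a ∈ H)
    (hr : r ∈ H) (ta : tr a = 0) (t : tr r ^ 2 = 1) : ¬ a.1 * r.1 = r.1 * a.1 := by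
  intro h
  have h2 := two_ne hp
  have h3 := three_ne hp
  obtain ⟨c, hc⟩ := comm_ax hp (not_pm_of_tr hp (Or.inl ta)) (ax_trace r) (by
    rw [ax_eq]; simp [mul_sub, sub_mul, h])
  have h4 : 4 * c ^ 2 = 3 := by
    have := congrArg Matrix.det hc
    rw [Matrix.det_smul, ax_det, ax_det, ta, t, Fintype.card_fin] at this
    linear_combination -this
  have h5 : tr (a * r) = -2 * c := by
    have := congrArg (fun X => (a.1 * X).trace) hc
    simp only [ax_eq, mul_sub, Matrix.mul_smul, Matrix.trace_sub, Matrix.trace_smul, ← cmul,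
      ← tr_eq_trace, mul_one, ta, tr_eq_zero_of_sq ta, smul_eq_mul] at this
    have e : tr (-1 : SLp p) = -2 := by simp [tr]; norm_num
    rw [e] at this
    apply mul_left_cancel₀ h2; linear_combination this
  have h6 : tr (a * r) ^ 2 = 3 := by rw [h5]; linear_combination h4
  rcases hH.trace _ (mul_mem ha hr) with h | h | h
  · have := h.tr_sq
    apply one_ne_zero (α := ZMod p); linear_combination h6 - this
  · rw [h] at h6; apply h3; linear_combination -h6
  · apply h2; linear_combination h - h6

end Tetrahedral

section Replacement

variable {p : ℕ} [Fact p.Prime]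

lemma PType.ne_top {H : Subgroup (SLp p)} (hH : PType H) : H ≠ ⊤ := by
  rintro rfl
  obtain ⟨v, hv, hle⟩ := hH
  have h1 := (mem_borel_iff hv).1 (hle (Subgroup.mem_top (uu 1)))
  have h2 := (mem_borel_iff hv).1 (hle (Subgroup.mem_top (ll 1)))
  simp only [uu, ll, mk2, Matrix.of_apply, Matrix.cons_val', Matrix.cons_val_zero, Matrix.cons_val_one,
    Matrix.cons_val_fin_one, m00, m01] at h1 h2
  rcases vec_ne hv with h | h
  · apply h; apply pow_eq_zero_iff two_ne_zero |>.1; linear_combination -h2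
  · apply h; apply pow_eq_zero_iff two_ne_zero |>.1; linear_combination h1

/-- Two elements of a Borel subgroup commute, or every proper subgroup containing both of them lies in
that Borel subgroup. -/
lemma comm_or_le_borel (hp : 5 < p) {K : Subgroup (SLp p)} (hneg : -1 ∈ K) (hK : K ≠ ⊤)
    {v : Fin 2 → ZMod p} (hv : v ≠ 0) {x y : SLp p} (hx : x ∈ K) (hy : y ∈ K) (hxv : x ∈ borel v)
    (hyv : y ∈ borel v) : x * y = y * x ∨ K ≤ borel v := by
  have hk : x * y * x⁻¹ * y⁻¹ ∈ borel v := mul_mem (mul_mem (mul_mem hxv hyv) (inv_mem hxv)) (inv_mem hyv)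
  have ht : tr (x * y * x⁻¹ * y⁻¹) = 2 := by
    obtain ⟨a, ha⟩ := hxv
    obtain ⟨b, hb⟩ := hyv
    obtain ⟨c, hc⟩ := hk
    have e : (x * y * x⁻¹ * y⁻¹).1 * (y.1 * x.1) = x.1 * y.1 := by
      have : x * y * x⁻¹ * y⁻¹ * (y * x) = x * y := by group
      rw [← cmul, ← cmul, ← cmul, this]
    have h := congrArg (· *ᵥ v) e
    simp only [← Matrix.mulVec_mulVec, ha, hb, Matrix.mulVec_smul, hc, smul_smul] at h
    have h1 := eig_quadratic hv ha
    have h2 := eig_quadratic hv hb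
    have h3 := eig_quadratic hv hc
    have ha0 : a ≠ 0 := by rintro rfl; simp at h1
    have hb0 : b ≠ 0 := by rintro rfl; simp at h2
    have hc1 : c = 1 := by
      have : a * (b * c) = a * b * 1 := by
        rcases vec_ne hv with h0 | h0
        · have := congrFun h 0
          simp only [Pi.smul_apply, smul_eq_mul] at this
          apply mul_right_cancel₀ h0; linear_combination this
        · have := congrFun h 1
          simp only [Pi.smul_apply, smul_eq_mul] at this
          apply mul_right_cancel₀ h0; linear_combination this
      apply mul_left_cancel₀ (mul_ne_zero ha0 hb0); linear_combination this
    rw [hc1] at h3; linear_combination -h3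
  by_cases h1 : x * y * x⁻¹ * y⁻¹ = 1
  · left
    rwa [mul_inv_eq_one, mul_inv_eq_iff_eq_mul] at h1
  right
  refine le_borel hneg hK (mul_mem (mul_mem (mul_mem hx hy) (inv_mem hx)) (inv_mem hy))
    (by rw [ht]; norm_num) h1 ?_ hv hk
  intro h
  have h4 : tr (-1 : SLp p) = -2 := by simp [tr]; norm_num
  rw [h, h4] at ht
  exact mul_ne_zero (two_ne hp) (two_ne hp) (by linear_combination -ht)

lemma mem_dih_ax_of_comm {x y : SLp p} (h : y * x = x * y) : y ∈ dih (ax x) := by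
  rw [mem_dih]; left
  rw [ax_eq, mul_sub, sub_mul, Matrix.mul_smul, Matrix.smul_mul, ← cmul, ← cmul, h]
  simp

lemma comm_of_comm_ax (hp : 5 < p) {x y : SLp p} (h : y.1 * ax x = ax x * y.1) :
    y.1 * x.1 = x.1 * y.1 := by
  rw [ax_eq, mul_sub, sub_mul, Matrix.mul_smul, Matrix.smul_mul] at h
  simp only [Matrix.mul_smul, mul_one, Matrix.smul_mul, one_mul, sub_left_inj] at h
  exact smul_right_injective _ (two_ne hp) h

lemma ax_of_tr_zero {x : SLp p} (h : tr x = 0) : ax x = (2 : ZMod p) • x.1 := by rw [ax_eq, h]; simp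

lemma pm_of_comm (hp : 5 < p) {a b : SLp p} (ta : tr a = 0) (tb : tr b = 0) (h : a.1 * b.1 = b.1 * a.1) :
    PM (a * b) := by
  have h' : a * b = b * a := Subtype.ext (by rw [cmul, cmul, h])
  apply sl_sq_eq_one hp
  calc a * b * (a * b) = a * (b * a) * b := by group
    _ = (a * a) * (b * b) := by rw [← h']; group
    _ = 1 := by rw [tr_eq_zero_of_sq ta, tr_eq_zero_of_sq tb]; simp

/-- Two involutions preserving the same nondegenerate line of trace-zero matrices. -/
lemma involutions_of_dih (hp : 5 < p) {W : Matrix (Fin 2) (Fin 2) (ZMod p)} (hW : W.trace = 0)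
    (hW0 : W ≠ 0) {x y : SLp p} (hx : ¬ PM x) (hy : ¬ PM y) (tx : tr x = 0) (ty : tr y = 0)
    (hxW : x ∈ dih W) (hyW : y ∈ dih W) (hxy : ¬ PM (x * y)) :
    x.1 * y.1 = -(y.1 * x.1) ∨ (x.1 * W = -(W * x.1) ∧ y.1 * W = -(W * y.1)) := by
  have h2 := two_ne hp
  have key : ∀ {x y : SLp p}, ¬ PM x → tr x = 0 → tr y = 0 → x.1 * W = W * x.1 → y ∈ dih W →
      ¬ PM (x * y) → x.1 * y.1 = -(y.1 * x.1) := by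
    intro x y hx tx ty h hy hxy
    obtain ⟨c, hc⟩ := comm_ax hp hx hW h
    have hc0 : c ≠ 0 := by rintro rfl; simp at hc; exact hW0 hc
    rw [hc] at hy
    have := dih_smul hc0 hy
    rw [ax_of_tr_zero tx] at this
    rcases mem_dih.1 (dih_smul h2 this) with h | h
    · exact absurd (pm_of_comm hp tx ty h.symm) hxy
    · rw [h, neg_neg]
  rcases mem_dih.1 hxW with h | h
  · exact Or.inl (key hx tx ty h hyW hxy)
  rcases mem_dih.1 hyW with h' | h'
  · left
    rw [key hy ty tx h' hxW, neg_neg]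
    intro hp'; apply hxy
    have : x * y = x * (y * x) * x⁻¹ := by group
    rw [this, ← hp'.comm x, mul_assoc, mul_inv_cancel, mul_one]; exact hp'
  · exact Or.inr ⟨h, h'⟩

/-- Two elements lying in the stabilizers of two different nondegenerate lines of trace-zero matrices
are commuting involutions. -/
lemma involutions_of_dih_dih (hp : 5 < p) {W X : Matrix (Fin 2) (Fin 2) (ZMod p)} (hW : W.trace = 0)
    (hdW : W.det ≠ 0) (hX : X.trace = 0) (hdX : X.det ≠ 0) (hWX : ∀ c : ZMod p, X ≠ c • W)
    {x y : SLp p} (hx : ¬ PM x) (hy : ¬ PM y) (hxy : ¬ PM (x * y)) (hxW : x ∈ dih W) (hyW : y ∈ dih W)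
    (hxX : x ∈ dih X) (hyX : y ∈ dih X) : tr x = 0 ∧ tr y = 0 ∧ x.1 * y.1 = -(y.1 * x.1) := by
  have ne0 : ∀ {Y : Matrix (Fin 2) (Fin 2) (ZMod p)}, Y.det ≠ 0 → Y ≠ 0 := by
    rintro Y h rfl; simp at h
  have hnc : ∀ {z : SLp p}, ¬ PM z → z.1 * W = W * z.1 → z.1 * X = X * z.1 → False := by
    intro z hz h1 h2
    obtain ⟨c, hc⟩ := comm_prop hp hz hW hX h1 h2 (ne0 hdW)
    exact hWX c hc
  have ht : ∀ {z : SLp p}, ¬ PM z → z ∈ dih W → z ∈ dih X → tr z = 0 := by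
    intro z hz h1 h2
    by_contra h
    exact hnc hz (comm_of_mem_dih hp hW hdW h1 h) (comm_of_mem_dih hp hX hdX h2 h)
  have tx := ht hx hxW hxX
  have ty := ht hy hyW hyX
  refine ⟨tx, ty, ?_⟩
  rcases involutions_of_dih hp hW (ne0 hdW) hx hy tx ty hxW hyW hxy with h | h
  · exact h
  rcases involutions_of_dih hp hX (ne0 hdX) hx hy tx ty hxX hyX hxy with h' | h'
  · exact h'
  exfalso
  apply hnc hxy
  · rw [cmul, mul_assoc, h.2, mul_neg, ← mul_assoc, h.1, neg_mul, neg_neg, mul_assoc]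
  · rw [cmul, mul_assoc, h'.2, mul_neg, ← mul_assoc, h'.1, neg_mul, neg_neg, mul_assoc]

/-- In a tetrahedral subgroup, the product of an involution and an element of order three is not an
involution. -/
lemma TType.tr_ne_zero (hp : 5 < p) {H : Subgroup (SLp p)} (hH : TType H) {a r : SLp p} (ha : a ∈ H)
    (hr : r ∈ H) (ta : tr a = 0) (t : tr r ^ 2 = 1) : tr (a * r) ≠ 0 := by
  intro h
  have e : a * (a * r) = -r := by rw [← mul_assoc, tr_eq_zero_of_sq ta]; simp
  rcases hH.involutions hp ha (mul_mem ha hr) ta h with h' | h'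
  · rw [e, pm_neg] at h'; exact not_pm_of_tr hp (Or.inr t) h'
  · rw [e, tr_neg, neg_eq_zero] at h'; rw [h'] at t; simp at t

/-- A subgroup of a tetrahedral group which is not cyclic contains two different involutions. -/
lemma TType.exists_involutions (hp : 5 < p) {H K : Subgroup (SLp p)} (hH : TType H) (hKH : K ≤ H)
    {x y : SLp p} (hx : x ∈ K) (hy : y ∈ K) (nx : ¬ PM x) (ny : ¬ PM y) (nxy : ¬ PM (x * y))
    (nxy' : ¬ PM (x * y⁻¹)) : ∃ a ∈ K, ∃ b ∈ K, tr a = 0 ∧ tr b = 0 ∧ ¬ PM (a * b) := by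
  have key : ∀ {a r : SLp p}, a ∈ K → r ∈ K → tr a = 0 → tr r ^ 2 = 1 →
      ∃ a ∈ K, ∃ b ∈ K, tr a = 0 ∧ tr b = 0 ∧ ¬ PM (a * b) := by
    intro a r ha hr ta t
    refine ⟨a, ha, r * a * r⁻¹, mul_mem (mul_mem hr ha) (inv_mem hr), ta, ?_, fun h => ?_⟩
    · rw [tr_eq_trace, cmul, cmul, Matrix.trace_mul_comm, ← mul_assoc, cinv_mul, one_mul,
        ← tr_eq_trace, ta]
    · have e : r * a = a⁻¹ * (a * (r * a * r⁻¹)) * r := by group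
      rw [inv_of_tr_zero ta] at e
      have hc : a.1 * r.1 = r.1 * a.1 ∨ a.1 * r.1 = -(r.1 * a.1) := by
        rcases h with h | h <;> rw [h] at e <;> have e := congrArg Subtype.val e <;> rw [cmul] at e
        · right; rw [e, mul_one, cmul, cneg, neg_mul, neg_neg]
        · left; rw [e, mul_neg_one, neg_neg, cmul]
      rcases hc with h | h
      · exact hH.not_comm hp (hKH ha) (hKH hr) ta t h
      · apply hH.tr_ne_zero hp (hKH ha) (hKH hr) ta t
        rw [tr_eq_trace, cmul]; exact trace_of_anticomm hp h
  rcases (hH.trace x (hKH hx)).resolve_left nx with tx | tx <;>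
    rcases (hH.trace y (hKH hy)).resolve_left ny with ty | ty
  · exact ⟨x, hx, y, hy, tx, ty, nxy⟩
  · exact key hx hy tx ty
  · exact key hy hx ty tx
  · have hsum : tr (x * y) + tr (x * y⁻¹) = tr x * tr y := by simp only [tr, m00, m11, i00, i01, i10, i11]; ring
    rcases (hH.trace _ (hKH (mul_mem hx hy))).resolve_left nxy with h | h
    · exact key (mul_mem hx hy) hy h ty
    rcases (hH.trace _ (hKH (mul_mem hx (inv_mem hy)))).resolve_left nxy' with h' | h'
    · exact key (mul_mem hx (inv_mem hy)) hy h' ty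
    exfalso
    have hs : (tr (x * y) + tr (x * y⁻¹)) ^ 2 = 1 := by
      rw [hsum]; linear_combination tr y ^ 2 * tx + ty
    generalize tr (x * y) = u at *
    generalize tr (x * y⁻¹) = w at *
    have h0 : (u - w) * (u + w) = 0 := by linear_combination h - h'
    rcases mul_eq_zero.1 h0 with h0 | h0
    · apply three_ne hp
      linear_combination hs - 4 * h' - (u + 3 * w) * h0
    · rw [h0] at hs; simp at hs

/-- The frame of three commuting involutions. -/
lemma TType.le_permSub (hp : 5 < p) {H : Subgroup (SLp p)} (hH : TType H) {a b : SLp p} (ha : a ∈ H)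
    (hb : b ∈ H) (ta : tr a = 0) (tb : tr b = 0) (hab : ¬ PM (a * b)) :
    H ≤ permSub (({a.1, b.1, (a * b).1} : Finset _) ∪ ({a.1, b.1, (a * b).1} : Finset _).image Neg.neg) := by
  intro h hh
  have tab := (hH.involutions hp ha hb ta tb).resolve_left hab
  have inv : ∀ {c d : SLp p}, tr c = 0 → PM (c * d) → d = c ∨ d = -c := by
    intro c d tc hpm
    have e : d = c⁻¹ * (c * d) := by group
    rcases hpm with h | h <;> rw [h, inv_of_tr_zero tc] at e
    · right; simpa using e
    · left; simpa using e
  have anti : ∀ {c d : SLp p}, tr c = 0 → tr d = 0 → tr (c * d) = 0 → c.1 * d.1 = -(d.1 * c.1) := by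
    intro c d tc td h
    exact anticomm_of_trace (by rw [← tr_eq_trace, tc]) (by rw [← tr_eq_trace, td])
      (by rw [← cmul, ← tr_eq_trace, h])
  have key : ∀ d ∈ H, tr d = 0 → ∃ c : SLp p, (c = a ∨ c = b ∨ c = a * b) ∧ (d = c ∨ d = -c) := by
    intro d hd td
    rcases hH.involutions hp ha hd ta td with h1 | h1
    · exact ⟨a, Or.inl rfl, inv ta h1⟩
    rcases hH.involutions hp hb hd tb td with h2 | h2
    · exact ⟨b, Or.inr (Or.inl rfl), inv tb h2⟩
    refine ⟨a * b, Or.inr (Or.inr rfl), inv tab (pm_of_comm hp tab td ?_)⟩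
    have e1 := anti ta td h1
    have e2 := anti tb td h2
    rw [cmul, mul_assoc, e2, mul_neg, ← mul_assoc, e1, neg_mul, neg_neg, mul_assoc]
  apply mem_permSub_of_sign
  have fin : ∀ c ∈ H, tr c = 0 → ∃ W' ∈ ({a.1, b.1, (a * b).1} : Finset _),
      h.1 * c.1 = W' * h.1 ∨ h.1 * c.1 = -(W' * h.1) := by
    intro c hc tc
    obtain ⟨e, he, hde⟩ := key (h * c * h⁻¹) (mul_mem (mul_mem hh hc) (inv_mem hh)) (by
      rw [tr_eq_trace, cmul, cmul, Matrix.trace_mul_comm, ← mul_assoc, cinv_mul, one_mul,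
        ← tr_eq_trace, tc])
    refine ⟨e.1, ?_, ?_⟩
    · rcases he with rfl | rfl | rfl <;> simp
    · have e' : h.1 * c.1 = (h * c * h⁻¹).1 * h.1 := by
        rw [← cmul, ← cmul, inv_mul_cancel_right]
      rw [e']
      rcases hde with h' | h' <;> rw [h']
      · exact Or.inl rfl
      · right; rw [cneg, neg_mul]
  intro W hW
  simp only [Finset.mem_insert, Finset.mem_singleton] at hW
  rcases hW with rfl | rfl | rfl
  · exact fin a ha ta
  · exact fin b hb tb
  · exact fin _ (mul_mem ha hb) tab

lemma gen_three_le {a b c : SLp p} {H : Subgroup (SLp p)} :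
    gen {a, b, c} ≤ H ↔ -1 ∈ H ∧ a ∈ H ∧ b ∈ H ∧ c ∈ H := by
  rw [gen_le, Set.insert_subset_iff, Set.insert_subset_iff, Set.singleton_subset_iff]; rfl

/-- An irredundant generating sequence of length three with an element which replaces no member. -/
structure Unreplaced (x a b c : SLp p) : Prop where
  top : gen {a, b, c} = ⊤
  nx : ¬ PM x
  ne_a : gen {x, b, c} ≠ ⊤
  ne_b : gen {x, a, c} ≠ ⊤
  ne_c : gen {x, a, b} ≠ ⊤
  na : ¬ PM a
  nb : ¬ PM b
  nc : ¬ PM c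

namespace Unreplaced

variable {x a b c : SLp p}

lemma swap (h : Unreplaced x a b c) : Unreplaced x b a c where
  top := by rw [Set.insert_comm]; exact h.top
  nx := h.nx
  ne_a := h.ne_b
  ne_b := h.ne_a
  ne_c := by rw [Set.pair_comm]; exact h.ne_c
  na := h.nb
  nb := h.na
  nc := h.nc

lemma rot (h : Unreplaced x a b c) : Unreplaced x b c a where
  top := by
    have : ({b, c, a} : Set (SLp p)) = {a, b, c} := by ext; simp; tauto
    rw [this]; exact h.top
  nx := h.nx
  ne_a := by rw [Set.pair_comm]; exact h.ne_b
  ne_b := by rw [Set.pair_comm]; exact h.ne_c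
  ne_c := h.ne_a
  na := h.nb
  nb := h.nc
  nc := h.na

lemma eq_top (h : Unreplaced x a b c) {H : Subgroup (SLp p)} (hneg : -1 ∈ H) (ha : a ∈ H) (hb : b ∈ H)
    (hc : c ∈ H) : H = ⊤ := by
  rw [eq_top_iff, ← h.top, gen_three_le]; exact ⟨hneg, ha, hb, hc⟩

lemma not_pm_mul (h : Unreplaced x a b c) : ¬ PM (x * c) ∧ ¬ PM (x * c⁻¹) := by
  obtain ⟨hn, hx, ha, hb⟩ := gen_three_le.1 (le_refl (gen {x, a, b}))
  constructor
  · intro hpm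
    apply h.ne_c
    refine h.eq_top hn ha hb ?_
    have e : c = x⁻¹ * (x * c) := by group
    rw [e]; exact mul_mem (inv_mem hx) (hpm.mem hn)
  · intro hpm
    apply h.ne_c
    refine h.eq_top hn ha hb ?_
    have e : c = (x * c⁻¹)⁻¹ * x := by group
    rw [e]; exact mul_mem (inv_mem (hpm.mem hn)) hx

lemma tr_sq_ne (hp : 5 < p) (h : Unreplaced x a b c) : tr x ^ 2 ≠ 4 := by
  intro ht
  obtain ⟨v, hv, hx⟩ := exists_borel hp ht
  have key : ∀ {a b c : SLp p}, Unreplaced x a b c → b ∈ borel v := by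
    intro a b c h
    obtain ⟨hn, hx', hb, hc⟩ := gen_three_le.1 (le_refl (gen {x, b, c}))
    exact le_borel hn h.ne_a hx' ht (fun h' => h.nx (Or.inl h')) (fun h' => h.nx (Or.inr h')) hv hx hb
  exact PType.ne_top ⟨v, hv, le_rfl⟩
    (h.eq_top (neg_one_mem_borel v) (key h.swap) (key h) (key h.rot))

lemma not_P (hp : 5 < p) (h : Unreplaced x a b c) (hP : PType (gen {x, b, c})) :
    DType (gen {x, b, c}) := by
  obtain ⟨v, hv, hle⟩ := hP
  obtain ⟨hn, hx, hb, hc⟩ := gen_three_le.1 hle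
  obtain ⟨hn2, hx2, ha2, hc2⟩ := gen_three_le.1 (le_refl (gen {x, a, c}))
  obtain ⟨hn3, hx3, ha3, hb3⟩ := gen_three_le.1 (le_refl (gen {x, a, b}))
  have hna : a ∉ borel v := fun ha => PType.ne_top ⟨v, hv, le_rfl⟩ (h.eq_top hn ha hb hc)
  have e1 := (comm_or_le_borel hp hn2 h.ne_b hv hc2 hx2 hc hx).resolve_right fun h' => hna (h' ha2)
  have e2 := (comm_or_le_borel hp hn3 h.ne_c hv hb3 hx3 hb hx).resolve_right fun h' => hna (h' ha3)
  refine ⟨ax x, ax_trace x, ?_, gen_three_le.2 ⟨neg_one_mem_dih _, mem_dih_ax_of_comm rfl,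
    mem_dih_ax_of_comm e2, mem_dih_ax_of_comm e1⟩⟩
  rw [ax_det, sub_ne_zero]; exact fun h' => h.tr_sq_ne hp h'.symm

lemma dd (hp : 5 < p) (h : Unreplaced x a b c) (h1 : DType (gen {x, b, c})) (h2 : DType (gen {x, a, c})) :
    tr x = 0 ∧ tr c = 0 ∧ x.1 * c.1 = -(c.1 * x.1) := by
  obtain ⟨W, hW, hdW, hle⟩ := h1
  obtain ⟨X, hX, hdX, hle'⟩ := h2
  obtain ⟨hn, hx, hb, hc⟩ := gen_three_le.1 hle
  obtain ⟨hn', hx', ha', hc'⟩ := gen_three_le.1 hle'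
  refine involutions_of_dih_dih hp hW hdW hX hdX ?_ h.nx h.nc h.not_pm_mul.1 hx hc hx' hc'
  rintro k rfl
  have hk : k ≠ 0 := by rintro rfl; simp at hdX
  exact DType.ne_top hp ⟨W, hW, hdW, le_rfl⟩ (h.eq_top hn (dih_smul hk ha') hb hc)

lemma false_of_mem_dih (hp : 5 < p) (h : Unreplaced x a b c) (tx : tr x = 0) (ha : a ∈ dih x.1)
    (hb : b ∈ dih x.1) (hc : c ∈ dih x.1) : False :=
  DType.ne_top hp ⟨x.1, by rw [← tr_eq_trace, tx], by rw [x.2]; exact one_ne_zero, le_rfl⟩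
    (h.eq_top (neg_one_mem_dih _) ha hb hc)

lemma mem_dih_of_anti {x y : SLp p} (h : x.1 * y.1 = -(y.1 * x.1)) : y ∈ dih x.1 :=
  mem_dih.2 (Or.inr (by rw [h, neg_neg]))

lemma ddd (hp : 5 < p) (h : Unreplaced x a b c) (h1 : DType (gen {x, b, c})) (h2 : DType (gen {x, a, c}))
    (h3 : DType (gen {x, a, b})) : False := by
  have k1 := h.dd hp h1 h2
  have k2 := h.rot.dd hp (by rw [Set.pair_comm]; exact h2) (by rw [Set.pair_comm]; exact h3)
  have k3 := h.rot.rot.dd hp h3 (by rw [Set.pair_comm]; exact h1)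
  exact h.false_of_mem_dih hp k1.1 (mem_dih_of_anti k2.2.2) (mem_dih_of_anti k3.2.2)
    (mem_dih_of_anti k1.2.2)

lemma ddt_aux (hp : 5 < p) (h : Unreplaced x a b c) (h1 : DType (gen {x, b, c}))
    (h3 : TType (gen {x, a, b})) (tx : tr x = 0) : b ∈ dih x.1 := by
  obtain ⟨hn, hx, ha, hb⟩ := gen_three_le.1 (le_refl (gen {x, a, b}))
  obtain ⟨W, hW, hdW, hle⟩ := h1
  obtain ⟨-, hxW, hbW, -⟩ := gen_three_le.1 hle
  rcases (h3.trace b hb).resolve_left h.nb with tb | tb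
  · refine mem_dih_of_anti (anticomm_of_trace (by rw [← tr_eq_trace, tx]) (by rw [← tr_eq_trace, tb]) ?_)
    rw [← cmul, ← tr_eq_trace]
    exact (h3.involutions hp hx hb tx tb).resolve_left h.rot.rot.not_pm_mul.1
  · exfalso
    have tb0 : tr b ≠ 0 := by rintro h0; rw [h0] at tb; simp at tb
    obtain ⟨k, rfl⟩ := comm_ax hp h.nb hW (comm_of_mem_dih hp hW hdW hbW tb0)
    have hk : k ≠ 0 := by rintro rfl; simp at hdW
    rcases mem_dih.1 (dih_smul hk hxW) with h' | h'
    · exact h3.not_comm hp hx hb tx tb (comm_of_comm_ax hp h')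
    · apply h3.tr_ne_zero hp hx hb tx tb
      have := trace_of_anticomm hp h'
      rw [ax_eq, mul_sub, Matrix.mul_smul, Matrix.mul_smul, mul_one, Matrix.trace_sub, Matrix.trace_smul,
        Matrix.trace_smul, ← tr_eq_trace, tx, smul_zero, sub_zero, ← cmul, ← tr_eq_trace] at this
      exact (smul_eq_zero.1 this).resolve_left (two_ne hp)

lemma ddt (hp : 5 < p) (h : Unreplaced x a b c) (h1 : DType (gen {x, b, c})) (h2 : DType (gen {x, a, c}))
    (h3 : TType (gen {x, a, b})) : False := by
  have k1 := h.dd hp h1 h2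
  exact h.false_of_mem_dih hp k1.1 (h.swap.ddt_aux hp h2 (by rw [Set.pair_comm]; exact h3) k1.1)
    (h.ddt_aux hp h1 h3 k1.1) (mem_dih_of_anti k1.2.2)

lemma tt (hp : 5 < p) (hp7 : 7 ≤ p) (h : Unreplaced x a b c) (h1 : TType (gen {x, b, c})) (h2 : TType (gen {x, a, c})) :
    False := by
  obtain ⟨hn, hx, hb, hc⟩ := gen_three_le.1 (le_refl (gen {x, b, c}))
  obtain ⟨hn', hx', ha', hc'⟩ := gen_three_le.1 (le_refl (gen {x, a, c}))
  obtain ⟨e, he, f, hf, te, tf, hef⟩ := h1.exists_involutions hp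
    (K := gen {x, b, c} ⊓ gen {x, a, c}) inf_le_left ⟨hx, hx'⟩ ⟨hc, hc'⟩ h.nx h.nc h.not_pm_mul.1
    h.not_pm_mul.2
  have l1 := h1.le_permSub hp he.1 hf.1 te tf hef
  have l2 := h2.le_permSub hp he.2 hf.2 te tf hef
  refine permSub_ne_top hp (W := e.1) ?_ ?_ ?_ ?_ (h.eq_top (neg_one_mem_permSub _) (l2 ha') (l1 hb) (l1 hc))
  · refine (Finset.card_union_le _ _).trans_lt ?_
    have := Finset.card_le_three (a := e.1) (b := f.1) (c := (e * f).1)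
    have := Finset.card_image_le (s := ({e.1, f.1, (e * f).1} : Finset _)) (f := Neg.neg)
    omega
  · simp
  · rw [← tr_eq_trace, te]
  · rw [e.2]; exact one_ne_zero

end Unreplaced

lemma EType.tType {s : ℕ} {H : Subgroup (SLp p)} (hH : EType s H) (h2 : ∀ t : ZMod p, t ^ 2 ≠ 2)
    (h5 : ∀ t : ZMod p, t ^ 2 ≠ 5) : TType H where
  neg := hH.neg
  notP := hH.notP
  notD := hH.notD
  trace A hA := by
    by_cases hpm : PM A
    · exact Or.inl hpm
    right
    rcases hH.pow A hA with h | h | h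
    · exact Or.inl (tr_eq_of_pow_two hpm h)
    · exact Or.inr (tr_eq_of_pow_three hpm h)
    · rcases hH.card with ⟨rfl, -⟩ | ⟨rfl, -⟩ | ⟨rfl, -⟩
      · exact Or.inr (tr_eq_of_pow_three hpm h)
      · exact Or.inl ((tr_eq_of_pow_four hpm h).resolve_right (h2 _))
      · exact absurd (show (2 * tr A ^ 2 - 3) ^ 2 = 5 by
          linear_combination 4 * tr_eq_of_pow_five hpm h) (h5 _)

theorem RP3_of_mod (hp : 5 < p) (h8 : p % 8 = 3 ∨ p % 8 = 5) (h10 : p % 10 = 3 ∨ p % 10 = 7) : RP3 p := by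
  have h2 : ∀ t : ZMod p, t ^ 2 ≠ 2 := by
    intro t ht
    have := (ZMod.exists_sq_eq_two_iff (p := p) (by omega)).1 ⟨t, by rw [← ht, sq]⟩
    omega
  have h5 : ∀ t : ZMod p, t ^ 2 ≠ 5 := by
    intro t ht
    have hsq : ∀ y : ZMod 5, ¬ (y * y = 2 ∨ y * y = 3) := by decide
    haveI : Fact (Nat.Prime 5) := ⟨by norm_num⟩
    have := (ZMod.exists_sq_eq_prime_iff_of_mod_four_eq_one (p := 5) (q := p) (by norm_num) (by omega)).2
      ⟨t, by push_cast; rw [← ht, sq]⟩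
    obtain ⟨y, hy⟩ := this
    have hm : (p : ZMod 5) = 2 ∨ (p : ZMod 5) = 3 := by
      have : ((p % 5 : ℕ) : ZMod 5) = p := ZMod.natCast_mod p 5
      rw [← this]
      have : p % 5 = 2 ∨ p % 5 = 3 := by omega
      rcases this with h | h <;> rw [h]
      · left; rfl
      · right; rfl
    rw [hy] at hm
    exact hsq y hm
  have h7 : 7 ≤ p := by
    rcases Nat.lt_or_ge p 7 with h | h
    · have : p = 6 := by omega
      omega
    · exact h
  intro A hA x hx1 hx2
  by_contra! hcon
  have hd : ∀ j, ¬ PM (A j) := by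
    intro j hj
    apply hA.2 j
    rw [eq_top_iff, ← hA.1, gen_range_le]
    obtain ⟨hn, hm⟩ := gen_image_le.1 (le_refl (gen (A '' {k | k ≠ j})))
    refine ⟨hn, fun k => ?_⟩
    by_cases h : k = j
    · rw [h]; exact hj.mem hn
    · exact hm k h
  have hrange : ∀ B : Fin 3 → SLp p, Set.range B = {B 0, B 1, B 2} := by
    intro B; ext y; simp [Fin.exists_fin_succ, eq_comm]
  have e0 := hcon 0
  have e1 := hcon 1
  have e2 := hcon 2
  rw [hrange] at e0 e1 e2
  simp [Function.update] at e0 e1 e2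
  have hcfg : Unreplaced x (A 0) (A 1) (A 2) :=
    { top := by rw [← hrange]; exact hA.1
      nx := fun h => h.elim hx1 hx2
      ne_a := e0
      ne_b := by rw [Set.insert_comm]; exact e1
      ne_c := by
        have : ({x, A 0, A 1} : Set (SLp p)) = {A 0, A 1, x} := by ext; simp; tauto
        rw [this]; exact e2
      na := hd 0
      nb := hd 1
      nc := hd 2 }
  have hdt : ∀ {a b c : SLp p}, Unreplaced x a b c → DType (gen {x, b, c}) ∨ TType (gen {x, b, c}) := by
    intro a b c h
    rcases classification hp (neg_one_mem_gen _) h.ne_a with h' | h' | ⟨s, h'⟩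
    · exact Or.inl (h.not_P hp h')
    · exact Or.inl h'
    · exact Or.inr (h'.tType h2 h5)
  generalize A 0 = a at hcfg
  generalize A 1 = b at hcfg
  generalize A 2 = c at hcfg
  have c2 : ({x, c, a} : Set (SLp p)) = {x, a, c} := by rw [Set.pair_comm]
  have c3 : ({x, c, b} : Set (SLp p)) = {x, b, c} := by rw [Set.pair_comm]
  have c4 : ({x, b, a} : Set (SLp p)) = {x, a, b} := by rw [Set.pair_comm]
  have r1 := hdt hcfg
  have r2 := hdt hcfg.rot
  have r3 := hdt hcfg.rot.rot
  rw [c2] at r2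
  rcases r1 with r1 | r1 <;> rcases r2 with r2 | r2
  · rcases r3 with r3 | r3
    · exact hcfg.ddd hp r1 r2 r3
    · exact hcfg.ddt hp r1 r2 r3
  · rcases r3 with r3 | r3
    · exact hcfg.rot.rot.ddt hp r3 (by rw [c3]; exact r1) (by rw [c2]; exact r2)
    · exact hcfg.rot.tt hp h7 (by rw [c2]; exact r2) (by rw [c4]; exact r3)
  · rcases r3 with r3 | r3
    · exact hcfg.rot.ddt hp (by rw [c2]; exact r2) (by rw [c4]; exact r3) r1
    · exact hcfg.rot.rot.tt hp h7 r3 (by rw [c3]; exact r1)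
  · exact hcfg.tt hp h7 r1 r2

end Replacement

/-- The element `a + b√2 + cτ + d√2τ` of `ℤ[√2, τ]`, where `τ² = τ + 1`. -/
structure ZR where
  a : ℤ
  b : ℤ
  c : ℤ
  d : ℤ

namespace ZR

def ofInt (n : ℤ) : ZR := ⟨n, 0, 0, 0⟩

def add (x y : ZR) : ZR := ⟨x.a + y.a, x.b + y.b, x.c + y.c, x.d + y.d⟩

def neg (x : ZR) : ZR := ⟨-x.a, -x.b, -x.c, -x.d⟩

def sub (x y : ZR) : ZR := ⟨x.a - y.a, x.b - y.b, x.c - y.c, x.d - y.d⟩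

def mul (x y : ZR) : ZR :=
  ⟨x.a * y.a + 2 * (x.b * y.b) + x.c * y.c + 2 * (x.d * y.d),
    x.a * y.b + x.b * y.a + x.c * y.d + x.d * y.c,
    x.a * y.c + x.c * y.a + 2 * (x.b * y.d + x.d * y.b) + x.c * y.c + 2 * (x.d * y.d),
    x.a * y.d + x.d * y.a + x.b * y.c + x.c * y.b + x.c * y.d + x.d * y.c⟩

/-- The norm of `e + fτ`. -/
def norm₂ (e f : ℤ) : ℤ := e * e + e * f - f * f

/-- The norm to `ℤ`. -/
def norm (x : ZR) : ℤ :=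
  norm₂ (x.a * x.a + x.c * x.c - 2 * (x.b * x.b) - 2 * (x.d * x.d))
    (2 * (x.a * x.c) + x.c * x.c - 4 * (x.b * x.d) - 2 * (x.d * x.d))

/-- All prime divisors of the norm are among the excluded primes. -/
def nz (x : ZR) : Bool :=
  !(Nat.beq x.norm.natAbs 0) && Nat.beq ((1360590 ^ 64) % x.norm.natAbs) 0

section Eval

variable {K : Type*} [Field K] (s t : K)

/-- Evaluation of `a + b√2 + cτ + d√2τ`. -/
def ev (x : ZR) : K := x.a + x.b * s + x.c * t + x.d * (s * t)

lemma ev_ofInt (n : ℤ) : (ofInt n).ev s t = n := by simp [ev, ofInt]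

lemma ev_add (x y : ZR) : (x.add y).ev s t = x.ev s t + y.ev s t := by
  simp only [ev, add]; push_cast; ring

lemma ev_sub (x y : ZR) : (x.sub y).ev s t = x.ev s t - y.ev s t := by
  simp only [ev, sub]; push_cast; ring

lemma ev_neg (x : ZR) : x.neg.ev s t = -x.ev s t := by
  simp only [ev, neg]; push_cast; ring

variable {s t}

lemma ev_mul (hs : s * s = 2) (ht : t * t = t + 1) (x y : ZR) :
    (x.mul y).ev s t = x.ev s t * y.ev s t := by
  simp only [ev, mul]; push_cast
  linear_combination (-((x.b : K) * y.b + (x.b * y.d + x.d * y.b) * t + x.d * y.d * (t * t))) * hs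
    - ((x.c : K) * y.c + (x.c * y.d + x.d * y.c) * s + 2 * (x.d * y.d)) * ht

lemma norm_eq_zero (hs : s * s = 2) (ht : t * t = t + 1) {x : ZR} (h : x.ev s t = 0) :
    (x.norm : K) = 0 := by
  have h1 : ((x.a * x.a + x.c * x.c - 2 * (x.b * x.b) - 2 * (x.d * x.d) : ℤ) : K) +
      ((2 * (x.a * x.c) + x.c * x.c - 4 * (x.b * x.d) - 2 * (x.d * x.d) : ℤ) : K) * t = 0 := by
    have : ((x.a : K) + x.b * s + x.c * t + x.d * (s * t)) * (x.a - x.b * s + x.c * t - x.d * (s * t)) = 0 := by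
      rw [ev] at h; rw [h, zero_mul]
    push_cast
    linear_combination this + ((x.b : K) + x.d * t) ^ 2 * hs - (x.c * x.c - 2 * (x.d * x.d) : K) * ht
  set e := x.a * x.a + x.c * x.c - 2 * (x.b * x.b) - 2 * (x.d * x.d)
  set f := 2 * (x.a * x.c) + x.c * x.c - 4 * (x.b * x.d) - 2 * (x.d * x.d)
  show ((norm₂ e f : ℤ) : K) = 0
  rw [norm₂]; push_cast
  linear_combination ((e : K) + f * (1 - t)) * h1 + (f : K) ^ 2 * ht

end Eval

end ZR

open ZR

/-- A field over `ZMod p` with elements `√2` and `τ`, where the excluded primes are invertible. -/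
structure Emb (p : ℕ) [Fact p.Prime] (K : Type) [Field K] [Algebra (ZMod p) K] where
  s : K
  t : K
  hs : s * s = 2
  ht : t * t = t + 1
  inv : ((1360590 : ℤ) : K) ≠ 0

section

variable {p : ℕ} [Fact p.Prime]

lemma exists_emb (hp : 5 < p) (h7 : p ≠ 7) (h11 : p ≠ 11) (h19 : p ≠ 19) (h31 : p ≠ 31) :
    Nonempty (Emb p (AlgebraicClosure (ZMod p))) := by
  obtain ⟨s, hs⟩ := IsAlgClosed.exists_eq_mul_self (2 : AlgebraicClosure (ZMod p))
  obtain ⟨r, hr⟩ := IsAlgClosed.exists_eq_mul_self (5 : AlgebraicClosure (ZMod p))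
  have h2 : (2 : AlgebraicClosure (ZMod p)) ≠ 0 := by
    intro h
    apply two_ne hp
    apply (algebraMap (ZMod p) (AlgebraicClosure (ZMod p))).injective
    rw [map_ofNat, map_zero]; exact h
  refine ⟨⟨s, (1 + r) / 2, hs.symm, ?_, ?_⟩⟩
  · field_simp
    linear_combination -hr
  · intro h
    have h' : ((1360590 : ℕ) : ZMod p) = 0 := by
      apply (algebraMap (ZMod p) (AlgebraicClosure (ZMod p))).injective
      rw [map_natCast, map_zero]; exact_mod_cast h
    rw [ZMod.natCast_eq_zero_iff] at h'
    have hpp := (Fact.out : p.Prime)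
    have : (1360590 : ℕ) = 2 * (3 * (5 * (7 * (11 * (19 * 31))))) := by norm_num
    rw [this] at h'
    have aux : ∀ q m : ℕ, q.Prime → p ≠ q → p ∣ q * m → p ∣ m := fun q m hq hne hd => by
      rcases (Nat.Prime.dvd_mul hpp).1 hd with h | h
      · exact absurd ((Nat.prime_dvd_prime_iff_eq hpp hq).1 h) hne
      · exact h
    have h1 := aux 2 _ (by norm_num) (by omega) h'
    have h1 := aux 3 _ (by norm_num) (by omega) h1
    have h1 := aux 5 _ (by norm_num) (by omega) h1
    have h1 := aux 7 _ (by norm_num) (by omega) h1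
    have h1 := aux 11 _ (by norm_num) (by omega) h1
    have h1 := aux 19 _ (by norm_num) (by omega) h1
    exact h31 ((Nat.prime_dvd_prime_iff_eq hpp (by norm_num)).1 h1)

namespace Emb

variable {K : Type} [Field K] [Algebra (ZMod p) K] (e : Emb p K)

/-- Evaluation in `K`. -/
def ev (x : ZR) : K := x.ev e.s e.t

@[simp] lemma ev_ofInt (n : ℤ) : e.ev (ZR.ofInt n) = n := ZR.ev_ofInt _ _ _
@[simp] lemma ev_add (x y : ZR) : e.ev (x.add y) = e.ev x + e.ev y := ZR.ev_add _ _ _ _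
@[simp] lemma ev_sub (x y : ZR) : e.ev (x.sub y) = e.ev x - e.ev y := ZR.ev_sub _ _ _ _
@[simp] lemma ev_neg (x : ZR) : e.ev x.neg = -e.ev x := ZR.ev_neg _ _ _
@[simp] lemma ev_mul (x y : ZR) : e.ev (x.mul y) = e.ev x * e.ev y := ZR.ev_mul e.hs e.ht _ _

lemma ev_ne_zero {x : ZR} (h : x.nz = true) : e.ev x ≠ 0 := by
  intro h0
  have h1 := ZR.norm_eq_zero e.hs e.ht h0
  simp only [nz, Bool.and_eq_true, Bool.not_eq_true'] at h
  have h2 : x.norm ∣ (1360590 : ℤ) ^ 64 := by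
    have := Nat.dvd_of_mod_eq_zero (Nat.eq_of_beq_eq_true h.2)
    rw [← Int.natAbs_dvd]
    exact_mod_cast this
  obtain ⟨m, hm⟩ := h2
  have : (((1360590 : ℤ) : K)) ^ 64 = 0 := by
    rw [← Int.cast_pow, hm, Int.cast_mul, h1, zero_mul]
  exact e.inv (pow_eq_zero_iff (by norm_num) |>.1 this)

lemma nz_eq_false {x : ZR} (h : e.ev x = 0) : x.nz = false := by
  by_contra h'
  exact e.ev_ne_zero (by simpa using h') h

/-- The image of the trace. -/
def T (_ : Emb p K) (A : SLp p) : K := algebraMap (ZMod p) K (tr A)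

end Emb

end

namespace ZR

/-- The traces of the elements of finite subgroups of `SL(2)` without elements of order at least 6. -/
def P9 : ℕ → ZR
  | 0 => ⟨0, 0, 0, 0⟩
  | 1 => ⟨1, 0, 0, 0⟩
  | 2 => ⟨-1, 0, 0, 0⟩
  | 3 => ⟨0, 1, 0, 0⟩
  | 4 => ⟨0, -1, 0, 0⟩
  | 5 => ⟨0, 0, 1, 0⟩
  | 6 => ⟨0, 0, -1, 0⟩
  | 7 => ⟨-1, 0, 1, 0⟩
  | _ => ⟨1, 0, -1, 0⟩

def S4 : List ℕ := [0, 1, 2, 3, 4]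
def S5 : List ℕ := [0, 1, 2, 5, 6, 7, 8]
def S9 : List ℕ := [0, 1, 2, 3, 4, 5, 6, 7, 8]

/-- Whether `x` can be a member of `S`. -/
def inS (S : List ℕ) (x : ZR) : Bool := S.any fun r => !(x.sub (P9 r)).nz

/-- The coefficients of a word in `A` and `B` with respect to `1, A, B, AB`. -/
structure Co where
  k : ZR
  a : ZR
  b : ZR
  ab : ZR

def co1 : Co := ⟨ofInt 1, ofInt 0, ofInt 0, ofInt 0⟩

def mulA (t₁ t₂ : ℤ) (x : ZR) (v : Co) : Co :=
  ⟨((v.b.mul (x.sub (ofInt (t₁ * t₂)))).sub v.a).sub (v.ab.mul (ofInt t₂)),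
    ((v.k.add (v.a.mul (ofInt t₁))).add (v.b.mul (ofInt t₂))).add (v.ab.mul x),
    (v.b.mul (ofInt t₁)).add v.ab, v.b.neg⟩

def mulB (t₂ : ℤ) (v : Co) : Co :=
  ⟨v.b.neg, v.ab.neg, v.k.add (v.b.mul (ofInt t₂)), v.a.add (v.ab.mul (ofInt t₂))⟩

def coW (t₁ t₂ : ℤ) (x : ZR) : List Bool → Co
  | [] => co1
  | true :: w => mulA t₁ t₂ x (coW t₁ t₂ x w)
  | false :: w => mulB t₂ (coW t₁ t₂ x w)

def Co.lin (v : Co) (k a b ab : ZR) : ZR :=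
  (((v.k.mul k).add (v.a.mul a)).add (v.b.mul b)).add (v.ab.mul ab)

def W4 : List (List Bool) :=
  [[false, true, false], [true, false, true, false], [false, false, true, false],
   [false, true, false, false]]

def words (S : List ℕ) (t₁ t₂ : ℤ) (x c : ZR) (y z r : ZR) : Bool :=
  W4.all fun w => inS S ((coW t₁ t₂ x w).lin c y z r)

def trP (t₁ t₂ t₃ : ℤ) (x y z : ZR) : ZR :=
  ((((ofInt t₁).mul z).add ((ofInt t₂).mul y)).add ((ofInt t₃).mul x)).sub (ofInt (t₁ * t₂ * t₃))

def trQ (t₁ t₂ t₃ : ℤ) (x y z : ZR) : ZR :=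
  ((((((x.mul x).add (y.mul y)).add (z.mul z)).add (x.mul (y.mul z))).sub ((ofInt (t₁ * t₂)).mul x)).sub
    (((ofInt (t₁ * t₃)).mul y).add ((ofInt (t₂ * t₃)).mul z))).add
    (ofInt (t₁ * t₁ + t₂ * t₂ + t₃ * t₃ - 4))

/-- Whether `r` can be the trace of `ABC`. -/
def isRoot (t₁ t₂ t₃ : ℤ) (x y z r : ZR) : Bool :=
  !(((r.mul r).sub (r.mul (trP t₁ t₂ t₃ x y z))).add (trQ t₁ t₂ t₃ x y z)).nz

def core (S : List ℕ) (t₁ t₂ t₃ : ℤ) (x y z r : ZR) : Bool :=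
  isRoot t₁ t₂ t₃ x y z r && inS S ((trP t₁ t₂ t₃ x y z).sub r) &&
    words S t₁ t₂ x (ofInt t₃) y z r && words S t₂ t₃ z (ofInt t₁) x y r &&
    words S t₃ t₁ y (ofInt t₂) z x r

def chkE (t₁ t₂ t₃ : ℤ) (x y z : ℕ) : Bool :=
  [S4, S5].any fun S => S.elem x && S.elem y && S.elem z &&
    S.any fun r => core S t₁ t₂ t₃ (P9 x) (P9 y) (P9 z) (P9 r)

/-- Whether the first element can be the only one commuting with the axis of a dihedral group. -/
def rot (t₁ t₂ t₃ : Bool) (x y z : ℕ) : Bool :=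
  !t₂ && !t₃ && Nat.beq x 0 && Nat.beq y 0 &&
    (if t₁ then !([1, 2].elem z) else [1, 2, 5, 6, 7, 8].elem z)

def chkD (t₁ t₂ t₃ : Bool) (x y z : ℕ) : Bool :=
  rot t₁ t₂ t₃ x y z || rot t₂ t₁ t₃ x z y || rot t₃ t₁ t₂ y z x

def tz (t : Bool) : ℤ := if t then 1 else 0

/-- The possible traces of products of two elements. -/
def dom : Bool → Bool → List ℕ
  | false, false => S9
  | true, true => [0, 1]
  | _, _ => [0, 1, 2]

/-- Bit masks of the possible traces of products of pairs from a triple. -/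
def tab : Bool → Bool → Bool → ℕ
  | false, false, false => 730845575703668624374451376691654697771313959778696045221328741360958425116992732386344584236314050030831769898735463561949453555325391998076836314260440799512696207803927690112757207760391599384299259797298378944020454
  | false, false, true => 921538837725003367760043067377037029592215592261427259174623474384457809614905924938915720647861291732914365534003011926927652207977845244960991073679537632469308121344949266801672569999817927047774727
  | false, true, true => 17538019647970835018444225246150313923646239540739
  | _, _, _ => 1242775742563838791597949953

def tabT (t₁ t₂ t₃ : Bool) (x y z : ℕ) : Bool := (tab t₁ t₂ t₃).testBit (81 * x + 9 * y + z)

def tabOK (t₁ t₂ t₃ : Bool) : Bool :=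
  (dom t₁ t₂).all fun x => (dom t₁ t₃).all fun y => (dom t₂ t₃).all fun z =>
    !(chkD t₁ t₂ t₃ x y z || chkE (tz t₁) (tz t₂) (tz t₃) x y z) || tabT t₁ t₂ t₃ x y z

set_option maxRecDepth 100000

lemma tabOK_fff : tabOK false false false = true := by decide +kernel
lemma tabOK_fft : tabOK false false true = true := by decide +kernel
lemma tabOK_ftt : tabOK false true true = true := by decide +kernel
lemma tabOK_ttt : tabOK true true true = true := by decide +kernel

end ZR

namespace ZR

/-- The determinant of a symmetric matrix. -/
def det3 (k₀ k₁ k₂ a b d : ZR) : ZR :=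
  ((k₀.mul ((k₁.mul k₂).sub (d.mul d))).sub (a.mul ((a.mul k₂).sub (d.mul b)))).add
    (b.mul ((a.mul d).sub (k₁.mul b)))

/-- The determinant of a symmetric matrix, expanded along the last row and column. -/
def det4 (k₀ k₁ k₂ k₃ a b c d e f : ZR) : ZR :=
  (k₃.mul (det3 k₀ k₁ k₂ a b d)).sub
    ((((((k₁.mul k₂).sub (d.mul d)).mul (c.mul c)).add
      (((k₀.mul k₂).sub (b.mul b)).mul (e.mul e))).add (((k₀.mul k₁).sub (a.mul a)).mul (f.mul f))).add
      ((ofInt 2).mul ((((d.mul b).sub (a.mul k₂)).mul (c.mul e)).add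
        ((((a.mul d).sub (b.mul k₁)).mul (c.mul f)).add (((a.mul b).sub (d.mul k₀)).mul (e.mul f))))))

/-- The entries of the Gram matrix of trace zero parts. -/
def gm (t₁ t₂ : Bool) (x : ZR) : ZR := (ofInt (tz t₁ * tz t₂)).sub ((ofInt 2).mul x)

def gd (t : Bool) : ZR := ofInt (4 - tz t)

def cfgDet (t₀ t₁ t₂ t₃ : Bool) (x y w z u v : ℕ) : ZR :=
  det4 (gd t₀) (gd t₁) (gd t₂) (gd t₃) (gm t₀ t₁ (P9 x)) (gm t₀ t₂ (P9 y)) (gm t₀ t₃ (P9 w))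
    (gm t₁ t₂ (P9 z)) (gm t₁ t₃ (P9 u)) (gm t₂ t₃ (P9 v))

def cfgDet3 (t₀ t₁ t₂ : Bool) (x y z : ℕ) : ZR :=
  det3 (gd t₀) (gd t₁) (gd t₂) (gm t₀ t₁ (P9 x)) (gm t₀ t₂ (P9 y)) (gm t₁ t₂ (P9 z))

/-- The traces of products of two elements. -/
def trM (t : Fin 4 → Bool) (x : Fin 6 → ℕ) (i j : Fin 4) : ZR :=
  match i, j with
  | 0, 1 | 1, 0 => P9 (x 0)
  | 0, 2 | 2, 0 => P9 (x 1)
  | 0, 3 | 3, 0 => P9 (x 2)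
  | 1, 2 | 2, 1 => P9 (x 3)
  | 1, 3 | 3, 1 => P9 (x 4)
  | 2, 3 | 3, 2 => P9 (x 5)
  | i, _ => ofInt (tz (t i) - 2)

def dot (v w : Fin 4 → ZR) : ZR :=
  (((v 0).mul (w 0)).add ((v 1).mul (w 1))).add (((v 2).mul (w 2)).add ((v 3).mul (w 3)))

/-- Conjugation by the `k`-th element, of order 2. -/
def half (m : Fin 4 → Fin 4 → ZR) (k : Fin 4) (v : Fin 4 → ZR) : Fin 4 → ZR := fun q =>
  (v q).neg.sub (if q = k then dot v (m k) else ofInt 0)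

def basisV (j : Fin 4) : Fin 4 → ZR := fun q => ofInt (if q = j then 1 else 0)

def eqz (x y : ZR) : Bool := x.a == y.a && x.b == y.b && x.c == y.c && x.d == y.d

def conjV (m : Fin 4 → Fin 4 → ZR) (j : Fin 4) : List (Fin 4) → Fin 4 → ZR
  | [] => basisV j
  | k :: w => half m k (conjV m j w)

/-- Whether the `i`-th element is a conjugate of the `j`-th one up to inversion. -/
def hint (t : Fin 4 → Bool) (m : Fin 4 → Fin 4 → ZR) (i j : Fin 4) (w : List (Fin 4)) : Bool :=
  let g := fun a b => gm (t a) (t b) (m a b)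
  let v := conjV m j w
  !(j == i) && t i == t j && (w.all fun k => !(k == i) && !(t k)) &&
    ([0, 1, 2].all (fun q => eqz (dot v (g q)) (g q i)) ||
      [0, 1, 2].all (fun q => eqz (dot v (g q)) (g q i).neg))

/-- Residues of the traces modulo 241, used to discard hints quickly. -/
def P9m : ℕ → ℕ
  | 0 => 0
  | 1 => 1
  | 2 => 240
  | 3 => 22
  | 4 => 219
  | 5 => 52
  | 6 => 189
  | 7 => 51
  | _ => 190

/-- Vectors modulo 241. -/
structure N4 where
  c0 : ℕ
  c1 : ℕ
  c2 : ℕ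
  c3 : ℕ

def trR (t₀ t₁ t₂ t₃ : Bool) (x y w z u v : ℕ) : Fin 4 → N4
  | 0 => ⟨cond t₀ 240 239, P9m x, P9m y, P9m w⟩
  | 1 => ⟨P9m x, cond t₁ 240 239, P9m z, P9m u⟩
  | 2 => ⟨P9m y, P9m z, cond t₂ 240 239, P9m v⟩
  | 3 => ⟨P9m w, P9m u, P9m v, cond t₃ 240 239⟩

def N4.dot (v w : N4) : ℕ := (v.c0 * w.c0 + v.c1 * w.c1 + v.c2 * w.c2 + v.c3 * w.c3) % 241

def N4.conj (m : Fin 4 → N4) (j : Fin 4) : List (Fin 4) → N4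
  | [] => match j with
    | 0 => ⟨1, 0, 0, 0⟩
    | 1 => ⟨0, 1, 0, 0⟩
    | 2 => ⟨0, 0, 1, 0⟩
    | 3 => ⟨0, 0, 0, 1⟩
  | k :: w => let v := N4.conj m j w
    let d := 482 - v.dot (m k)
    match k with
    | 0 => ⟨(d - v.c0) % 241, 241 - v.c1, 241 - v.c2, 241 - v.c3⟩
    | 1 => ⟨241 - v.c0, (d - v.c1) % 241, 241 - v.c2, 241 - v.c3⟩
    | 2 => ⟨241 - v.c0, 241 - v.c1, (d - v.c2) % 241, 241 - v.c3⟩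
    | 3 => ⟨241 - v.c0, 241 - v.c1, 241 - v.c2, (d - v.c3) % 241⟩

/-- A necessary condition for `hint`, for involutions only. -/
def filt (m : Fin 4 → N4) (i j : Fin 4) (w : List (Fin 4)) : Bool :=
  let v := N4.conj m j w
  let r := m i
  let d := v.dot (m 3)
  if Nat.beq i.1 3 then Nat.beq (v.dot (m 2)) r.c2 || Nat.beq (v.dot (m 2)) ((241 - r.c2) % 241) else
    Nat.beq d r.c3 || Nat.beq d ((241 - r.c3) % 241)

def close (t₀ t₁ t₂ t₃ : Bool) (x y w z u v : ℕ) (l : List (Fin 4 × Fin 4 × List (Fin 4))) : Bool :=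
  (cfgDet t₀ t₁ t₂ t₃ x y w z u v).nz || ((cfgDet3 t₀ t₁ t₂ x y z).nz &&
    l.any fun h => (t₃ || filt (trR t₀ t₁ t₂ t₃ x y w z u v) h.1 h.2.1 h.2.2) &&
      hint ![t₀, t₁, t₂, t₃] (trM ![t₀, t₁, t₂, t₃] ![x, y, w, z, u, v]) h.1 h.2.1 h.2.2)

def hints : List (Fin 4 × Fin 4 × List (Fin 4)) :=
  [(1, 2, [3, 0]), (3, 0, [2, 1]), (2, 0, [0, 3, 1, 0, 3]), (0, 3, [3, 2, 3, 1]), (2, 3, [3, 0, 3, 1]),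
   (2, 3, [1, 0]), (0, 2, [2, 1, 2, 3]), (0, 2, [3, 2, 3, 2, 1]), (1, 3, [2, 0, 2, 0, 2]),
   (3, 2, [0, 1, 0, 1]), (0, 1, [1, 2, 1, 2, 3]), (0, 2, [3, 1, 2, 3, 1]), (2, 1, [1, 0, 1, 0, 3]),
   (1, 2, [2, 0, 2, 3]), (0, 2, [2, 1, 2, 3, 1]), (3, 1, [1, 0, 2]), (3, 2, [1, 0, 1])]

def hints₀ : List (Fin 4 × Fin 4 × List (Fin 4)) := [(0, 1, [2, 3, 2]), (0, 1, [2, 1, 2, 3])]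

/-- The case of three elements of order 2 and one of order 3, where `xi3 = 0`. -/
def swapOK (xjk xji xj3 xki xk3 xi3 : ℕ) : Bool :=
  Nat.beq xi3 0 && !chkD false false true xji xj3 0 && !chkD false false true xki xk3 0 &&
  S9.all fun a => !isRoot 0 0 1 (P9 xji) (P9 xj3) (P9 0) (P9 a) ||
    S9.all fun b => !isRoot 0 0 1 (P9 xki) (P9 xk3) (P9 0) (P9 b) ||
      close false false false false xjk xji a xki b 2 hints₀

def chkCfg (t₀ t₁ t₂ t₃ : Bool) (x y w z u v : ℕ) : Bool :=
  close t₀ t₁ t₂ t₃ x y w z u v hints || (!t₀ && !t₁ && !t₂ && t₃ &&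
    (swapOK z x u y v w || swapOK y x w z v u || swapOK x y w z u v))

def dom₀ : Bool → Bool → List ℕ
  | false, false => [0, 1, 3, 5, 7]
  | false, true => [0, 1]
  | s, t => dom s t

def chkAll (t₀ t₁ t₂ t₃ : Bool) : Bool :=
  (dom₀ t₀ t₁).all fun x => (dom₀ t₀ t₂).all fun y => (dom t₁ t₂).all fun z => !tabT t₀ t₁ t₂ x y z ||
    (dom₀ t₀ t₃).all fun w => (dom t₁ t₃).all fun u => !tabT t₀ t₁ t₃ x w u ||
      (dom t₂ t₃).all fun v => !tabT t₀ t₂ t₃ y w v || !tabT t₁ t₂ t₃ z u v ||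
        chkCfg t₀ t₁ t₂ t₃ x y w z u v

set_option maxRecDepth 100000

set_option maxHeartbeats 0

lemma chkAll_tttt : chkAll true true true true = true := by decide +kernel
lemma chkAll_fttt : chkAll false true true true = true := by decide +kernel
lemma chkAll_fftt : chkAll false false true true = true := by decide +kernel
lemma chkAll_ffft : chkAll false false false true = true := by decide +kernel
lemma chkAll_ffff : chkAll false false false false = true := by decide +kernel

end ZR

section Words

variable {p : ℕ} [Fact p.Prime]

lemma tr_mul_comm (A B : SLp p) : tr (A * B) = tr (B * A) := by
  simp only [tr, m00, m01, m10, m11]; ring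

lemma tr_inv (A : SLp p) : tr A⁻¹ = tr A := by simp [tr, add_comm]

lemma tr_inv_mul (A C : SLp p) : tr (A⁻¹ * C) = tr A * tr C - tr (A * C) := by
  simp only [tr, m00, m01, m10, m11, i00, i01, i10, i11]; ring

lemma tr_mul_mul_self (A C : SLp p) : tr (A * (A * C)) = tr A * tr (A * C) - tr C := by
  simp only [tr, m00, m01, m10, m11]
  linear_combination -(C.1 0 0 + C.1 1 1) * sl_det A

lemma tr_mul_swap (A B C : SLp p) : tr (B * (A * C)) = (tr (A * B) - tr A * tr B) * tr C +
    tr B * tr (A * C) + tr A * tr (B * C) - tr (A * (B * C)) := by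
  simp only [tr, m00, m01, m10, m11]; ring

lemma tr_mul_mul_mul (A B C : SLp p) : tr (A * (B * (A * C))) =
    tr (A * B) * tr (A * C) + tr (B * C) - tr B * tr C := by
  simp only [tr, m00, m01, m10, m11]
  linear_combination (B.1 0 0 * C.1 0 0 + B.1 0 1 * C.1 1 0 + B.1 1 0 * C.1 0 1 + B.1 1 1 * C.1 1 1 -
    (B.1 0 0 + B.1 1 1) * (C.1 0 0 + C.1 1 1)) * sl_det A

lemma tr_triple_add (A B C : SLp p) : tr (A * (B * C)) + tr (A * (C * B)) =
    tr A * tr (B * C) + tr B * tr (A * C) + tr C * tr (A * B) - tr A * tr B * tr C := by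
  simp only [tr, m00, m01, m10, m11]; ring

lemma tr_triple_mul (A B C : SLp p) : tr (A * (B * C)) * tr (A * (C * B)) =
    tr (A * B) ^ 2 + tr (A * C) ^ 2 + tr (B * C) ^ 2 + tr (A * B) * tr (A * C) * tr (B * C)
      - tr A * tr B * tr (A * B) - tr A * tr C * tr (A * C) - tr B * tr C * tr (B * C)
      + tr A ^ 2 + tr B ^ 2 + tr C ^ 2 - 4 := by
  have hA := sl_det A
  have hB := sl_det B
  have hC := sl_det C
  simp only [tr, m00, m01, m10, m11]
  generalize A.1 0 0 = a, A.1 0 1 = b, A.1 1 0 = c, A.1 1 1 = d at *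
  generalize B.1 0 0 = e, B.1 0 1 = f, B.1 1 0 = g, B.1 1 1 = h at *
  generalize C.1 0 0 = i, C.1 0 1 = j, C.1 1 0 = k, C.1 1 1 = l at *
  have key : (a * (e * i + f * k) + b * (g * i + h * k) + (c * (e * j + f * l) + d * (g * j + h * l))) *
      (a * (i * e + j * g) + b * (k * e + l * g) + (c * (i * f + j * h) + d * (k * f + l * h))) =
      (a * e + b * g + (c * f + d * h)) ^ 2 * (i * l - j * k) + (a * i + b * k + (c * j + d * l)) ^ 2 * (e * h - f * g)
      + (e * i + f * k + (g * j + h * l)) ^ 2 * (a * d - b * c) + (a * e + b * g + (c * f + d * h)) *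
      (a * i + b * k + (c * j + d * l)) * (e * i + f * k + (g * j + h * l))
      - (a + d) * (e + h) * (a * e + b * g + (c * f + d * h)) * (i * l - j * k)
      - (a + d) * (i + l) * (a * i + b * k + (c * j + d * l)) * (e * h - f * g)
      - (e + h) * (i + l) * (e * i + f * k + (g * j + h * l)) * (a * d - b * c)
      + (a + d) ^ 2 * ((e * h - f * g) * (i * l - j * k)) + (e + h) ^ 2 * ((a * d - b * c) * (i * l - j * k))
      + (i + l) ^ 2 * ((a * d - b * c) * (e * h - f * g))
      - 4 * ((a * d - b * c) * ((e * h - f * g) * (i * l - j * k))) := by ring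
  rw [hA, hB, hC] at key
  linear_combination key

/-- The product of a word in `A` and `B`, with the first letter on the right. -/
def wd (A B : SLp p) : List Bool → SLp p
  | [] => 1
  | true :: w => wd A B w * A
  | false :: w => wd A B w * B

lemma wd_mem {A B : SLp p} {H : Subgroup (SLp p)} (hA : A ∈ H) (hB : B ∈ H) :
    ∀ w : List Bool, wd A B w ∈ H
  | [] => one_mem _
  | true :: w => mul_mem (wd_mem hA hB w) hA
  | false :: w => mul_mem (wd_mem hA hB w) hB

namespace Emb

open ZR

variable {K : Type} [Field K] [Algebra (ZMod p) K] (e : Emb p K)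

lemma T_wd {A B : SLp p} {t₁ t₂ : ℤ} {x : ZR} (hA : e.T A = t₁) (hB : e.T B = t₂)
    (hx : e.ev x = e.T (A * B)) (w : List Bool) : ∀ C : SLp p, e.T (wd A B w * C) =
      e.ev (coW t₁ t₂ x w).k * e.T C + e.ev (coW t₁ t₂ x w).a * e.T (A * C) +
        e.ev (coW t₁ t₂ x w).b * e.T (B * C) + e.ev (coW t₁ t₂ x w).ab * e.T (A * (B * C)) := by
  induction w with
  | nil => intro C; simp [wd, coW, co1]
  | cons c w ih =>
    intro C
    cases c
    · have h1 : e.T (B * (B * C)) = t₂ * e.T (B * C) - e.T C := by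
        rw [← hB]; simp only [T]; rw [tr_mul_mul_self]; simp
      have h2 : e.T (A * (B * (B * C))) = t₂ * e.T (A * (B * C)) - e.T (A * C) := by
        rw [← hB]; simp only [T]
        rw [tr_mul_comm A, show B * (B * C) * A = B * (B * (C * A)) by group, tr_mul_mul_self,
          tr_mul_comm A C, show B * (C * A) = B * C * A by group, tr_mul_comm _ A]
        simp
      simp only [wd, coW, mulB, mul_assoc, ih, h1, h2, ev_add, ev_mul, ev_neg, ev_ofInt]
      ring
    · have h1 : e.T (A * (A * C)) = t₁ * e.T (A * C) - e.T C := by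
        rw [← hA]; simp only [T]; rw [tr_mul_mul_self]; simp
      have h2 : e.T (B * (A * C)) = (e.ev x - t₁ * t₂) * e.T C + t₂ * e.T (A * C) + t₁ * e.T (B * C) -
          e.T (A * (B * C)) := by
        rw [← hA, ← hB, hx]; simp only [T]; rw [tr_mul_swap]; simp
      have h3 : e.T (A * (B * (A * C))) = e.ev x * e.T (A * C) + e.T (B * C) - t₂ * e.T C := by
        rw [← hB, hx]; simp only [T]; rw [tr_mul_mul_mul]; simp
      simp only [wd, coW, mulA, mul_assoc, ih, h1, h2, h3, ev_add, ev_sub, ev_mul, ev_neg, ev_ofInt]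
      push_cast
      ring

lemma ev_lin (v : Co) (k a b ab : ZR) : e.ev (v.lin k a b ab) =
    e.ev v.k * e.ev k + e.ev v.a * e.ev a + e.ev v.b * e.ev b + e.ev v.ab * e.ev ab := by
  simp [Co.lin]

/-- The trace of `g` is one of those in `S`. -/
def SIn (S : List ℕ) (g : SLp p) : Prop := ∃ n ∈ S, e.T g = e.ev (P9 n)

lemma inS_of {S : List ℕ} {g : SLp p} {x : ZR} (h : e.SIn S g) (hx : e.ev x = e.T g) :
    inS S x = true := by
  obtain ⟨n, hn, h⟩ := h
  refine List.any_eq_true.2 ⟨n, hn, ?_⟩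
  rw [e.nz_eq_false]; · rfl
  rw [ev_sub, hx, h, sub_self]

lemma isRoot_of {A B C : SLp p} {t₁ t₂ t₃ : ℤ} {x y z r : ZR} (hA : e.T A = t₁) (hB : e.T B = t₂)
    (hC : e.T C = t₃) (hx : e.ev x = e.T (A * B)) (hy : e.ev y = e.T (A * C)) (hz : e.ev z = e.T (B * C))
    (hr : e.ev r = e.T (A * (B * C))) : isRoot t₁ t₂ t₃ x y z r = true ∧
      e.ev ((trP t₁ t₂ t₃ x y z).sub r) = e.T (A * (C * B)) := by
  have h1 := congrArg (algebraMap (ZMod p) K) (tr_triple_add A B C)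
  have h2 := congrArg (algebraMap (ZMod p) K) (tr_triple_mul A B C)
  simp only [map_add, map_sub, map_mul, map_pow, map_ofNat] at h1 h2
  simp only [T] at hA hB hC hx hy hz hr
  rw [hA, hB, hC, ← hx, ← hy, ← hz, ← hr] at h1 h2
  have hP : e.ev ((trP t₁ t₂ t₃ x y z).sub r) = e.T (A * (C * B)) := by
    simp only [trP, ev_add, ev_sub, ev_mul, ev_ofInt, T]; push_cast
    linear_combination -h1
  refine ⟨?_, hP⟩
  rw [isRoot, e.nz_eq_false]; · rfl
  simp only [trP, trQ, ev_add, ev_sub, ev_mul, ev_ofInt, T] at hP ⊢; push_cast at hP ⊢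
  linear_combination -h2 - e.ev r * hP

lemma T_eq_iff {A B : SLp p} : e.T A = e.T B ↔ tr A = tr B :=
  (algebraMap (ZMod p) K).injective.eq_iff

lemma T_eq_zero {A : SLp p} : e.T A = 0 ↔ tr A = 0 := by
  rw [T, map_eq_zero_iff _ (algebraMap (ZMod p) K).injective]

lemma T_eq_one {A : SLp p} : e.T A = 1 ↔ tr A = 1 := by
  rw [T, map_eq_one_iff _ (algebraMap (ZMod p) K).injective]

lemma T_neg (A : SLp p) : e.T (-A) = -e.T A := by rw [T, tr_neg, map_neg, T]

lemma T_sq {A : SLp p} {n : ℕ} (h : tr A ^ 2 = n) : e.T A ^ 2 = n := by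
  rw [T, ← map_pow, h, map_natCast]

lemma SIn.of_sq_zero {S : List ℕ} (h0 : 0 ∈ S) {g : SLp p} (h : tr g = 0) : e.SIn S g :=
  ⟨0, h0, by rw [e.T_eq_zero.2 h]; simp [P9, ev, ZR.ev]⟩

lemma SIn.of_sq_one {S : List ℕ} (h1 : 1 ∈ S) (h2 : 2 ∈ S) {g : SLp p} (h : tr g ^ 2 = 1) :
    e.SIn S g := by
  have := e.T_sq (n := 1) (by exact_mod_cast h)
  rw [Nat.cast_one] at this
  rcases sq_eq_one_iff.1 this with h | h
  · exact ⟨1, h1, by rw [h]; simp [P9, ev, ZR.ev]⟩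
  · exact ⟨2, h2, by rw [h]; simp [P9, ev, ZR.ev]⟩

lemma SIn.of_EType {s : ℕ} {H : Subgroup (SLp p)} (hH : EType s H) :
    ∃ S ∈ [S4, S5], ∀ g ∈ H, ¬ PM g → e.SIn S g := by
  rcases hH.card with ⟨rfl, -⟩ | ⟨rfl, -⟩ | ⟨rfl, -⟩
  · refine ⟨S4, by simp, fun g hg hn => ?_⟩
    rcases hH.pow g hg with h | h | h
    · exact SIn.of_sq_zero e (by simp [S4]) (tr_eq_of_pow_two hn h)
    · exact SIn.of_sq_one e (by simp [S4]) (by simp [S4]) (tr_eq_of_pow_three hn h)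
    · exact SIn.of_sq_one e (by simp [S4]) (by simp [S4]) (tr_eq_of_pow_three hn h)
  · refine ⟨S4, by simp, fun g hg hn => ?_⟩
    rcases hH.pow g hg with h | h | h
    · exact SIn.of_sq_zero e (by simp [S4]) (tr_eq_of_pow_two hn h)
    · exact SIn.of_sq_one e (by simp [S4]) (by simp [S4]) (tr_eq_of_pow_three hn h)
    · rcases tr_eq_of_pow_four hn h with h | h
      · exact SIn.of_sq_zero e (by simp [S4]) h
      · have := e.T_sq (n := 2) (by exact_mod_cast h)
        have h2 : (e.T g - e.s) * (e.T g + e.s) = 0 := by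
          push_cast at this
          linear_combination this - e.hs
        rcases mul_eq_zero.1 h2 with h | h
        · exact ⟨3, by simp [S4], by simp [P9, ev, ZR.ev]; linear_combination h⟩
        · exact ⟨4, by simp [S4], by simp [P9, ev, ZR.ev]; linear_combination h⟩
  · refine ⟨S5, by simp, fun g hg hn => ?_⟩
    rcases hH.pow g hg with h | h | h
    · exact SIn.of_sq_zero e (by simp [S5]) (tr_eq_of_pow_two hn h)
    · exact SIn.of_sq_one e (by simp [S5]) (by simp [S5]) (tr_eq_of_pow_three hn h)
    · have h := congrArg (algebraMap (ZMod p) K) (tr_eq_of_pow_five hn h)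
      have h2 : (e.T g - e.t) * (e.T g + e.t) * ((e.T g - (e.t - 1)) * (e.T g + (e.t - 1))) = 0 := by
        simp only [map_add, map_sub, map_mul, map_pow, map_ofNat, map_zero, map_one] at h
        simp only [T]
        linear_combination h + (-2 * algebraMap (ZMod p) K (tr g) ^ 2 + e.t ^ 2 - e.t + 1) * e.ht
      rcases mul_eq_zero.1 h2 with h | h <;> rcases mul_eq_zero.1 h with h | h
      · exact ⟨5, by simp [S5], by simp [P9, ev, ZR.ev]; linear_combination h⟩
      · exact ⟨6, by simp [S5], by simp [P9, ev, ZR.ev]; linear_combination h⟩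
      · exact ⟨7, by simp [S5], by simp [P9, ev, ZR.ev]; linear_combination h⟩
      · exact ⟨8, by simp [S5], by simp [P9, ev, ZR.ev]; linear_combination h⟩

lemma P9_inj {m n : ℕ} (hm : m ∈ S9) (hn : n ∈ S9) (h : e.ev (P9 m) = e.ev (P9 n)) : m = n := by
  have key : ∀ m ∈ S9, ∀ n ∈ S9, m ≠ n → ((P9 m).sub (P9 n)).nz = true := by decide +kernel
  by_contra hne
  exact e.ev_ne_zero (key m hm n hn hne) (by rw [ev_sub, h, sub_self])

end Emb

/-- No member of the triple lies in the group generated by the other two. -/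
structure Ind3 (A B C : SLp p) : Prop where
  h₁ : A ∉ gen {B, C}
  h₂ : B ∉ gen {C, A}
  h₃ : C ∉ gen {A, B}

lemma Ind3.rot {A B C : SLp p} (h : Ind3 A B C) : Ind3 B C A := ⟨h.h₂, h.h₃, h.h₁⟩

lemma left_mem_gen (A B : SLp p) : A ∈ gen {A, B} := subset_gen _ (by simp)
lemma right_mem_gen (A B : SLp p) : B ∈ gen {A, B} := subset_gen _ (by simp)

lemma mem_of_pm_mul {H : Subgroup (SLp p)} (hH : -1 ∈ H) {A B : SLp p} (hA : A ∈ H) (h : PM (A * B)) :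
    B ∈ H := by
  have := mul_mem (inv_mem hA) (h.mem hH)
  rwa [inv_mul_cancel_left] at this

lemma Ind3.word {A B C : SLp p} (h : Ind3 A B C) (w : List Bool) : ¬ PM (wd A B w * C) := fun hpm =>
  h.h₃ (mem_of_pm_mul (neg_one_mem_gen _) (wd_mem (left_mem_gen A B) (right_mem_gen A B) w) hpm)

namespace Emb

open ZR

variable {K : Type} [Field K] [Algebra (ZMod p) K] (e : Emb p K)

lemma words_of {S : List ℕ} {H : Subgroup (SLp p)} (hS : ∀ g ∈ H, ¬ PM g → e.SIn S g) {A B C : SLp p}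
    (hAH : A ∈ H) (hBH : B ∈ H) (hCH : C ∈ H) (hi : Ind3 A B C) {t₁ t₂ : ℤ} {x c y z r : ZR}
    (hA : e.T A = t₁) (hB : e.T B = t₂) (hx : e.ev x = e.T (A * B)) (hC : e.ev c = e.T C)
    (hy : e.ev y = e.T (A * C)) (hz : e.ev z = e.T (B * C)) (hr : e.ev r = e.T (A * (B * C))) :
    words S t₁ t₂ x c y z r = true := by
  refine List.all_eq_true.2 fun w _ => e.inS_of (hS _ (mul_mem (wd_mem hAH hBH w) hCH) (hi.word w)) ?_
  rw [ev_lin, e.T_wd hA hB hx, hC, hy, hz, hr]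

lemma chkE_of {s : ℕ} {H : Subgroup (SLp p)} (hH : EType s H) {A B C : SLp p}
    (hAH : A ∈ H) (hBH : B ∈ H) (hCH : C ∈ H) (hi : Ind3 A B C) {t₁ t₂ t₃ : ℤ} {x y z : ℕ}
    (hA : e.T A = t₁) (hB : e.T B = t₂) (hC : e.T C = t₃) (mx : x ∈ S9) (my : y ∈ S9) (mz : z ∈ S9)
    (hx : e.T (A * B) = e.ev (P9 x)) (hy : e.T (A * C) = e.ev (P9 y)) (hz : e.T (B * C) = e.ev (P9 z)) :
    chkE t₁ t₂ t₃ x y z = true := by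
  obtain ⟨S, hS, hSH⟩ := SIn.of_EType e hH
  have hS9 := (show ∀ S ∈ [S4, S5], ∀ n ∈ S, n ∈ S9 by decide) S hS
  have hne : ∀ {a b c : SLp p}, Ind3 a b c → ¬ PM (a * b) := fun h hpm =>
    h.h₂ (mem_of_pm_mul (neg_one_mem_gen _) (right_mem_gen _ _) hpm)
  have key : ∀ {g : SLp p} {n : ℕ}, g ∈ H → ¬ PM g → n ∈ S9 → e.T g = e.ev (P9 n) → n ∈ S := by
    intro g n hg hn hm h
    obtain ⟨m, hmS, h'⟩ := hSH g hg hn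
    rwa [e.P9_inj hm (hS9 m hmS) (h.symm.trans h')]
  have hAC : ∀ X Y : SLp p, e.T (X * Y) = e.T (Y * X) := fun X Y => by rw [T_eq_iff, tr_mul_comm]
  have hcyc : ∀ X Y Z : SLp p, e.T (X * (Y * Z)) = e.T (Y * (Z * X)) := fun X Y Z => by
    rw [T_eq_iff, tr_mul_comm, mul_assoc]
  obtain ⟨r, hrS, hr⟩ := hSH (A * (B * C)) (mul_mem hAH (mul_mem hBH hCH)) (by
    simpa [wd, mul_assoc] using hi.word [false, true])
  have hq := hSH _ (mul_mem hAH (mul_mem hCH hBH)) (by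
    simpa [wd, mul_assoc] using hi.rot.rot.word [true, false])
  obtain ⟨h1, h2⟩ := e.isRoot_of hA hB hC hx.symm hy.symm hz.symm hr.symm
  refine List.any_eq_true.2 ⟨S, hS, ?_⟩
  simp only [Bool.and_eq_true, List.elem_eq_mem, decide_eq_true_eq]
  refine ⟨⟨⟨key (mul_mem hAH hBH) (hne hi) mx hx, key (mul_mem hCH hAH) (hne hi.rot.rot) my
    ((hAC _ _).trans hy)⟩, key (mul_mem hBH hCH) (hne hi.rot) mz hz⟩, ?_⟩
  refine List.any_eq_true.2 ⟨r, hrS, ?_⟩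
  simp only [core, Bool.and_eq_true]
  refine ⟨⟨⟨⟨h1, e.inS_of hq h2⟩, ?_⟩, ?_⟩, ?_⟩
  · exact e.words_of hSH hAH hBH hCH hi hA hB hx.symm (by rw [ev_ofInt, hC]) hy.symm hz.symm hr.symm
  · exact e.words_of hSH hBH hCH hAH hi.rot hB hC hz.symm (by rw [ev_ofInt, hA])
      (by rw [← hx, hAC]) (by rw [← hy, hAC]) (by rw [← hr, hcyc])
  · exact e.words_of hSH hCH hAH hBH hi.rot.rot hC hA (by rw [← hy, hAC]) (by rw [ev_ofInt, hB])
      (by rw [← hz, hAC]) hx.symm (by rw [← hr, hcyc, hcyc])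

end Emb

end Words

section Gram

variable {p : ℕ} [Fact p.Prime]

namespace Emb

open ZR

variable {K : Type} [Field K] [Algebra (ZMod p) K] (e : Emb p K)

/-- Up to a scalar, the trace form on trace zero parts. -/
def G (X Y : SLp p) : K := e.T X * e.T Y - 2 * e.T (X * Y)

/-- An entry of a matrix in `K`. -/
def en (_ : Emb p K) (X : SLp p) (i j : Fin 2) : K := algebraMap (ZMod p) K (X.1 i j)

lemma T_eq_en (X : SLp p) : e.T X = e.en X 0 0 + e.en X 1 1 := by simp [T, en, tr]

lemma G_eq_en (X Y : SLp p) : e.G X Y = -((e.en X 0 0 - e.en X 1 1) * (e.en Y 0 0 - e.en Y 1 1) +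
    2 * e.en X 0 1 * e.en Y 1 0 + e.en X 1 0 * (2 * e.en Y 0 1)) := by
  simp only [G, T, tr, en, m00, m11, map_add, map_mul]; ring

lemma G_comm (X Y : SLp p) : e.G X Y = e.G Y X := by rw [G_eq_en, G_eq_en]; ring

lemma G_inv (X Y : SLp p) : e.G X⁻¹ Y = -e.G X Y := by
  have h1 : e.T X⁻¹ = e.T X := by rw [T_eq_iff, tr_inv]
  have h2 : e.T (X⁻¹ * Y) = e.T X * e.T Y - e.T (X * Y) := by simp only [T]; rw [tr_inv_mul]; simp
  rw [G, G, h1, h2]; ring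

lemma ev_det3 (k₀ k₁ k₂ a b d : ZR) : e.ev (det3 k₀ k₁ k₂ a b d) =
    e.ev k₀ * (e.ev k₁ * e.ev k₂ - e.ev d * e.ev d) - e.ev a * (e.ev a * e.ev k₂ - e.ev d * e.ev b) +
      e.ev b * (e.ev a * e.ev d - e.ev k₁ * e.ev b) := by
  simp [det3]

lemma det4_eq_zero (u b c : Fin 4 → K) {k₀ k₁ k₂ k₃ g₀₁ g₀₂ g₀₃ g₁₂ g₁₃ g₂₃ : ZR}
    (h₀ : e.ev k₀ = -(u 0 * u 0 + b 0 * c 0 + c 0 * b 0))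
    (h₁ : e.ev k₁ = -(u 1 * u 1 + b 1 * c 1 + c 1 * b 1))
    (h₂ : e.ev k₂ = -(u 2 * u 2 + b 2 * c 2 + c 2 * b 2))
    (h₃ : e.ev k₃ = -(u 3 * u 3 + b 3 * c 3 + c 3 * b 3))
    (h₀₁ : e.ev g₀₁ = -(u 0 * u 1 + b 0 * c 1 + c 0 * b 1))
    (h₀₂ : e.ev g₀₂ = -(u 0 * u 2 + b 0 * c 2 + c 0 * b 2))
    (h₀₃ : e.ev g₀₃ = -(u 0 * u 3 + b 0 * c 3 + c 0 * b 3))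
    (h₁₂ : e.ev g₁₂ = -(u 1 * u 2 + b 1 * c 2 + c 1 * b 2))
    (h₁₃ : e.ev g₁₃ = -(u 1 * u 3 + b 1 * c 3 + c 1 * b 3))
    (h₂₃ : e.ev g₂₃ = -(u 2 * u 3 + b 2 * c 3 + c 2 * b 3)) :
    e.ev (det4 k₀ k₁ k₂ k₃ g₀₁ g₀₂ g₀₃ g₁₂ g₁₃ g₂₃) = 0 := by
  simp only [det4, ev_det3, ev_add, ev_sub, ev_mul, ev_ofInt, h₀, h₁, h₂, h₃, h₀₁, h₀₂, h₀₃, h₁₂, h₁₃, h₂₃]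
  push_cast
  ring

lemma eq_of_G {A₀ A₁ A₂ : SLp p} (hp : 5 < p) {k₀ k₁ k₂ a b d : ZR} (h₀ : e.ev k₀ = e.G A₀ A₀)
    (h₁ : e.ev k₁ = e.G A₁ A₁) (h₂ : e.ev k₂ = e.G A₂ A₂) (ha : e.ev a = e.G A₀ A₁)
    (hb : e.ev b = e.G A₀ A₂) (hd : e.ev d = e.G A₁ A₂) (hdet : e.ev (det3 k₀ k₁ k₂ a b d) ≠ 0)
    {Y Z : SLp p} (ht : e.T Y = e.T Z) (g₀ : e.G Y A₀ = e.G Z A₀) (g₁ : e.G Y A₁ = e.G Z A₁)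
    (g₂ : e.G Y A₂ = e.G Z A₂) : Y = Z := by
  have two : (2 : K) ≠ 0 := by
    have := (map_ne_zero_iff _ (algebraMap (ZMod p) K).injective).2 (two_ne hp)
    rwa [map_ofNat] at this
  rw [ev_det3, h₀, h₁, h₂, ha, hb, hd] at hdet
  simp only [G_eq_en] at hdet g₀ g₁ g₂
  rw [T_eq_en, T_eq_en] at ht
  have inj : ∀ {i j}, e.en Y i j = e.en Z i j → Y.1 i j = Z.1 i j := fun h =>
    (algebraMap (ZMod p) K).injective h
  generalize e.en A₀ 0 0 - e.en A₀ 1 1 = u₀, e.en A₀ 0 1 = b₀, e.en A₀ 1 0 = c₀ at *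
  generalize e.en A₁ 0 0 - e.en A₁ 1 1 = u₁, e.en A₁ 0 1 = b₁, e.en A₁ 1 0 = c₁ at *
  generalize e.en A₂ 0 0 - e.en A₂ 1 1 = u₂, e.en A₂ 0 1 = b₂, e.en A₂ 1 0 = c₂ at *
  have hD : u₀ * (b₁ * c₂ - b₂ * c₁) - u₁ * (b₀ * c₂ - b₂ * c₀) + u₂ * (b₀ * c₁ - b₁ * c₀) ≠ 0 := by
    intro h
    apply hdet
    linear_combination (4 * (u₀ * (b₁ * c₂ - b₂ * c₁) - u₁ * (b₀ * c₂ - b₂ * c₀) +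
      u₂ * (b₀ * c₁ - b₁ * c₀))) * h
  have e1 : e.en Y 0 1 = e.en Z 0 1 := by
    apply mul_left_cancel₀ (mul_ne_zero two hD)
    linear_combination -(u₁ * b₂ - u₂ * b₁) * g₀ + (u₀ * b₂ - u₂ * b₀) * g₁ - (u₀ * b₁ - u₁ * b₀) * g₂
  have e2 : e.en Y 1 0 = e.en Z 1 0 := by
    apply mul_left_cancel₀ (mul_ne_zero two hD)
    linear_combination (u₁ * c₂ - u₂ * c₁) * g₀ - (u₀ * c₂ - u₂ * c₀) * g₁ + (u₀ * c₁ - u₁ * c₀) * g₂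
  have e3 : e.en Y 0 0 - e.en Y 1 1 = e.en Z 0 0 - e.en Z 1 1 := by
    apply mul_left_cancel₀ hD
    linear_combination -(b₁ * c₂ - b₂ * c₁) * g₀ + (b₀ * c₂ - b₂ * c₀) * g₁ - (b₀ * c₁ - b₁ * c₀) * g₂
  apply sl_ext
  · exact inj (mul_left_cancel₀ two (by linear_combination ht + e3))
  · exact inj e1
  · exact inj e2
  · exact inj (mul_left_cancel₀ two (by linear_combination ht - e3))

lemma G_conj {A B C : SLp p} (hA : tr A = 0) :
    e.G (A * B * A⁻¹) C = -e.T (A * B) * e.G A C - e.G B C := by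
  have h1 : tr (A * B * A⁻¹) = tr B := by rw [tr_mul_comm, inv_mul_cancel_left]
  have h2 : tr (A * B * A⁻¹ * C) = -(tr (A * B) * tr (A * C) + tr (B * C) - tr B * tr C) := by
    rw [inv_of_tr_zero hA, mul_neg, neg_mul, tr_neg, ← tr_mul_mul_mul]; simp only [mul_assoc]
  simp only [G, T, h1, h2, hA]
  simp only [map_neg, map_add, map_sub, map_mul, map_zero]
  ring

lemma G_conj' (A B C : SLp p) : e.G (A * B * A⁻¹) C = e.G B (A⁻¹ * C * A) := by
  have h1 : tr (A * B * A⁻¹) = tr B := by rw [tr_mul_comm, inv_mul_cancel_left]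
  have h2 : tr (A⁻¹ * C * A) = tr C := by rw [tr_mul_comm, mul_inv_cancel_left]
  have h3 : tr (A * B * A⁻¹ * C) = tr (B * (A⁻¹ * C * A)) := by
    rw [mul_assoc, mul_assoc, tr_mul_comm]; simp only [mul_assoc]
  simp only [G, T, h1, h2, h3]

/-- The conjugate of the `j`-th element described by a word. -/
def conjA (A : Fin 4 → SLp p) (j : Fin 4) : List (Fin 4) → SLp p
  | [] => A j
  | k :: w => A k * conjA A j w * (A k)⁻¹

lemma tr_conjA (A : Fin 4 → SLp p) (j : Fin 4) : ∀ w, tr (conjA A j w) = tr (A j)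
  | [] => rfl
  | k :: w => by
    rw [conjA, tr_mul_comm, inv_mul_cancel_left, tr_conjA A j w]

lemma conjA_mem {A : Fin 4 → SLp p} {H : Subgroup (SLp p)} {j : Fin 4} (hj : A j ∈ H) :
    ∀ w : List (Fin 4), (∀ k ∈ w, A k ∈ H) → conjA A j w ∈ H
  | [], _ => hj
  | k :: w, h => mul_mem (mul_mem (h k (by simp)) (conjA_mem hj w fun l hl => h l (by simp [hl])))
      (inv_mem (h k (by simp)))

lemma ev_dot (v w : Fin 4 → ZR) : e.ev (dot v w) = ∑ q, e.ev (v q) * e.ev (w q) := by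
  simp only [dot, ev_add, ev_mul, Fin.sum_univ_four]; ring

lemma ev_half (m : Fin 4 → Fin 4 → ZR) (k : Fin 4) (v : Fin 4 → ZR) (q : Fin 4) :
    e.ev (half m k v q) = -e.ev (v q) - if q = k then ∑ a, e.ev (v a) * e.ev (m k a) else 0 := by
  rw [half, ev_sub, ev_neg]
  split_ifs <;> simp [ev_dot]

lemma G_conjA {A : Fin 4 → SLp p} {t : Fin 4 → Bool} (hA : ∀ i, e.T (A i) = tz (t i))
    {m : Fin 4 → Fin 4 → ZR} (hm : ∀ i j, e.ev (m i j) = e.T (A i * A j)) (j : Fin 4) :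
    ∀ w : List (Fin 4), (∀ k ∈ w, t k = false) → ∀ C,
      e.G (conjA A j w) C = ∑ a, e.ev (conjV m j w a) * e.G (A a) C
  | [], _, C => by
    simp only [conjA, conjV, basisV, ev_ofInt]
    rw [Finset.sum_eq_single j] <;> simp +contextual
  | k :: w, hw, C => by
    have ih := G_conjA hA hm j w fun l hl => hw l (by simp [hl])
    have tk : tr (A k) = 0 := by
      rw [← e.T_eq_zero, hA, hw k (by simp)]; simp [tz]
    rw [conjA, G_conj', ih]
    simp only [← G_conj', e.G_conj tk, conjV, ev_half, hm, sub_mul, mul_sub, Finset.sum_sub_distrib, ite_mul,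
      zero_mul, Finset.sum_ite_eq', Finset.mem_univ, if_true, Finset.sum_mul]
    rw [sub_eq_add_neg, add_comm, sub_eq_add_neg, ← Finset.sum_neg_distrib, ← Finset.sum_neg_distrib]
    congr 1 <;> refine Finset.sum_congr rfl fun a _ => by ring

lemma ev_eqz {x y : ZR} (h : eqz x y = true) : e.ev x = e.ev y := by
  simp only [eqz, Bool.and_eq_true, beq_iff_eq] at h
  obtain ⟨⟨⟨h1, h2⟩, h3⟩, h4⟩ := h
  simp only [ev, ZR.ev, h1, h2, h3, h4]

lemma ev_gm {A B : SLp p} {t₁ t₂ : Bool} {x : ZR} (hA : e.T A = tz t₁) (hB : e.T B = tz t₂)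
    (hx : e.ev x = e.T (A * B)) : e.ev (gm t₁ t₂ x) = e.G A B := by
  simp [gm, G, hA, hB, hx]

lemma T_sq_eq {A : SLp p} {t : Bool} (hA : e.T A = tz t) : e.T (A * A) = (tz t : K) - 2 := by
  have h : tr (A * A) = tr A * tr A - 2 := by
    have := tr_mul_mul_self A 1
    rw [mul_one] at this
    rw [this]; simp [tr]; ring
  simp only [T] at hA ⊢
  rw [h, map_sub, map_mul, hA, map_ofNat]
  cases t <;> simp [tz]

lemma ev_gd {A : SLp p} {t : Bool} (hA : e.T A = tz t) : e.ev (gd t) = e.G A A := by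
  rw [G, T_sq_eq e hA, hA, gd, ev_ofInt]
  cases t <;> simp [tz] <;> ring

end Emb

end Gram

section Config

variable {p : ℕ} [Fact p.Prime]

namespace Emb

open ZR

variable {K : Type} [Field K] [Algebra (ZMod p) K] (e : Emb p K)

/-- The traces of four elements and their products in pairs. -/
structure Cfg (A : Fin 4 → SLp p) (t : Fin 4 → Bool) (x : Fin 6 → ℕ) : Prop where
  hA : ∀ i, e.T (A i) = (tz (t i) : ℤ)
  h01 : e.ev (P9 (x 0)) = e.T (A 0 * A 1)
  h02 : e.ev (P9 (x 1)) = e.T (A 0 * A 2)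
  h03 : e.ev (P9 (x 2)) = e.T (A 0 * A 3)
  h12 : e.ev (P9 (x 3)) = e.T (A 1 * A 2)
  h13 : e.ev (P9 (x 4)) = e.T (A 1 * A 3)
  h23 : e.ev (P9 (x 5)) = e.T (A 2 * A 3)

variable {e}

lemma T_mul_comm (A B : SLp p) : e.T (A * B) = e.T (B * A) := by rw [T_eq_iff, tr_mul_comm]

lemma Cfg.ev_trM {A : Fin 4 → SLp p} {t : Fin 4 → Bool} {x : Fin 6 → ℕ} (h : e.Cfg A t x) (i j : Fin 4) :
    e.ev (trM t x i j) = e.T (A i * A j) := by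
  have hd : ∀ i, e.ev (ofInt (tz (t i) - 2)) = e.T (A i * A i) := fun i => by
    rw [e.T_sq_eq (h.hA i), ev_ofInt]; push_cast; rfl
  match i, j with
  | 0, 0 => exact hd 0
  | 0, 1 => exact h.h01
  | 0, 2 => exact h.h02
  | 0, 3 => exact h.h03
  | 1, 0 => exact h.h01.trans (T_mul_comm _ _)
  | 1, 1 => exact hd 1
  | 1, 2 => exact h.h12
  | 1, 3 => exact h.h13
  | 2, 0 => exact h.h02.trans (T_mul_comm _ _)
  | 2, 1 => exact h.h12.trans (T_mul_comm _ _)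
  | 2, 2 => exact hd 2
  | 2, 3 => exact h.h23
  | 3, 0 => exact h.h03.trans (T_mul_comm _ _)
  | 3, 1 => exact h.h13.trans (T_mul_comm _ _)
  | 3, 2 => exact h.h23.trans (T_mul_comm _ _)
  | 3, 3 => exact hd 3

lemma Cfg.of_hint {A : Fin 4 → SLp p} {t : Fin 4 → Bool} {x : Fin 6 → ℕ} (hp : 5 < p) (h : e.Cfg A t x)
    (h3 : (cfgDet3 (t 0) (t 1) (t 2) (x 0) (x 1) (x 3)).nz = true) {i j : Fin 4} {w : List (Fin 4)}
    (hh : hint t (trM t x) i j w = true) : A i ∈ gen (A '' {j | j ≠ i}) := by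
  simp only [hint, Bool.and_eq_true, Bool.or_eq_true, Bool.not_eq_true', beq_eq_false_iff_ne, beq_iff_eq,
    List.all_eq_true] at hh
  obtain ⟨⟨⟨hji, htt⟩, hw⟩, hv⟩ := hh
  have hmem : ∀ {k}, k ≠ i → A k ∈ gen (A '' {j | j ≠ i}) := fun hk => subset_gen _ ⟨_, hk, rfl⟩
  have hY := conjA_mem (hmem hji) w fun k hk => hmem (hw k hk).1
  have hG := e.G_conjA h.hA h.ev_trM j w fun k hk => (hw k hk).2
  have hg : ∀ a b, e.ev (gm (t a) (t b) (trM t x a b)) = e.G (A a) (A b) := fun a b =>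
    e.ev_gm (h.hA a) (h.hA b) (h.ev_trM a b)
  have hGG : ∀ q, e.ev (dot (conjV (trM t x) j w) fun b => gm (t q) (t b) (trM t x q b)) =
      e.G (conjA A j w) (A q) := fun q => by
    rw [hG, ev_dot]
    exact Finset.sum_congr rfl fun a _ => by rw [hg, e.G_comm]
  have hT : e.T (conjA A j w) = e.T (A i) := by
    rw [h.hA, htt, ← h.hA, T_eq_iff, tr_conjA]
  have key := fun {Z : SLp p} => eq_of_G (e := e) (A₀ := A 0) (A₁ := A 1) (A₂ := A 2) (Y := conjA A j w) (Z := Z) hp (e.ev_gd (h.hA 0)) (e.ev_gd (h.hA 1))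
    (e.ev_gd (h.hA 2)) (e.ev_gm (h.hA 0) (h.hA 1) h.h01) (e.ev_gm (h.hA 0) (h.hA 2) h.h02)
    (e.ev_gm (h.hA 1) (h.hA 2) h.h12) (e.ev_ne_zero h3)
  rcases hv with hv | hv
  · have hv' : ∀ q ∈ [(0 : Fin 4), 1, 2], e.G (conjA A j w) (A q) = e.G (A i) (A q) := fun q hq => by
      rw [← hGG, e.ev_eqz (hv q hq), hg, e.G_comm]
    rwa [key hT (hv' 0 (by simp)) (hv' 1 (by simp)) (hv' 2 (by simp))] at hY
  · have hv' : ∀ q ∈ [(0 : Fin 4), 1, 2], e.G (conjA A j w) (A q) = e.G (A i)⁻¹ (A q) := fun q hq => by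
      rw [← hGG, e.ev_eqz (hv q hq), ev_neg, hg, e.G_comm, e.G_inv]
    have hT' : e.T (conjA A j w) = e.T (A i)⁻¹ := by rw [hT, T_eq_iff, tr_inv]
    rw [key hT' (hv' 0 (by simp)) (hv' 1 (by simp)) (hv' 2 (by simp))] at hY
    simpa using hY

lemma Cfg.det_eq_zero {A : Fin 4 → SLp p} {t : Fin 4 → Bool} {x : Fin 6 → ℕ} (h : e.Cfg A t x) :
    e.ev (cfgDet (t 0) (t 1) (t 2) (t 3) (x 0) (x 1) (x 2) (x 3) (x 4) (x 5)) = 0 := by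
  have hg : ∀ i j, e.G (A i) (A j) = -((e.en (A i) 0 0 - e.en (A i) 1 1) * (e.en (A j) 0 0 - e.en (A j) 1 1) +
    2 * e.en (A i) 0 1 * e.en (A j) 1 0 + e.en (A i) 1 0 * (2 * e.en (A j) 0 1)) := fun i j => e.G_eq_en _ _
  apply e.det4_eq_zero (fun i => e.en (A i) 0 0 - e.en (A i) 1 1) (fun i => 2 * e.en (A i) 0 1)
    (fun i => e.en (A i) 1 0) <;> rw [← hg]
  · exact e.ev_gd (h.hA 0)
  · exact e.ev_gd (h.hA 1)
  · exact e.ev_gd (h.hA 2)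
  · exact e.ev_gd (h.hA 3)
  · exact e.ev_gm (h.hA 0) (h.hA 1) h.h01
  · exact e.ev_gm (h.hA 0) (h.hA 2) h.h02
  · exact e.ev_gm (h.hA 0) (h.hA 3) h.h03
  · exact e.ev_gm (h.hA 1) (h.hA 2) h.h12
  · exact e.ev_gm (h.hA 1) (h.hA 3) h.h13
  · exact e.ev_gm (h.hA 2) (h.hA 3) h.h23

lemma vec4_eta {α : Type} (t : Fin 4 → α) : ![t 0, t 1, t 2, t 3] = t := by
  ext i; fin_cases i <;> rfl

lemma vec6_eta {α : Type} (t : Fin 6 → α) : ![t 0, t 1, t 2, t 3, t 4, t 5] = t := by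
  ext i; fin_cases i <;> rfl

lemma Cfg.of_close {A : Fin 4 → SLp p} {t : Fin 4 → Bool} {x : Fin 6 → ℕ} (hp : 5 < p) (h : e.Cfg A t x)
    {l : List (Fin 4 × Fin 4 × List (Fin 4))}
    (hc : close (t 0) (t 1) (t 2) (t 3) (x 0) (x 1) (x 2) (x 3) (x 4) (x 5) l = true) :
    ∃ h ∈ l, A h.1 ∈ gen (A '' {j | j ≠ h.1}) := by
  simp only [close, vec4_eta, vec6_eta, Bool.or_eq_true, Bool.and_eq_true, List.any_eq_true] at hc
  rcases hc with hc | ⟨h3, y, hy, -, hh⟩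
  · exact absurd h.det_eq_zero (e.ev_ne_zero hc)
  · exact ⟨y, hy, h.of_hint hp h3 hh⟩

end Emb

end Config

section Triples

variable {p : ℕ} [Fact p.Prime]

lemma EType.ne_top {s : ℕ} {H : Subgroup (SLp p)} (hH : EType s H) : H ≠ ⊤ := by
  rintro rfl
  have h := hH.semisimple (uu 1) (Subgroup.mem_top _) (by simp [uu, tr]; norm_num)
  rcases h with h | h
  · have := congrArg (fun A : SLp p => A.1 0 1) h
    simp [uu] at this
  · have := congrArg (fun A : SLp p => A.1 0 1) h
    simp [uu] at this

/-- Two commuting elements whose traces agree up to sign generate the same group. -/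
lemma mem_gen_of_comm (hp : 5 < p) {a b : SLp p} (hab : a * b = b * a) (hb : ¬ PM b)
    (ht : tr a ^ 2 = tr b ^ 2) (h4 : tr b ^ 2 ≠ 4) : a ∈ gen {b} := by
  have h2 := two_ne hp
  have hbg : b ∈ gen {b} := subset_gen _ rfl
  have hng : ∀ {c : SLp p}, c ∈ gen {b} → -c ∈ gen {b} := fun h => by
    rw [← neg_one_mul]; exact mul_mem (neg_one_mem_gen _) h
  have hc : b.1 * ax a = ax a * b.1 := by
    rw [ax_eq, mul_sub, sub_mul, Matrix.mul_smul, Matrix.smul_mul, ← cmul, ← cmul, hab]; simp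
  obtain ⟨c, hc⟩ := comm_ax hp hb (ax_trace a) hc
  have hd := congrArg Matrix.det hc
  rw [Matrix.det_smul, ax_det, ax_det, Fintype.card_fin, ht] at hd
  have hc2 : c ^ 2 = 1 := by
    apply mul_right_cancel₀ (sub_ne_zero.2 (Ne.symm h4))
    rw [← hd, one_mul]
  have h00 := congrFun (congrFun hc 0) 0
  have h01 := congrFun (congrFun hc 0) 1
  have h10 := congrFun (congrFun hc 1) 0
  simp [ax] at h00 h01 h10
  have e01 : a.1 0 1 = c * b.1 0 1 := mul_left_cancel₀ h2 (by linear_combination h01)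
  have e10 : a.1 1 0 = c * b.1 1 0 := mul_left_cancel₀ h2 (by linear_combination h10)
  rcases sq_eq_one_iff.1 hc2 with rfl | rfl <;> rcases sq_eq_sq_iff_eq_or_eq_neg.1 ht with h | h <;>
    simp only [tr] at h
  · rw [show a = b from sl_ext (mul_left_cancel₀ h2 (by linear_combination h + h00)) (by rw [e01, one_mul])
      (by rw [e10, one_mul]) (mul_left_cancel₀ h2 (by linear_combination h - h00))]
    exact hbg
  · rw [show a = -b⁻¹ from sl_ext (mul_left_cancel₀ h2 (by simp; linear_combination h + h00)) (by simp [e01])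
      (by simp [e10]) (mul_left_cancel₀ h2 (by simp; linear_combination h - h00))]
    exact hng (inv_mem hbg)
  · rw [show a = b⁻¹ from sl_ext (mul_left_cancel₀ h2 (by simp only [i00]; linear_combination h + h00)) (by simp [e01])
      (by simp [e10]) (mul_left_cancel₀ h2 (by simp only [i11]; linear_combination h - h00))]
    exact inv_mem hbg
  · rw [show a = -b from sl_ext (mul_left_cancel₀ h2 (by simp; linear_combination h + h00)) (by simp [e01])
      (by simp [e10]) (mul_left_cancel₀ h2 (by simp; linear_combination h - h00))]
    exact hng hbg

lemma tr_of_comm {a b : SLp p} (h : a * b = b * a) :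
    tr a ^ 2 + tr b ^ 2 + tr (a * b) ^ 2 - tr a * tr b * tr (a * b) = 4 := by
  have h1 : a⁻¹ * (b * (a * b⁻¹)) = 1 := by
    rw [← mul_assoc b, ← h, mul_assoc, mul_inv_cancel, mul_one, inv_mul_cancel]
  have h2 : tr (1 : SLp p) = 2 := by simp [tr]; norm_num
  have h3 : tr (a * b⁻¹) = tr b * tr a - tr (a * b) := by rw [tr_mul_comm, tr_inv_mul, tr_mul_comm b a]
  have h4 := tr_inv_mul a (b * (a * b⁻¹))
  rw [h1, h2, tr_mul_mul_mul, h3, tr_mul_comm b, inv_mul_cancel_right, mul_inv_cancel, h2, tr_inv] at h4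
  linear_combination -h4

namespace ZR

/-- Commuting elements with such traces have two traces that agree up to sign. -/
def commOK : Bool :=
  S9.all fun i => S9.all fun j => S9.all fun k =>
    let x := P9 i
    let y := P9 j
    let z := P9 k
    (((((x.mul x).add (y.mul y)).add (z.mul z)).sub ((x.mul y).mul z)).sub (ofInt 4)).nz ||
      eqz (x.mul x) (y.mul y) || eqz (x.mul x) (z.mul z) || eqz (y.mul y) (z.mul z)

lemma commOK_eq : commOK = true := by decide +kernel

lemma four_nz : ∀ n ∈ S9, (((P9 n).mul (P9 n)).sub (ofInt 4)).nz = true := by decide +kernel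

end ZR

namespace Emb

open ZR

variable {K : Type} [Field K] [Algebra (ZMod p) K] (e : Emb p K)

variable {e} in
lemma SIn.tr_sq_ne {g : SLp p} (h : e.SIn S9 g) : tr g ^ 2 ≠ 4 := by
  obtain ⟨n, hn, h⟩ := h
  intro h4
  have := e.T_sq (n := 4) (by exact_mod_cast h4)
  apply e.ev_ne_zero (four_nz n hn)
  rw [ev_sub, ev_mul, ← h, ev_ofInt]; push_cast at this ⊢; linear_combination this

variable {e} in
lemma SIn.not_pm {g : SLp p} (h : e.SIn S9 g) : ¬ PM g := fun hp => h.tr_sq_ne hp.tr_sq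

lemma tr_sq_eq (e : Emb p K) {g h : SLp p} : e.T g ^ 2 = e.T h ^ 2 ↔ tr g ^ 2 = tr h ^ 2 := by
  rw [T, T, ← map_pow, ← map_pow]; exact (algebraMap (ZMod p) K).injective.eq_iff

lemma comm_mem (hp : 5 < p) {a b : SLp p} (hab : a * b = b * a) (ha : e.SIn S9 a) (hb : e.SIn S9 b)
    (hc : e.SIn S9 (a * b)) : a ∈ gen {b} ∨ b ∈ gen {a} := by
  have h4 := congrArg (algebraMap (ZMod p) K) (tr_of_comm hab)
  obtain ⟨i, hi, hi'⟩ := id ha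
  obtain ⟨j, hj, hj'⟩ := id hb
  obtain ⟨k, hk, hk'⟩ := id hc
  simp only [map_add, map_sub, map_mul, map_pow, map_ofNat] at h4
  change e.T a ^ 2 + e.T b ^ 2 + e.T (a * b) ^ 2 - e.T a * e.T b * e.T (a * b) = 4 at h4
  have key := List.all_eq_true.1 (List.all_eq_true.1 (List.all_eq_true.1 commOK_eq i hi) j hj) k hk
  simp only [Bool.or_eq_true] at key
  have sq : ∀ {m n : ℕ} {g h : SLp p}, eqz ((P9 m).mul (P9 m)) ((P9 n).mul (P9 n)) = true →
      e.T g = e.ev (P9 m) → e.T h = e.ev (P9 n) → tr g ^ 2 = tr h ^ 2 := fun h h1 h2 => by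
    have := e.ev_eqz h
    rw [ev_mul, ev_mul, ← h1, ← h2] at this
    rw [← e.tr_sq_eq, sq, sq, this]
  rcases key with ((h | h) | h) | h
  · refine absurd ?_ (e.ev_ne_zero h)
    simp only [ev_sub, ev_add, ev_mul, ev_ofInt, ← hi', ← hj', ← hk']; push_cast
    linear_combination h4
  · exact Or.inl (mem_gen_of_comm hp hab hb.not_pm (sq h hi' hj') hb.tr_sq_ne)
  · right
    have := mem_gen_of_comm hp (a := a * b) (b := a) (by rw [mul_assoc, hab]) ha.not_pm
      (sq h hi' hk').symm ha.tr_sq_ne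
    simpa using mul_mem (inv_mem (subset_gen {a} rfl : a ∈ gen {a})) this
  · left
    have := mem_gen_of_comm hp (a := a * b) (b := b) (by rw [← mul_assoc, hab]) hb.not_pm
      (sq h hj' hk').symm hb.tr_sq_ne
    simpa using mul_mem this (inv_mem (subset_gen {b} rfl : b ∈ gen {b}))

lemma SIn.of_mem {s : ℕ} {H : Subgroup (SLp p)} (hH : EType s H) {g : SLp p} (hg : g ∈ H) (hn : ¬ PM g) :
    e.SIn S9 g := by
  obtain ⟨S, hS, h⟩ := SIn.of_EType e hH
  obtain ⟨n, hn, h⟩ := h g hg hn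
  exact ⟨n, (show ∀ S ∈ [S4, S5], ∀ n ∈ S, n ∈ S9 by decide) S hS n hn, h⟩

/-- Commuting members of an exceptional group: one generates the other. -/
lemma comm_mem_of_EType (e : Emb p K) (hp : 5 < p) {s : ℕ} {H : Subgroup (SLp p)} (hH : EType s H) {a b : SLp p}
    (ha : a ∈ H) (hb : b ∈ H) (hab : a * b = b * a) : a ∈ gen {b} ∨ b ∈ gen {a} := by
  by_cases pa : PM a
  · exact Or.inl (pa.mem (neg_one_mem_gen _))
  by_cases pb : PM b
  · exact Or.inr (pb.mem (neg_one_mem_gen _))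
  by_cases pc : PM (a * b)
  · exact Or.inr (mem_of_pm_mul (neg_one_mem_gen _) (subset_gen _ rfl) pc)
  exact e.comm_mem hp hab (.of_mem e hH ha pa) (.of_mem e hH hb pb) (.of_mem e hH (mul_mem ha hb) pc)

end Emb

lemma gen_singleton_le {a : SLp p} {H : Subgroup (SLp p)} (h : -1 ∈ H) (ha : a ∈ H) : gen {a} ≤ H :=
  gen_le.2 ⟨h, by simpa using ha⟩

lemma gen_pair_le {a b : SLp p} {H : Subgroup (SLp p)} (h : -1 ∈ H) (ha : a ∈ H) (hb : b ∈ H) :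
    gen {a, b} ≤ H :=
  gen_le.2 ⟨h, Set.insert_subset ha (by simpa using hb)⟩

lemma Ind3.swap {a b c : SLp p} (h : Ind3 a b c) : Ind3 b a c :=
  ⟨by rw [Set.pair_comm]; exact h.h₂, by rw [Set.pair_comm]; exact h.h₁, by rw [Set.pair_comm]; exact h.h₃⟩

lemma Ind3.not_pm {a b c : SLp p} (h : Ind3 a b c) : ¬ PM a := fun ha => h.h₁ (ha.mem (neg_one_mem_gen _))

lemma Ind3.not_pm_mul {a b c : SLp p} (h : Ind3 a b c) : ¬ PM (a * b) := fun hpm =>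
    h.h₂ (mem_of_pm_mul (neg_one_mem_gen _) (right_mem_gen _ _) hpm)

lemma Ind3.notMem {a b c : SLp p} (h : Ind3 a b c) : ¬ (a ∈ gen {b} ∨ b ∈ gen {a}) := by
  rintro (h' | h')
  · exact h.h₁ (gen_mono (by simp) h')
  · exact h.h₂ (gen_mono (by simp) h')

lemma Ind3.notMem_mul {a b c : SLp p} (h : Ind3 a b c) : ¬ (a ∈ gen {b * c} ∨ b * c ∈ gen {a}) := by
  rintro (h' | h')
  · exact h.h₁ (gen_singleton_le (neg_one_mem_gen _) (mul_mem (left_mem_gen _ _) (right_mem_gen _ _)) h')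
  · refine h.h₃ ?_
    have := mul_mem (inv_mem (right_mem_gen a b)) (gen_mono (by simp) h' : b * c ∈ gen {a, b})
    rwa [inv_mul_cancel_left] at this

lemma EType.eq_of_tr {s s' : ℕ} {H H' : Subgroup (SLp p)} (hH : EType s H) (hH' : EType s' H') {r : SLp p}
    (hr : r ∈ H) (hr' : r ∈ H') (hn : ¬ PM r) (h0 : tr r ≠ 0) (h1 : tr r ^ 2 ≠ 1) :
    Nat.card H = Nat.card H' := by
  have key : ∀ {s} {H : Subgroup (SLp p)}, EType s H → r ∈ H →
      (Nat.card H = 48 ∧ tr r ^ 2 = 2) ∨ (Nat.card H = 120 ∧ tr r ^ 4 - 3 * tr r ^ 2 + 1 = 0) := by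
    intro s H hH hr
    rcases hH.pow r hr with h | h | h
    · exact absurd (tr_eq_of_pow_two hn h) h0
    · exact absurd (tr_eq_of_pow_three hn h) h1
    · rcases hH.card with ⟨rfl, -⟩ | ⟨rfl, hc⟩ | ⟨rfl, hc⟩
      · exact absurd (tr_eq_of_pow_three hn h) h1
      · exact Or.inl ⟨hc, (tr_eq_of_pow_four hn h).resolve_left h0⟩
      · exact Or.inr ⟨hc, tr_eq_of_pow_five hn h⟩
  have no : tr r ^ 2 = 2 → tr r ^ 4 - 3 * tr r ^ 2 + 1 ≠ 0 := fun h h' => by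
    have : (1 : ZMod p) = 0 := by linear_combination (tr r ^ 2 - 1) * h - h'
    exact one_ne_zero this
  rcases key hH hr with ⟨h, h'⟩ | ⟨h, h'⟩ <;> rcases key hH' hr' with ⟨k, k'⟩ | ⟨k, k'⟩
  · rw [h, k]
  · exact absurd k' (no h')
  · exact absurd h' (no k')
  · rw [h, k]

namespace Emb

variable {K : Type} [Field K] [Algebra (ZMod p) K] (e : Emb p K)

lemma dih_of_EType (e : Emb p K) (hp : 5 < p) {s : ℕ} {H : Subgroup (SLp p)} (hH : EType s H) {a b c r : SLp p}
    (ha : a ∈ H) (hb : b ∈ H) (hc : c ∈ H) (hi : Ind3 a b c) (hr : r ∈ gen {a, b}) (hn : ¬ PM r)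
    (h0 : tr r ≠ 0) (h1 : tr r ^ 2 ≠ 1) : DType (gen {a, b}) := by
  have hle := gen_pair_le hH.neg ha hb
  have hne : gen {a, b} ≠ ⊤ := fun h => hi.h₃ (h ▸ Subgroup.mem_top c)
  rcases classification hp (neg_one_mem_gen _) hne with ⟨v, hv, h⟩ | h | ⟨s', h⟩
  · rcases comm_or_le_borel hp hH.neg hH.ne_top hv ha hb (h (left_mem_gen _ _)) (h (right_mem_gen _ _))
      with h' | h'
    · exact absurd (e.comm_mem_of_EType hp hH ha hb h') hi.notMem
    · exact absurd ⟨v, hv, h'⟩ hH.notP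
  · exact h
  · exfalso
    have hcard := h.eq_of_tr hH hr (hle hr) hn h0 h1
    have hfin : Finite H := Nat.finite_of_card_ne_zero (by rcases hH.card with h | h | h <;> omega)
    exact hi.h₃ (Subgroup.eq_of_le_of_card_ge hle hcard.ge ▸ hc)

lemma tr_of_EType (e : Emb p K) (hp : 5 < p) {s : ℕ} {H : Subgroup (SLp p)} (hH : EType s H) {a b c : SLp p}
    (ha : a ∈ H) (hb : b ∈ H) (hc : c ∈ H) (hi : Ind3 a b c) : tr a = 0 ∨ tr a ^ 2 = 1 := by
  by_contra! h
  have hna := hi.not_pm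
  have key : ∀ {b c : SLp p}, b ∈ H → c ∈ H → Ind3 a b c → b.1 * ax a = -(ax a * b.1) := by
    intro b c hb hc hi
    obtain ⟨W, hW, hdW, hle⟩ := e.dih_of_EType hp hH ha hb hc hi (left_mem_gen _ _) hna h.1 h.2
    obtain ⟨k, rfl⟩ := comm_ax hp hna hW (comm_of_mem_dih hp hW hdW (hle (left_mem_gen _ _)) h.1)
    have hk : k ≠ 0 := by rintro rfl; simp at hdW
    refine (mem_dih.1 (dih_smul hk (hle (right_mem_gen _ _)))).resolve_left fun hc => ?_
    exact hi.notMem (e.comm_mem_of_EType hp hH ha hb (Subtype.ext (by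
      rw [cmul, cmul]; exact (comm_of_comm_ax hp hc).symm)))
  have kb := key hb hc hi
  have kc := key hc hb hi.rot.rot.swap
  have hcom : a * (b * c) = b * c * a := by
    refine Subtype.ext ((cmul _ _).trans (Eq.trans (comm_of_comm_ax hp ?_).symm (cmul _ _).symm))
    rw [cmul, mul_assoc, kc, mul_neg, ← mul_assoc, kb, neg_mul, neg_neg, mul_assoc]
  exact hi.notMem_mul (e.comm_mem_of_EType hp hH ha (mul_mem hb hc) hcom)

lemma tr_mul_of_EType (e : Emb p K) (hp : 5 < p) {s : ℕ} {H : Subgroup (SLp p)} (hH : EType s H) {a b c : SLp p}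
    (ha : a ∈ H) (hb : b ∈ H) (hc : c ∈ H) (hi : Ind3 a b c) (tb : tr b ≠ 0) :
    tr (a * b) = 0 ∨ tr (a * b) ^ 2 = 1 := by
  by_contra! h
  have hnb := hi.swap.not_pm
  obtain ⟨W, hW, hdW, hle⟩ := e.dih_of_EType hp hH ha hb hc hi
    (mul_mem (left_mem_gen _ _) (right_mem_gen _ _)) hi.not_pm_mul h.1 h.2
  have h1 := comm_of_mem_dih hp hW hdW (hle (right_mem_gen _ _)) tb
  have h2 := comm_of_mem_dih hp hW hdW (hle (mul_mem (left_mem_gen _ _) (right_mem_gen _ _))) h.1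
  obtain ⟨k, rfl⟩ := comm_ax hp hnb hW h1
  have hk : k ≠ 0 := by rintro rfl; simp at hdW
  have h3 : (a * b).1 * ax b = ax b * (a * b).1 := by
    refine smul_right_injective _ hk ?_
    simpa only [Matrix.mul_smul, Matrix.smul_mul] using h2
  have h4 := comm_of_comm_ax hp h3
  refine hi.notMem (e.comm_mem_of_EType hp hH ha hb ?_)
  have h5 : a * b * b = b * (a * b) := Subtype.ext (by rw [cmul, cmul]; exact h4)
  rw [← mul_assoc] at h5
  exact mul_right_cancel h5

lemma tr_mul_ne_neg_one (e : Emb p K) (hp : 5 < p) {s : ℕ} {H : Subgroup (SLp p)} (hH : EType s H) {a b c : SLp p}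
    (ha : a ∈ H) (hb : b ∈ H) (hi : Ind3 a b c) (ta : tr a = 1) (tb : tr b = 1) : tr (a * b) ≠ -1 := by
  intro h
  have h1 := tr_inv_mul a b
  rw [ta, tb, h] at h1
  have := hH.semisimple _ (mul_mem (inv_mem ha) hb) (by rw [h1]; norm_num)
  exact hi.swap.h₁ (gen_mono (by simp) (mem_of_pm_mul (neg_one_mem_gen {a}) (inv_mem (subset_gen _ rfl)) this))

end Emb

end Triples

section Quads

variable {p : ℕ} [Fact p.Prime]

/-- The triple lies in an exceptional subgroup. -/
def E3 (a b c : SLp p) : Prop := ∃ s H, EType s H ∧ a ∈ H ∧ b ∈ H ∧ c ∈ H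

/-- The triple lies in a dihedral subgroup. -/
def D3 (a b c : SLp p) : Prop := ∃ W : Matrix (Fin 2) (Fin 2) (ZMod p), W.trace = 0 ∧ W.det ≠ 0 ∧
  a ∈ dih W ∧ b ∈ dih W ∧ c ∈ dih W

lemma tr_of_anti (hp : 5 < p) {W : Matrix (Fin 2) (Fin 2) (ZMod p)} (hW : W.trace = 0) (hd : W.det ≠ 0)
    {a : SLp p} (h : a.1 * W = -(W * a.1)) : tr a = 0 := by
  by_contra ht
  have h1 := comm_of_mem_dih hp hW hd (mem_dih.2 (Or.inr h)) ht
  have h2 : (2 : ZMod p) • (W * a.1) = 0 := by rw [two_smul]; nth_rewrite 1 [← h1]; rw [h, neg_add_cancel]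
  have h3 := (smul_eq_zero.1 h2).resolve_left (two_ne hp)
  have h4 := congrArg Matrix.det h3
  rw [Matrix.det_mul, a.2, mul_one, Matrix.det_zero] at h4
  exact hd h4

lemma comm_of_comm_comm (hp : 5 < p) {W : Matrix (Fin 2) (Fin 2) (ZMod p)} (hW : W.trace = 0)
    (hd : W.det ≠ 0) {a b : SLp p} (ha : a.1 * W = W * a.1) (hb : b.1 * W = W * b.1) : a * b = b * a := by
  by_cases pa : PM a
  · exact pa.comm b
  obtain ⟨k, rfl⟩ := comm_ax hp pa hW ha
  have hk : k ≠ 0 := by rintro rfl; simp at hd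
  have h3 : b.1 * ax a = ax a * b.1 := by
    refine smul_right_injective _ hk ?_
    simpa only [Matrix.mul_smul, Matrix.smul_mul] using hb
  exact Subtype.ext (by rw [cmul, cmul]; exact (comm_of_comm_ax hp h3).symm)

lemma comm_of_anti {W : Matrix (Fin 2) (Fin 2) (ZMod p)} {a b : SLp p} (ha : a.1 * W = -(W * a.1))
    (hb : b.1 * W = -(W * b.1)) : (a * b).1 * W = W * (a * b).1 := by
  rw [cmul, mul_assoc, hb, mul_neg, ← mul_assoc, ha, neg_mul, neg_neg, mul_assoc]

namespace Emb

open ZR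

variable {K : Type} [Field K] [Algebra (ZMod p) K] (e : Emb p K)

lemma SIn.neg {g : SLp p} (h : e.SIn S9 g) : e.SIn S9 (-g) := by
  obtain ⟨n, hn, h⟩ := h
  have key : ∀ n ∈ S9, ∃ m ∈ S9, eqz (P9 m) (P9 n).neg = true := by decide +kernel
  obtain ⟨m, hm, h'⟩ := key n hn
  exact ⟨m, hm, by rw [T_neg, h, e.ev_eqz h', ev_neg]⟩

lemma SIn.of_tz {a : SLp p} {t : Bool} (h : e.T a = (tz t : ℤ)) : e.SIn S9 a := by
  cases t
  · exact ⟨0, by simp [S9], by rw [h]; simp [tz, P9, ev, ZR.ev]⟩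
  · exact ⟨1, by simp [S9], by rw [h]; simp [tz, P9, ev, ZR.ev]⟩

lemma rot_of (hp : 5 < p) {W : Matrix (Fin 2) (Fin 2) (ZMod p)} (hW : W.trace = 0) (hd : W.det ≠ 0)
    {a b c : SLp p} (hi : Ind3 a b c) (ha : a.1 * W = W * a.1) (hb : b.1 * W = -(W * b.1))
    (hc : c.1 * W = -(W * c.1)) {t₁ t₂ t₃ : Bool} {x y z : ℕ}
    (hA : e.T a = (tz t₁ : ℤ)) (hB : e.T b = (tz t₂ : ℤ)) (hC : e.T c = (tz t₃ : ℤ)) (mx : x ∈ S9)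
    (my : y ∈ S9) (mz : z ∈ S9) (hx : e.T (a * b) = e.ev (P9 x)) (hy : e.T (a * c) = e.ev (P9 y))
    (hz : e.T (b * c) = e.ev (P9 z)) : rot t₁ t₂ t₃ x y z = true := by
  have hP0 : e.ev (P9 0) = 0 := by simp [P9, ev, ZR.ev]
  have zero : ∀ {g : SLp p} {n : ℕ}, g.1 * W = -(W * g.1) → n ∈ S9 → e.T g = e.ev (P9 n) → n = 0 := by
    intro g n hg hn h
    refine e.P9_inj hn (by simp [S9]) ?_
    rw [← h, hP0, T_eq_zero, tr_of_anti hp hW hd hg]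
  have tf : ∀ {g : SLp p} {t : Bool}, g.1 * W = -(W * g.1) → e.T g = (tz t : ℤ) → t = false := by
    intro g t hg h
    have := (e.T_eq_zero).2 (tr_of_anti hp hW hd hg)
    rw [h] at this
    cases t
    · rfl
    · simp [tz] at this
  have anti : ∀ {g : SLp p}, g.1 * W = -(W * g.1) → (a * g).1 * W = -(W * (a * g).1) := by
    intro g hg
    rw [cmul, mul_assoc, hg, mul_neg, ← mul_assoc, ha, mul_assoc]
  have hbc := comm_of_anti hb hc
  have hcom := comm_of_comm_comm hp hW hd ha hbc
  have sbc : e.SIn S9 (b * c) := ⟨z, mz, hz⟩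
  have sa := SIn.of_tz e hA
  have ne : e.T a ^ 2 ≠ e.T (b * c) ^ 2 := fun h =>
    hi.notMem_mul (Or.inl (mem_gen_of_comm hp hcom sbc.not_pm (e.tr_sq_eq.1 h) sbc.tr_sq_ne))
  rw [hA, hz] at ne
  obtain rfl := zero (anti hb) mx hx
  obtain rfl := zero (anti hc) my hy
  obtain rfl := tf hb hB
  obtain rfl := tf hc hC
  have sqrt : t₁ = false → tr (b * c) ^ 2 ≠ 2 := by
    rintro rfl h2
    have ta : tr a = 0 := by rw [← e.T_eq_zero, hA]; simp [tz]
    have h3 : tr (b * c * (b * c)) = 0 := by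
      have := tr_mul_mul_self (b * c) 1
      rw [mul_one] at this
      rw [this]; simp [tr] at h2 ⊢; linear_combination h2
    have h4 := mem_gen_of_comm hp (a := a) (b := b * c * (b * c))
      (Commute.mul_right (show Commute a (b * c) from hcom) hcom)
      (not_pm_of_tr hp (Or.inl h3)) (by rw [ta, h3]) (by
        rw [h3]; intro h; apply two_ne hp; exact pow_eq_zero_iff (two_ne_zero) |>.1 (by linear_combination -h))
    exact hi.notMem_mul (Or.inl (gen_singleton_le (neg_one_mem_gen _)
      (mul_mem (subset_gen _ (Set.mem_singleton _)) (subset_gen _ (Set.mem_singleton _))) h4))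
  have sq2 : t₁ = false → e.T (b * c) ^ 2 ≠ 2 := fun h h' => sqrt h (by
    apply (algebraMap (ZMod p) K).injective
    rw [map_pow, map_ofNat]; exact h')
  rw [hz] at sq2
  have hs := e.hs
  simp only [S9, List.mem_cons, List.not_mem_nil, or_false] at mz
  rcases mz with rfl | rfl | rfl | rfl | rfl | rfl | rfl | rfl | rfl <;> cases t₁ <;> first
    | rfl
    | (exfalso; simp [tz, P9, ev, ZR.ev] at ne; done)
    | (exfalso; apply sq2 rfl; simp only [P9, ev, ZR.ev]; push_cast; linear_combination hs)

lemma chkD_of (hp : 5 < p) {a b c : SLp p} (h : D3 a b c) (hi : Ind3 a b c) {t₁ t₂ t₃ : Bool} {x y z : ℕ}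
    (hA : e.T a = (tz t₁ : ℤ)) (hB : e.T b = (tz t₂ : ℤ)) (hC : e.T c = (tz t₃ : ℤ)) (mx : x ∈ S9)
    (my : y ∈ S9) (mz : z ∈ S9) (hx : e.T (a * b) = e.ev (P9 x)) (hy : e.T (a * c) = e.ev (P9 y))
    (hz : e.T (b * c) = e.ev (P9 z)) : chkD t₁ t₂ t₃ x y z = true := by
  obtain ⟨W, hW, hd, ha, hb, hc⟩ := h
  have two : ∀ {a b c : SLp p} {t₁ t₂ : Bool}, Ind3 a b c → e.T a = (tz t₁ : ℤ) → e.T b = (tz t₂ : ℤ) →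
      e.SIn S9 (a * b) → a.1 * W = W * a.1 → b.1 * W = W * b.1 → False := fun hi hA hB hab ha hb =>
    hi.notMem (e.comm_mem hp (comm_of_comm_comm hp hW hd ha hb) (SIn.of_tz e hA) (SIn.of_tz e hB) hab)
  have hx' := (e.T_mul_comm b a).trans hx
  have hy' := (e.T_mul_comm c a).trans hy
  have hz' := (e.T_mul_comm c b).trans hz
  simp only [chkD, Bool.or_eq_true]
  rcases mem_dih.1 ha with ha | ha
  · rcases mem_dih.1 hb with hb | hb
    · exact (two hi hA hB ⟨x, mx, hx⟩ ha hb).elim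
    rcases mem_dih.1 hc with hc | hc
    · exact (two hi.rot.rot.swap hA hC ⟨y, my, hy⟩ ha hc).elim
    exact Or.inl (Or.inl (e.rot_of hp hW hd hi ha hb hc hA hB hC mx my mz hx hy hz))
  rcases mem_dih.1 hb with hb | hb
  · rcases mem_dih.1 hc with hc | hc
    · exact (two hi.rot hB hC ⟨z, mz, hz⟩ hb hc).elim
    exact Or.inl (Or.inr (e.rot_of hp hW hd hi.swap hb ha hc hB hA hC mx mz my hx' hz hy))
  rcases mem_dih.1 hc with hc | hc
  · exact Or.inr (e.rot_of hp hW hd hi.rot.rot hc ha hb hC hA hB my mz mx hy' hz' hx)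
  exfalso
  have ta := tr_of_anti hp hW hd ha
  have hab := comm_of_anti ha hb
  have hac := comm_of_anti ha hc
  have hba : b * a * (a * c) = -(b * c) := by
    have := tr_eq_zero_of_sq ta
    rw [mul_assoc, ← mul_assoc a, this]; simp
  rcases e.comm_mem hp (comm_of_comm_comm hp hW hd (comm_of_anti hb ha) hac) ⟨x, mx, hx'⟩ ⟨y, my, hy⟩
    (by rw [hba]; exact SIn.neg e ⟨z, mz, hz⟩) with h | h
  · refine hi.h₂ ?_
    have := gen_singleton_le (neg_one_mem_gen _) (mul_mem (right_mem_gen c a) (left_mem_gen c a)) h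
    simpa using mul_mem this (inv_mem (right_mem_gen c a))
  · refine hi.h₃ ?_
    have := gen_singleton_le (neg_one_mem_gen _) (mul_mem (right_mem_gen a b) (left_mem_gen a b)) h
    simpa using mul_mem (inv_mem (left_mem_gen a b)) this

/-- An independent quadruple of elements of orders 2 and 3 modulo the center, each triple of which
generates an exceptional or dihedral group. -/
structure NQ (A : Fin 4 → SLp p) (t : Fin 4 → Bool) : Prop where
  hA : ∀ i, e.T (A i) = (tz (t i) : ℤ)
  ind : ∀ i, A i ∉ gen (A '' {j | j ≠ i})
  trip : ∀ i j k, i ≠ j → i ≠ k → j ≠ k → E3 (A i) (A j) (A k) ∨ D3 (A i) (A j) (A k)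
  pair : ∀ i j, i ≠ j → ∃ n ∈ dom (t i) (t j), e.T (A i * A j) = e.ev (P9 n)

lemma dom_sub : ∀ s t, ∀ n ∈ dom s t, n ∈ S9 := by decide

lemma dom₀_sub : ∀ s t, ∀ n ∈ dom₀ s t, n ∈ dom s t := by decide

end Emb

lemma ind3_of {A : Fin 4 → SLp p} (ind : ∀ i, A i ∉ gen (A '' {j | j ≠ i})) {i j k : Fin 4} (hij : i ≠ j)
    (hik : i ≠ k) (hjk : j ≠ k) : Ind3 (A i) (A j) (A k) := by
  have key : ∀ {i j k}, j ≠ i → k ≠ i → A i ∉ gen {A j, A k} := fun {i j k} hj hk h =>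
    ind i (gen_pair_le (H := gen (A '' {l | l ≠ i})) (neg_one_mem_gen _) (subset_gen _ ⟨j, hj, rfl⟩) (subset_gen _ ⟨k, hk, rfl⟩) h)
  exact ⟨key hij.symm hik.symm, key hjk.symm hij, key hik hjk⟩

namespace Emb

open ZR

variable {K : Type} [Field K] [Algebra (ZMod p) K] {e : Emb p K}

lemma tabOK_of : ∀ {t₁ t₂ t₃ : Bool}, t₁ ≤ t₂ → t₂ ≤ t₃ → tabOK t₁ t₂ t₃ = true
  | false, false, false, _, _ => tabOK_fff
  | false, false, true, _, _ => tabOK_fft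
  | false, true, true, _, _ => tabOK_ftt
  | true, true, true, _, _ => tabOK_ttt
  | true, false, _, h, _ => absurd h (by decide)
  | _, true, false, _, h => absurd h (by decide)

lemma NQ.chk {A : Fin 4 → SLp p} {t : Fin 4 → Bool} (hp : 5 < p) (h : e.NQ A t) {i j k : Fin 4}
    (hij : i ≠ j) (hik : i ≠ k) (hjk : j ≠ k) {x y z : ℕ} (mx : x ∈ S9) (my : y ∈ S9) (mz : z ∈ S9)
    (hx : e.T (A i * A j) = e.ev (P9 x)) (hy : e.T (A i * A k) = e.ev (P9 y))
    (hz : e.T (A j * A k) = e.ev (P9 z)) : chkD (t i) (t j) (t k) x y z = true ∨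
      (E3 (A i) (A j) (A k) ∧ chkE (tz (t i)) (tz (t j)) (tz (t k)) x y z = true) := by
  have hi := ind3_of h.ind hij hik hjk
  rcases h.trip i j k hij hik hjk with hE | hD
  · obtain ⟨s, H, hH, h1, h2, h3⟩ := id hE
    exact Or.inr ⟨hE, e.chkE_of hH h1 h2 h3 hi (h.hA i) (h.hA j) (h.hA k) mx my mz hx hy hz⟩
  · exact Or.inl (e.chkD_of hp hD hi (h.hA i) (h.hA j) (h.hA k) mx my mz hx hy hz)

lemma NQ.tab {A : Fin 4 → SLp p} {t : Fin 4 → Bool} (hp : 5 < p) (h : e.NQ A t) {i j k : Fin 4}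
    (hij : i ≠ j) (hik : i ≠ k) (hjk : j ≠ k) (tij : t i ≤ t j) (tjk : t j ≤ t k) {x y z : ℕ}
    (mx : x ∈ dom (t i) (t j)) (my : y ∈ dom (t i) (t k)) (mz : z ∈ dom (t j) (t k))
    (hx : e.T (A i * A j) = e.ev (P9 x)) (hy : e.T (A i * A k) = e.ev (P9 y))
    (hz : e.T (A j * A k) = e.ev (P9 z)) : tabT (t i) (t j) (t k) x y z = true := by
  have key := List.all_eq_true.1 (List.all_eq_true.1 (List.all_eq_true.1 (tabOK_of tij tjk) x mx) y my) z mz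
  rw [Bool.or_eq_true] at key
  refine key.resolve_left fun hn => ?_
  rw [Bool.not_eq_true', Bool.or_eq_false_iff] at hn
  rcases h.chk hp hij hik hjk (dom_sub _ _ _ mx) (dom_sub _ _ _ my) (dom_sub _ _ _ mz) hx hy hz with h | ⟨-, h⟩
  · rw [hn.1] at h; cases h
  · rw [hn.2] at h; cases h

lemma NQ.not_swapOK {A : Fin 4 → SLp p} {t : Fin 4 → Bool} (hp : 5 < p) (h : e.NQ A t) {i j k : Fin 4}
    (hij : i ≠ j) (hik : i ≠ k) (hjk : j ≠ k) (hi : i ≠ 3) (hj : j ≠ 3) (hk : k ≠ 3) (ti : t i = false)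
    (tj : t j = false) (tk : t k = false) (t3 : t 3 = true) {xjk xji xj3 xki xk3 xi3 : ℕ}
    (mji : xji ∈ S9) (mj3 : xj3 ∈ S9) (mki : xki ∈ S9) (mk3 : xk3 ∈ S9)
    (hjk' : e.T (A j * A k) = e.ev (P9 xjk)) (hji' : e.T (A j * A i) = e.ev (P9 xji))
    (hj3' : e.T (A j * A 3) = e.ev (P9 xj3)) (hki' : e.T (A k * A i) = e.ev (P9 xki))
    (hk3' : e.T (A k * A 3) = e.ev (P9 xk3)) (hi3' : e.T (A i * A 3) = e.ev (P9 xi3))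
    (hs : swapOK xjk xji xj3 xki xk3 xi3 = true) : False := by
  simp only [swapOK, Bool.and_eq_true, Bool.not_eq_true'] at hs
  obtain ⟨⟨⟨c0, c1⟩, c2⟩, c3⟩ := hs
  obtain rfl := Nat.eq_of_beq_eq_true c0
  have hti : e.T (A i) = (0 : ℤ) := by rw [h.hA, ti]; rfl
  have htj : e.T (A j) = (0 : ℤ) := by rw [h.hA, tj]; rfl
  have htk : e.T (A k) = (0 : ℤ) := by rw [h.hA, tk]; rfl
  have ht3 : e.T (A 3) = (1 : ℤ) := by rw [h.hA, t3]; rfl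
  have root : ∀ {j x y}, j ≠ i → j ≠ 3 → t j = false → x ∈ S9 → y ∈ S9 →
      e.T (A j * A i) = e.ev (P9 x) → e.T (A j * A 3) = e.ev (P9 y) → chkD false false true x y 0 = false →
      ∃ a ∈ S9, e.T (A j * (A i * A 3)) = e.ev (P9 a) ∧ isRoot 0 0 1 (P9 x) (P9 y) (P9 0) (P9 a) = true := by
    intro j x y hji hj3 tj mx my hx hy hc
    rcases h.chk hp hji hj3 hi mx my (show 0 ∈ S9 by simp [S9]) hx hy hi3' with h' | ⟨⟨s, H, hH, h1, h2, h3⟩, -⟩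
    · rw [tj, ti, t3, hc] at h'; cases h'
    have I := ind3_of h.ind hji hj3 hi
    obtain ⟨a, ha, ha'⟩ := SIn.of_mem e hH (mul_mem h1 (mul_mem h2 h3)) (by
      simpa [wd, mul_assoc] using I.word [false, true])
    exact ⟨a, ha, ha', (e.isRoot_of (by rw [h.hA, tj]; rfl) hti ht3 hx.symm hy.symm hi3'.symm ha'.symm).1⟩
  obtain ⟨a, ha, ha', hra⟩ := root hij.symm hj tj mji mj3 hji' hj3' c1
  obtain ⟨b, hb, hb', hrb⟩ := root hik.symm hk tk mki mk3 hki' hk3' c2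
  have c4 := List.all_eq_true.1 c3 a ha
  rw [hra, Bool.not_true, Bool.false_or] at c4
  have c5 := List.all_eq_true.1 c4 b hb
  rw [hrb, Bool.not_true, Bool.false_or] at c5
  have hP0 : e.ev (P9 0) = 0 := by simp [P9, ev, ZR.ev]
  have hP2 : e.ev (P9 2) = -1 := by simp [P9, ev, ZR.ev]
  have cfg : e.Cfg ![A j, A k, A i, A i * A 3] (fun _ => false) ![xjk, xji, a, xki, b, 2] := by
    refine ⟨fun l => ?_, hjk'.symm, hji'.symm, ha'.symm, hki'.symm, hb'.symm, ?_⟩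
    · fin_cases l
      · exact htj
      · exact htk
      · exact hti
      · exact hi3'.trans (by rw [hP0]; simp [tz])
    · change e.ev (P9 2) = e.T (A i * (A i * A 3))
      have h1 := congrArg (algebraMap (ZMod p) K) (tr_mul_mul_self (A i) (A 3))
      rw [map_sub, map_mul] at h1
      change _ = e.T (A i) * _ - e.T (A 3) at h1
      rw [hP2, T, h1, hti, ht3]; simp
  obtain ⟨l, hl, hm⟩ := cfg.of_close hp c5
  have hl0 : l.1 = 0 := (show ∀ l ∈ hints₀, l.1 = 0 by decide) l hl
  rw [hl0] at hm
  refine h.ind j (gen_image_le.2 ⟨neg_one_mem_gen _, fun m hm => ?_⟩ hm)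
  have hmem : ∀ {k}, k ≠ j → A k ∈ gen (A '' {l | l ≠ j}) := fun hk => subset_gen _ ⟨_, hk, rfl⟩
  fin_cases m
  · exact absurd rfl hm
  · exact hmem hjk.symm
  · exact hmem hij
  · exact mul_mem (hmem hij) (hmem hj.symm)

lemma chkAll_of : ∀ {t₀ t₁ t₂ t₃ : Bool}, t₀ ≤ t₁ → t₁ ≤ t₂ → t₂ ≤ t₃ → chkAll t₀ t₁ t₂ t₃ = true
  | true, true, true, true, _, _, _ => chkAll_tttt
  | false, true, true, true, _, _, _ => chkAll_fttt
  | false, false, true, true, _, _, _ => chkAll_fftt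
  | false, false, false, true, _, _, _ => chkAll_ffft
  | false, false, false, false, _, _, _ => chkAll_ffff
  | true, false, _, _, h, _, _ => absurd h (by decide)
  | _, true, false, _, _, h, _ => absurd h (by decide)
  | _, _, true, false, _, _, h => absurd h (by decide)

lemma NQ.false_of_sorted {A : Fin 4 → SLp p} {t : Fin 4 → Bool} (hp : 5 < p) (h : e.NQ A t) (h01 : t 0 ≤ t 1)
    (h12 : t 1 ≤ t 2) (h23 : t 2 ≤ t 3)
    (h0 : ∀ j, 0 ≠ j → ∃ n ∈ dom₀ (t 0) (t j), e.T (A 0 * A j) = e.ev (P9 n)) : False := by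
  obtain ⟨x, mx, hx⟩ := h0 1 (by decide)
  obtain ⟨y, my, hy⟩ := h0 2 (by decide)
  obtain ⟨w, mw, hw⟩ := h0 3 (by decide)
  obtain ⟨z, mz, hz⟩ := h.pair 1 2 (by decide)
  obtain ⟨u, mu, hu⟩ := h.pair 1 3 (by decide)
  obtain ⟨v, mv, hv⟩ := h.pair 2 3 (by decide)
  have dx := dom₀_sub _ _ _ mx
  have dy := dom₀_sub _ _ _ my
  have dw := dom₀_sub _ _ _ mw
  have t1 := h.tab hp (i := 0) (j := 1) (k := 2) (by decide) (by decide) (by decide) h01 h12 dx dy mz hx hy hz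
  have t2 := h.tab hp (i := 0) (j := 1) (k := 3) (by decide) (by decide) (by decide) h01 (h12.trans h23)
    dx dw mu hx hw hu
  have t3 := h.tab hp (i := 0) (j := 2) (k := 3) (by decide) (by decide) (by decide) (h01.trans h12) h23
    dy dw mv hy hw hv
  have t4 := h.tab hp (i := 1) (j := 2) (k := 3) (by decide) (by decide) (by decide) h12 h23 mz mu mv hz hu hv
  have key := chkAll_of h01 h12 h23
  have key := List.all_eq_true.1 (List.all_eq_true.1 (List.all_eq_true.1 key x mx) y my) z mz
  rw [t1, Bool.not_true, Bool.false_or] at key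
  have key := List.all_eq_true.1 (List.all_eq_true.1 key w mw) u mu
  rw [t2, Bool.not_true, Bool.false_or] at key
  have key := List.all_eq_true.1 key v mv
  rw [t3, t4, Bool.not_true, Bool.false_or, Bool.false_or] at key
  simp only [chkCfg, Bool.or_eq_true, Bool.and_eq_true, Bool.not_eq_true'] at key
  have dx' := dom_sub _ _ _ dx
  have dy' := dom_sub _ _ _ dy
  have dw' := dom_sub _ _ _ dw
  have dz' := dom_sub _ _ _ mz
  have du' := dom_sub _ _ _ mu
  have dv' := dom_sub _ _ _ mv
  rcases key with key | ⟨⟨⟨⟨f0, f1⟩, f2⟩, f3⟩, (key | key) | key⟩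
  · have cfg : e.Cfg A t ![x, y, w, z, u, v] :=
      ⟨h.hA, hx.symm, hy.symm, hw.symm, hz.symm, hu.symm, hv.symm⟩
    obtain ⟨l, -, hl⟩ := cfg.of_close hp key
    exact h.ind _ hl
  · exact h.not_swapOK hp (i := 0) (j := 1) (k := 2) (by decide) (by decide) (by decide) (by decide) (by decide)
      (by decide) f0 f1 f2 f3 dx' du' dy' dv' hz ((e.T_mul_comm _ _).trans hx) hu ((e.T_mul_comm _ _).trans hy)
      hv hw key
  · exact h.not_swapOK hp (i := 1) (j := 0) (k := 2) (by decide) (by decide) (by decide) (by decide) (by decide)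
      (by decide) f1 f0 f2 f3 dx' dw' dz' dv' hy hx hw ((e.T_mul_comm _ _).trans hz) hv hu key
  · exact h.not_swapOK hp (i := 2) (j := 0) (k := 1) (by decide) (by decide) (by decide) (by decide) (by decide)
      (by decide) f2 f0 f1 f3 dy' dw' dz' du' hx hy hw hz hu hv key

end Emb

end Quads

section NoQuad

variable {p : ℕ} [Fact p.Prime]

/-- The elements lie in the same subgroups containing `-1`. -/
def Same (a b : SLp p) : Prop := ∀ H : Subgroup (SLp p), -1 ∈ H → (a ∈ H ↔ b ∈ H)

lemma Same.refl (a : SLp p) : Same a a := fun _ _ => Iff.rfl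

lemma Same.neg (a : SLp p) : Same a (-a) := fun _ hH => (neg_mem_iff' hH).symm

lemma Same.inv (a : SLp p) : Same a a⁻¹ := fun _ _ => inv_mem_iff.symm

lemma Same.ind {n : ℕ} {A B : Fin n → SLp p} (h : ∀ i, Same (A i) (B i))
    (ind : ∀ i, A i ∉ gen (A '' {j | j ≠ i})) (i : Fin n) : B i ∉ gen (B '' {j | j ≠ i}) := fun hi => by
  refine ind i (gen_image_le.2 ⟨neg_one_mem_gen _, fun j hj => ?_⟩ ((h i _ (neg_one_mem_gen _)).2 hi))
  exact (h j _ (neg_one_mem_gen _)).1 (subset_gen _ ⟨j, hj, rfl⟩)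

lemma E3.congr {a b c a' b' c' : SLp p} (ha : Same a a') (hb : Same b b') (hc : Same c c')
    (h : E3 a b c) : E3 a' b' c' := by
  obtain ⟨s, H, hH, h1, h2, h3⟩ := h
  exact ⟨s, H, hH, (ha H hH.neg).1 h1, (hb H hH.neg).1 h2, (hc H hH.neg).1 h3⟩

lemma D3.congr {a b c a' b' c' : SLp p} (ha : Same a a') (hb : Same b b') (hc : Same c c')
    (h : D3 a b c) : D3 a' b' c' := by
  obtain ⟨W, hW, hd, h1, h2, h3⟩ := h
  exact ⟨W, hW, hd, (ha _ (neg_one_mem_dih W)).1 h1, (hb _ (neg_one_mem_dih W)).1 h2,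
    (hc _ (neg_one_mem_dih W)).1 h3⟩

namespace Emb

open ZR

variable {K : Type} [Field K] [Algebra (ZMod p) K] {e : Emb p K}

lemma NQ.comp {A : Fin 4 → SLp p} {t : Fin 4 → Bool} (h : e.NQ A t) (σ : Equiv.Perm (Fin 4)) :
    e.NQ (A ∘ σ) (t ∘ σ) where
  hA i := h.hA _
  ind i hi := h.ind (σ i) <| by
    refine gen_mono ?_ hi
    rintro _ ⟨j, hj, rfl⟩
    exact ⟨σ j, fun h => hj (σ.injective h), rfl⟩
  trip i j k hij hik hjk := h.trip _ _ _ (σ.injective.ne hij) (σ.injective.ne hik) (σ.injective.ne hjk)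
  pair i j hij := h.pair _ _ (σ.injective.ne hij)

lemma dom_flip : ∀ s t, ∀ n ∈ dom s t, ∃ m ∈ dom s t,
    eqz (P9 m) ((ofInt (tz s * tz t)).sub (P9 n)) = true := by decide +kernel

lemma dom₀_flip : ∀ s t, ∀ n ∈ dom s t, n ∈ dom₀ s t ∨ ∃ m ∈ dom₀ s t,
    eqz (P9 m) ((ofInt (tz s * tz t)).sub (P9 n)) = true := by decide +kernel

lemma T_inv_mul {a b : SLp p} {s t : Bool} (ha : e.T a = (tz s : ℤ)) (hb : e.T b = (tz t : ℤ)) {m n : ℕ}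
    (h : e.T (a * b) = e.ev (P9 n)) (hm : eqz (P9 m) ((ofInt (tz s * tz t)).sub (P9 n)) = true) :
    e.T (a⁻¹ * b) = e.ev (P9 m) := by
  have := congrArg (algebraMap (ZMod p) K) (tr_inv_mul a b)
  rw [map_sub, map_mul] at this
  change e.T _ = e.T a * e.T b - e.T (a * b) at this
  rw [this, e.ev_eqz hm, ev_sub, ev_ofInt, ha, hb, h]; push_cast; rfl

lemma T_mul_inv {a b : SLp p} {s t : Bool} (ha : e.T a = (tz s : ℤ)) (hb : e.T b = (tz t : ℤ)) {m n : ℕ}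
    (h : e.T (a * b) = e.ev (P9 n)) (hm : eqz (P9 m) ((ofInt (tz s * tz t)).sub (P9 n)) = true) :
    e.T (a * b⁻¹) = e.ev (P9 m) := by
  rw [← T_inv_mul ha hb h hm, T_eq_iff, tr_mul_comm, tr_inv_mul, tr_inv_mul, tr_mul_comm b,
    _root_.mul_comm (tr b)]

lemma NQ.of_inv {A B : Fin 4 → SLp p} {t : Fin 4 → Bool} (h : e.NQ A t)
    (hB : ∀ i, B i = A i ∨ B i = (A i)⁻¹) : e.NQ B t := by
  have hs : ∀ i, Same (A i) (B i) := fun i => by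
    rcases hB i with h | h
    · rw [h]; exact .refl _
    · rw [h]; exact .inv _
  refine ⟨fun i => ?_, Same.ind hs h.ind, fun i j k hij hik hjk => ?_, fun i j hij => ?_⟩
  · rcases hB i with h' | h'
    · rw [h', h.hA]
    · rw [h', ← h.hA i, T_eq_iff, tr_inv]
  · exact (h.trip i j k hij hik hjk).imp (.congr (hs i) (hs j) (hs k)) (.congr (hs i) (hs j) (hs k))
  · obtain ⟨n, hn, hx⟩ := h.pair i j hij
    obtain ⟨m, hm, hm'⟩ := dom_flip _ _ n hn
    rcases hB i with h1 | h1 <;> rcases hB j with h2 | h2 <;> rw [h1, h2]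
    · exact ⟨n, hn, hx⟩
    · exact ⟨m, hm, T_mul_inv (h.hA i) (h.hA j) hx hm'⟩
    · exact ⟨m, hm, T_inv_mul (h.hA i) (h.hA j) hx hm'⟩
    · refine ⟨n, hn, ?_⟩
      rw [← hx, T_eq_iff, ← _root_.mul_inv_rev, tr_inv, tr_mul_comm]

lemma NQ.false {A : Fin 4 → SLp p} {t : Fin 4 → Bool} (hp : 5 < p) (h : e.NQ A t) : False := by
  have h' := h.comp (Tuple.sort t)
  have hm := Tuple.monotone_sort t
  set C := A ∘ Tuple.sort t with hC
  set u := t ∘ Tuple.sort t with hu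
  have key : ∀ j, ∃ b, (b = C j ∨ b = (C j)⁻¹) ∧
      (0 ≠ j → ∃ n ∈ dom₀ (u 0) (u j), e.T (C 0 * b) = e.ev (P9 n)) ∧ (0 = j → b = C j) := by
    intro j
    by_cases hj : 0 = j
    · exact ⟨C j, Or.inl rfl, fun h => absurd hj h, fun _ => rfl⟩
    obtain ⟨n, hn, hx⟩ := h'.pair 0 j hj
    rcases dom₀_flip _ _ n hn with h0 | ⟨m, h0, hm⟩
    · exact ⟨C j, Or.inl rfl, fun _ => ⟨n, h0, hx⟩, fun _ => rfl⟩
    · exact ⟨(C j)⁻¹, Or.inr rfl, fun _ => ⟨m, h0, T_mul_inv (h'.hA 0) (h'.hA j) hx hm⟩,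
        fun h => absurd h hj⟩
  choose B hB hB1 hB2 using key
  refine (h'.of_inv hB).false_of_sorted hp (hm (by decide)) (hm (by decide)) (hm (by decide)) fun j hj => ?_
  rw [hB2 0 rfl]
  exact hB1 j hj

/-- There is no independent quadruple with these properties. -/
theorem no_quad (e : Emb p K) (hp : 5 < p) {A : Fin 4 → SLp p} (ind : ∀ i, A i ∉ gen (A '' {j | j ≠ i}))
    (trip : ∀ i j k, i ≠ j → i ≠ k → j ≠ k → E3 (A i) (A j) (A k) ∨ D3 (A i) (A j) (A k))
    (pair : ∀ i j, i ≠ j → (∃ k, i ≠ k ∧ j ≠ k ∧ E3 (A i) (A j) (A k)) ∨ tr (A i * A j) = 0)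
    (single : ∀ i, ∃ j k, i ≠ j ∧ i ≠ k ∧ j ≠ k ∧ E3 (A i) (A j) (A k)) : False := by
  have key : ∀ i, ∃ b t, Same (A i) b ∧ (b = A i ∨ b = -A i) ∧ e.T b = (tz t : ℤ) := by
    intro i
    obtain ⟨j, k, hij, hik, hjk, s, H, hH, h1, h2, h3⟩ := single i
    rcases e.tr_of_EType hp hH h1 h2 h3 (ind3_of ind hij hik hjk) with h | h
    · exact ⟨A i, false, .refl _, Or.inl rfl, by rw [e.T_eq_zero.2 h]; simp [tz]⟩
    · rcases sq_eq_one_iff.1 h with h | h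
      · exact ⟨A i, true, .refl _, Or.inl rfl, by rw [e.T_eq_one.2 h]; simp [tz]⟩
      · exact ⟨-A i, true, .neg _, Or.inr rfl, by
          rw [e.T_eq_one.2 (by rw [tr_neg, h, neg_neg])]; simp [tz]⟩
  choose B t hs hB hT using key
  have indB := Same.ind hs ind
  refine NQ.false (e := e) hp (A := B) (t := t) ⟨hT, indB, fun i j k hij hik hjk =>
    (trip i j k hij hik hjk).imp (.congr (hs i) (hs j) (hs k)) (.congr (hs i) (hs j) (hs k)), fun i j hij => ?_⟩
  have zero : tr (B i * B j) = 0 → ∃ n ∈ dom (t i) (t j), e.T (B i * B j) = e.ev (P9 n) := fun h =>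
    ⟨0, (show ∀ s t, 0 ∈ dom s t by decide) _ _, by rw [e.T_eq_zero.2 h]; simp [P9, ev, ZR.ev]⟩
  rcases pair i j hij with ⟨k, hik, hjk, hE⟩ | h0
  swap
  · apply zero
    rcases hB i with h1 | h1 <;> rcases hB j with h2 | h2 <;> rw [h1, h2] <;> simp [tr_neg, h0]
  obtain ⟨s, H, hH, h1, h2, h3⟩ := hE.congr (hs i) (hs j) (hs k)
  have hi := ind3_of indB hij hik hjk
  have ht : ∀ {i}, t i = true → tr (B i) = 1 := fun {i} h => by rw [← e.T_eq_one, hT, h]; simp [tz]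
  have one : tr (B i * B j) = 1 → ∃ n ∈ dom (t i) (t j), e.T (B i * B j) = e.ev (P9 n) := fun h =>
    ⟨1, (show ∀ s t, 1 ∈ dom s t by decide) _ _, by rw [e.T_eq_one.2 h]; simp [P9, ev, ZR.ev]⟩
  have neg_one : dom (t i) (t j) = [0, 1, 2] → tr (B i * B j) = -1 →
      ∃ n ∈ dom (t i) (t j), e.T (B i * B j) = e.ev (P9 n) := fun hd h =>
    ⟨2, by rw [hd]; simp, by rw [T, h]; simp [P9, ev, ZR.ev]⟩
  rcases ti : t i <;> rcases tj : t j <;> rw [ti, tj] at zero one neg_one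
  · exact SIn.of_mem e hH (mul_mem h1 h2) hi.not_pm_mul
  · rcases e.tr_mul_of_EType hp hH h1 h2 h3 hi (by rw [ht tj]; exact one_ne_zero) with h | h
    · exact zero h
    · exact (sq_eq_one_iff.1 h).elim one (neg_one rfl)
  · rcases e.tr_mul_of_EType hp hH h2 h1 h3 hi.swap (by rw [ht ti]; exact one_ne_zero) with h | h
    · exact zero (by rw [tr_mul_comm, h])
    · rw [tr_mul_comm] at h
      exact (sq_eq_one_iff.1 h).elim one (neg_one rfl)
  · rcases e.tr_mul_of_EType hp hH h1 h2 h3 hi (by rw [ht tj]; exact one_ne_zero) with h | h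
    · exact zero h
    · rcases sq_eq_one_iff.1 h with h | h
      · exact one h
      · exact absurd h (e.tr_mul_ne_neg_one hp hH h1 h2 hi (ht ti) (ht tj))

end Emb

end NoQuad

section Reduction

variable {p : ℕ} [Fact p.Prime]

lemma exists_ne_three {n : ℕ} (hn : 4 ≤ n) (i j k : Fin n) : ∃ l, l ≠ i ∧ l ≠ j ∧ l ≠ k := by
  by_contra! h
  have : (Finset.univ : Finset (Fin n)) ⊆ {i, j, k} := fun l _ => by
    simp only [Finset.mem_insert, Finset.mem_singleton]
    have := h l
    tauto
  have h1 := Finset.card_le_card this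
  rw [Finset.card_univ, Fintype.card_fin] at h1
  have := h1.trans Finset.card_le_three
  omega

namespace ISeq

variable {n : ℕ} {A : Fin n → SLp p}

lemma mem_gen {i j : Fin n} (h : j ≠ i) : A j ∈ gen (A '' {l | l ≠ i}) := subset_gen _ ⟨j, h, rfl⟩

lemma eq_top (h : ISeq A) {H : Subgroup (SLp p)} (hneg : -1 ∈ H) (hA : ∀ i, A i ∈ H) : H = ⊤ := by
  rw [eq_top_iff, ← h.1, gen_range_le]; exact ⟨hneg, hA⟩

lemma notMem (h : ISeq A) (i : Fin n) : A i ∉ gen (A '' {j | j ≠ i}) := fun hi =>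
  h.2 i (h.eq_top (neg_one_mem_gen _) fun j => by
    by_cases hj : j = i
    · rw [hj]; exact hi
    · exact mem_gen hj)

lemma not_pm (h : ISeq A) (i : Fin n) : ¬ PM (A i) := fun hi => h.notMem i (hi.mem (neg_one_mem_gen _))

lemma not_pm_mul (h : ISeq A) {i j : Fin n} (hij : i ≠ j) : ¬ PM (A i * A j) := fun hpm =>
  h.notMem j (mem_of_pm_mul (neg_one_mem_gen _) (mem_gen hij) hpm)

lemma D_or_E (hp : 5 < p) (hn : 4 ≤ n) (h : ISeq A) (i : Fin n) :
    DType (gen (A '' {j | j ≠ i})) ∨ ∃ s, EType s (gen (A '' {j | j ≠ i})) := by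
  rcases classification hp (neg_one_mem_gen _) (h.2 i) with ⟨v, hv, hP⟩ | hDE
  swap
  · exact hDE
  left
  have hv' : ∀ {j}, j ≠ i → A j ∈ borel v := fun hj => hP (mem_gen hj)
  have no : ∀ {l}, l ≠ i → ¬ gen (A '' {j | j ≠ l}) ≤ borel v := fun {l} hl hle =>
    PType.ne_top ⟨v, hv, le_rfl⟩ (h.eq_top (neg_one_mem_borel v) fun j => by
      by_cases hj : j = i
      · rw [hj]; exact hle (mem_gen hl.symm)
      · exact hv' hj)
  obtain ⟨k, hki, -, -⟩ := exists_ne_three hn i i i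
  refine ⟨ax (A k), ax_trace _, ?_, gen_image_le.2 ⟨neg_one_mem_dih _, fun j hj => ?_⟩⟩
  · rw [ax_det, sub_ne_zero]
    intro ht
    obtain ⟨l, hli, hlk, -⟩ := exists_ne_three hn i k k
    exact no hli (le_borel (neg_one_mem_gen _) (h.2 l) (mem_gen hlk.symm) ht.symm
      (fun h' => h.not_pm k (Or.inl h')) (fun h' => h.not_pm k (Or.inr h')) hv (hv' hki))
  · obtain ⟨l, hli, hlj, hlk⟩ := exists_ne_three hn i j k
    exact mem_dih_ax_of_comm ((comm_or_le_borel hp (neg_one_mem_gen _) (h.2 l) hv (mem_gen hlj.symm)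
      (mem_gen hlk.symm) (hv' hj) (hv' hki)).resolve_right (no hli))

lemma anti_of_DD (hp : 5 < p) (h : ISeq A) {i j k l : Fin n} (hij : i ≠ j) (hki : k ≠ i) (hkj : k ≠ j)
    (hli : l ≠ i) (hlj : l ≠ j) (hkl : k ≠ l) (h1 : DType (gen (A '' {m | m ≠ i})))
    (h2 : DType (gen (A '' {m | m ≠ j}))) :
    tr (A k) = 0 ∧ tr (A l) = 0 ∧ (A k).1 * (A l).1 = -((A l).1 * (A k).1) := by
  obtain ⟨W, hW, hdW, hle⟩ := h1
  obtain ⟨X, hX, hdX, hle'⟩ := h2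
  refine involutions_of_dih_dih hp hW hdW hX hdX ?_ (h.not_pm k) (h.not_pm l) (h.not_pm_mul hkl)
    (hle (mem_gen hki)) (hle (mem_gen hli)) (hle' (mem_gen hkj)) (hle' (mem_gen hlj))
  rintro c rfl
  have hc : c ≠ 0 := by rintro rfl; simp at hdX
  refine DType.ne_top hp ⟨W, hW, hdW, le_rfl⟩ (h.eq_top (neg_one_mem_dih W) fun m => ?_)
  by_cases hm : m = i
  · rw [hm]; exact dih_smul hc (hle' (mem_gen hij))
  · exact hle (mem_gen hm)

lemma tr_mul_of_anti (hp : 5 < p) {a b : SLp p} (h : a.1 * b.1 = -(b.1 * a.1)) : tr (a * b) = 0 := by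
  rw [tr_eq_trace, cmul]; exact trace_of_anticomm hp h

/-- Two dihedral subgroups leave room for only two further elements. -/
lemma not_DD (hp : 5 < p) (hn : 5 ≤ n) (h : ISeq A) {i j : Fin n} (hij : i ≠ j)
    (h1 : DType (gen (A '' {m | m ≠ i}))) (h2 : DType (gen (A '' {m | m ≠ j}))) : False := by
  obtain ⟨k, hki, hkj, -⟩ := exists_ne_three (by omega) i j j
  obtain ⟨l, hli, hlj, hlk⟩ := exists_ne_three (by omega) i j k
  obtain ⟨m, hmi, hmj, hmk, hml⟩ : ∃ m, m ≠ i ∧ m ≠ j ∧ m ≠ k ∧ m ≠ l := by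
    by_contra! hc
    have : (Finset.univ : Finset (Fin n)) ⊆ {i, j, k, l} := fun m _ => by
      simp only [Finset.mem_insert, Finset.mem_singleton]
      have := hc m
      tauto
    have h1 := Finset.card_le_card this
    rw [Finset.card_univ, Fintype.card_fin] at h1
    have := h1.trans Finset.card_le_four
    omega
  obtain ⟨-, -, hkl'⟩ := h.anti_of_DD hp hij hki hkj hli hlj hlk.symm h1 h2
  obtain ⟨tm, -, hmk'⟩ := h.anti_of_DD hp hij hmi hmj hki hkj hmk h1 h2
  obtain ⟨-, -, hml'⟩ := h.anti_of_DD hp hij hmi hmj hli hlj hml h1 h2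
  have ht := tr_mul_of_anti hp hkl'
  have hcom : A m * (A k * A l) = A k * A l * A m := Subtype.ext <| by
    rw [cmul, cmul (A k * A l), cmul (A k), ← mul_assoc, hmk', neg_mul, mul_assoc, hml', mul_neg, neg_neg, mul_assoc]
  have h4 : (0 : ZMod p) ^ 2 ≠ 4 := fun h' =>
    two_ne hp (pow_eq_zero_iff two_ne_zero |>.1 (by linear_combination -h'))
  have := mem_gen_of_comm hp hcom (h.not_pm_mul hlk.symm) (by rw [tm, ht]) (by rw [ht]; exact h4)
  exact h.notMem m (gen_singleton_le (H := gen (A '' {j | j ≠ m})) (neg_one_mem_gen _)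
    (mul_mem (mem_gen hmk.symm) (mem_gen hml.symm)) this)

lemma not_DDD (hp : 5 < p) {A : Fin 4 → SLp p} (h : ISeq A) {i j k l : Fin 4} (hij : i ≠ j) (hik : i ≠ k)
    (hil : i ≠ l) (hjk : j ≠ k) (hjl : j ≠ l) (hkl : k ≠ l) (h1 : DType (gen (A '' {m | m ≠ j})))
    (h2 : DType (gen (A '' {m | m ≠ k}))) (h3 : DType (gen (A '' {m | m ≠ l}))) : False := by
  obtain ⟨ti, -, hl⟩ := h.anti_of_DD hp hjk hij hik hjl.symm hkl.symm hil h1 h2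
  obtain ⟨-, -, hk⟩ := h.anti_of_DD hp hjl hij hil hjk.symm hkl hik h1 h3
  obtain ⟨-, -, hj⟩ := h.anti_of_DD hp hkl hik hil hjk hjl hij h2 h3
  refine DType.ne_top hp ⟨(A i).1, by rw [← tr_eq_trace, ti], by rw [(A i).2]; exact one_ne_zero, le_rfl⟩
    (h.eq_top (neg_one_mem_dih _) fun m => ?_)
  have : m = i ∨ m = j ∨ m = k ∨ m = l := by omega
  rcases this with rfl | rfl | rfl | rfl
  · exact mem_dih.2 (Or.inl rfl)
  · exact Unreplaced.mem_dih_of_anti hj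
  · exact Unreplaced.mem_dih_of_anti hk
  · exact Unreplaced.mem_dih_of_anti hl

lemma false_of_four (hp : 5 < p) {K : Type} [Field K] [Algebra (ZMod p) K] (e : Emb p K)
    {A : Fin 4 → SLp p} (h : ISeq A) : False := by
  have E : ∀ {i j k l : Fin 4} {s}, i ≠ l → j ≠ l → k ≠ l → EType s (gen (A '' {m | m ≠ l})) →
      E3 (A i) (A j) (A k) := fun hi hj hk hE => ⟨_, _, hE, mem_gen hi, mem_gen hj, mem_gen hk⟩
  refine e.no_quad hp h.notMem (fun i j k _ _ _ => ?_) (fun i j hij => ?_) fun i => ?_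
  · obtain ⟨l, hli, hlj, hlk⟩ := exists_ne_three le_rfl i j k
    rcases h.D_or_E hp le_rfl l with ⟨W, hW, hd, hle⟩ | ⟨s, hE⟩
    · exact Or.inr ⟨W, hW, hd, hle (mem_gen hli.symm), hle (mem_gen hlj.symm), hle (mem_gen hlk.symm)⟩
    · exact Or.inl (E hli.symm hlj.symm hlk.symm hE)
  · obtain ⟨k, hki, hkj, -⟩ := exists_ne_three le_rfl i j j
    obtain ⟨l, hli, hlj, hlk⟩ := exists_ne_three le_rfl i j k
    rcases h.D_or_E hp le_rfl l with hl | ⟨s, hE⟩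
    swap
    · exact Or.inl ⟨k, hki.symm, hkj.symm, E hli.symm hlj.symm hlk.symm hE⟩
    rcases h.D_or_E hp le_rfl k with hk | ⟨s, hE⟩
    swap
    · exact Or.inl ⟨l, hli.symm, hlj.symm, E hki.symm hkj.symm hlk hE⟩
    exact Or.inr (tr_mul_of_anti hp
      (h.anti_of_DD hp hlk hli.symm hki.symm hlj.symm hkj.symm hij hl hk).2.2)
  · obtain ⟨j, hji, -, -⟩ := exists_ne_three le_rfl i i i
    obtain ⟨k, hki, hkj, -⟩ := exists_ne_three le_rfl i j j
    obtain ⟨l, hli, hlj, hlk⟩ := exists_ne_three le_rfl i j k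
    rcases h.D_or_E hp le_rfl l with hl | ⟨s, hE⟩
    swap
    · exact ⟨j, k, hji.symm, hki.symm, hkj.symm, E hli.symm hlj.symm hlk.symm hE⟩
    rcases h.D_or_E hp le_rfl k with hk | ⟨s, hE⟩
    swap
    · exact ⟨j, l, hji.symm, hli.symm, hlj.symm, E hki.symm hkj.symm hlk hE⟩
    rcases h.D_or_E hp le_rfl j with hj | ⟨s, hE⟩
    swap
    · exact ⟨k, l, hki.symm, hli.symm, hlk.symm, E hji.symm hkj hlj hE⟩
    exact (h.not_DDD hp hji.symm hki.symm hli.symm hkj.symm hlj.symm hlk.symm hj hk hl).elim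

lemma false_of_five (hp : 5 < p) {K : Type} [Field K] [Algebra (ZMod p) K] (e : Emb p K)
    {m : ℕ} (hm : 4 ≤ m) {A : Fin (m + 1) → SLp p} (h : ISeq A) : False := by
  obtain ⟨i, s, hE⟩ : ∃ i, ∃ s, EType s (gen (A '' {j | j ≠ i})) := by
    by_contra! hc
    have hD : ∀ i, DType (gen (A '' {j | j ≠ i})) := fun i =>
      (h.D_or_E hp (by omega) i).resolve_right fun ⟨s, hs⟩ => hc i s hs
    obtain ⟨j, hj, -, -⟩ := exists_ne_three (by omega) (0 : Fin (m + 1)) 0 0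
    exact h.not_DD hp (by omega) hj (hD j) (hD 0)
  set f : Fin 4 → Fin (m + 1) := fun j => i.succAbove (Fin.castLE hm j)
  have hf : Function.Injective f := Fin.succAbove_right_injective.comp (Fin.castLE_injective hm)
  have hE3 : ∀ j k l, E3 (A (f j)) (A (f k)) (A (f l)) := fun j k l =>
    ⟨s, _, hE, mem_gen (Fin.succAbove_ne _ _), mem_gen (Fin.succAbove_ne _ _), mem_gen (Fin.succAbove_ne _ _)⟩
  refine e.no_quad hp (A := A ∘ f) (fun j hj => h.notMem (f j) (gen_mono ?_ hj))
    (fun j k l _ _ _ => Or.inl (hE3 _ _ _)) (fun j k _ => Or.inl ?_) fun j => ?_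
  · rintro _ ⟨k, hk, rfl⟩
    exact ⟨f k, fun h => hk (hf h), rfl⟩
  · obtain ⟨l, hlj, hlk, -⟩ := exists_ne_three le_rfl j k k
    exact ⟨l, hlj.symm, hlk.symm, hE3 _ _ _⟩
  · obtain ⟨k, hkj, -, -⟩ := exists_ne_three le_rfl j j j
    obtain ⟨l, hlj, hlk, -⟩ := exists_ne_three le_rfl j k k
    exact ⟨k, l, hkj.symm, hlj.symm, hlk.symm, hE3 _ _ _⟩

end ISeq

/-- Irredundant generating sequences have length at most three. -/
theorem not_iseq_of_four_le (hp : 5 < p) (h7 : p ≠ 7) (h11 : p ≠ 11) (h19 : p ≠ 19) (h31 : p ≠ 31) {n : ℕ}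
    (hn : 4 ≤ n) (A : Fin n → SLp p) : ¬ ISeq A := fun h => by
  obtain ⟨e⟩ := exists_emb hp h7 h11 h19 h31
  obtain ⟨m, rfl⟩ := Nat.exists_eq_add_of_le' (show 1 ≤ n by omega)
  rcases Nat.lt_or_ge m 4 with hm | hm
  · obtain rfl : m = 3 := by omega
    exact h.false_of_four hp e
  · exact h.false_of_five hp e hm

end Reduction

end RPSL

theorem psl_replacement_property_iff (p : ℕ) [Fact p.Prime] (hp : 5 < p)
    (h7 : p ≠ 7) (h11 : p ≠ 11) (h19 : p ≠ 19) (h31 : p ≠ 31) :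
    ReplacementProperty (PSL p) ↔
      (p % 8 = 3 ∨ p % 8 = 5) ∧ (p % 10 = 3 ∨ p % 10 = 7) := by
  rw [RPSL.rp_iff_RP3 hp (RPSL.exists_iseq_three hp) fun _ hn =>
    RPSL.not_iseq_of_four_le hp h7 h11 h19 h31 hn]
  exact ⟨RPSL.mod_of_RP3 hp h7 h11 h19, fun h => RPSL.RP3_of_mod hp h.1 h.2⟩
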